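/- arXiv:2303.09069 — 4 statements merged into one kernel-verified Lean document; each statement's English description precedes it below -/
import Mathlib

section
/- Theorem (below-the-line ASW identities for τ = 0). For integers 0 ≤ a,b ≤ k define ℱ_{a,b;k}(q) := Σ over λ_1 ≥ ⋯ ≥ λ_k ≥ 0 and μ_1 ≥ ⋯ ≥ μ_k ≥ 0 of [(1 − q^{λ_a+μ_b+1})/(1−q)] · q^{Σ_{i=1}^k(λ_i²−λ_iμ_i+μ_i²)+Σ_{i=a+1}^k λ_i+Σ_{i=b+1}^k μ_i} / [∏_{i=1}^{k−1}(q;q)_{λ_i−λ_{i+1}}(q;q)_{μ_i−μ_{i+1}}] · g_{λ_k,μ_k;0}(q), with the convention q^{λ_0} = q^{μ_0} := 0. Let a,b,k be integers such that 2 ≤ k < a ≤ ⌊3k/2⌋ and 0 ≤ b ≤ 3k−2a, and set K := 3k+3. Then ℱ_{2k−a, a+b−k; k}(q) − q^{b+1} ℱ_{2k−a−b−1, a−k−1; k}(q) = (q^K;q^K)_∞²/(q;q)_∞³ · θ(q^{a+1}, q^{b+1}, q^{a+b+2}; q^K), as formal power series in q. -/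
noncomputable section

namespace Stmt6

/-- `(a; q)_n`, the finite q-Pochhammer symbol. -/
def qPoch (a q : ℂ) (n : ℕ) : ℂ := ∏ j ∈ Finset.range n, (1 - a * q ^ j)

/-- `(a; q)_∞`. -/
def qPochInf (a q : ℂ) : ℂ := ∏' j : ℕ, (1 - a * q ^ j)

/-- `1/(q;q)_n` for `n : ℤ`, with the convention that it vanishes for `n < 0`. -/
def qFacInv (q : ℂ) (n : ℤ) : ℂ := if 0 ≤ n then (qPoch q q n.toNat)⁻¹ else 0

/-- The modified theta function `θ(z; q) = (z;q)_∞ (q/z;q)_∞`. -/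
def theta (z q : ℂ) : ℂ := qPochInf z q * qPochInf (q / z) q

/-- The q-binomial coefficient, vanishing unless `0 ≤ m ≤ n`. -/
def qBinom (q : ℂ) (n m : ℤ) : ℂ :=
  if 0 ≤ m ∧ m ≤ n then
    qPoch q q n.toNat / (qPoch q q m.toNat * qPoch q q (n - m).toNat)
  else 0

/-- `g_{n,m;0}(q) = [n+m,n]_{q³}/((q;q)_{n+m}(q²;q)_{n+m})`. -/
def g0 (q : ℂ) (n m : ℕ) : ℂ :=
  qBinom (q ^ 3) (n + m) n / (qPoch q q (n + m) * qPoch (q ^ 2) q (n + m))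

/-- `f₁, …, f_k` read as a sequence indexed by `1, …, k` and extended by zero. -/
def nth {k : ℕ} (f : Fin k → ℕ) (i : ℕ) : ℕ :=
  if h : 1 ≤ i ∧ i ≤ k then f ⟨i - 1, by omega⟩ else 0

/-- Decreasing sequences `λ_1 ≥ λ_2 ≥ ⋯ ≥ λ_k ≥ 0` of nonnegative integers. -/
def Decr (k : ℕ) : Type := {f : Fin k → ℕ // ∀ i j : Fin k, i ≤ j → f j ≤ f i}

/-- The multisum `ℱ_{a,b;k}(q)` (for `τ = 0`), with the convention
`q^{λ_0} = q^{μ_0} := 0`. -/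
def Fab (q : ℂ) (a b k : ℕ) : ℂ :=
  ∑' p : Decr k × Decr k,
    (1 - (if a = 0 ∨ b = 0 then (0 : ℂ) else
        q ^ (nth p.1.1 a + nth p.2.1 b + 1))) / (1 - q) *
      q ^ ((∑ i ∈ Finset.Icc 1 k,
              (nth p.1.1 i ^ 2 + nth p.2.1 i ^ 2 - nth p.1.1 i * nth p.2.1 i)) +
            (∑ i ∈ Finset.Icc (a + 1) k, nth p.1.1 i) +
            (∑ i ∈ Finset.Icc (b + 1) k, nth p.2.1 i)) *
      (∏ i ∈ Finset.Icc 1 (k - 1),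
        qFacInv q ((nth p.1.1 i : ℤ) - (nth p.1.1 (i + 1) : ℤ)) *
          qFacInv q ((nth p.2.1 i : ℤ) - (nth p.2.1 (i + 1) : ℤ))) *
      g0 q (nth p.1.1 k) (nth p.2.1 k)

section Basic

variable {q : ℂ}

lemma qPoch_succ (a q : ℂ) (n : ℕ) : qPoch a q (n + 1) = qPoch a q n * (1 - a * q ^ n) := by
  simp [qPoch, Finset.prod_range_succ]

@[simp] lemma qPoch_zero (a q : ℂ) : qPoch a q 0 = 1 := by simp [qPoch]

lemma one_sub_pow_ne_zero (hq : ‖q‖ < 1) {n : ℕ} (hn : n ≠ 0) : 1 - q ^ n ≠ 0 := by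
  intro h
  have h1 : ‖q ^ n‖ < 1 := by
    rw [norm_pow]
    exact pow_lt_one₀ (norm_nonneg q) hq hn
  rw [← sub_eq_zero.mp h] at h1
  simp at h1

lemma qPoch_self_succ (q : ℂ) (n : ℕ) : qPoch q q (n + 1) = qPoch q q n * (1 - q ^ (n + 1)) := by
  rw [qPoch_succ, pow_succ']

lemma qPoch_self_ne_zero (hq : ‖q‖ < 1) (n : ℕ) : qPoch q q n ≠ 0 := by
  induction n with
  | zero => simp
  | succ n ih =>
    rw [qPoch_self_succ]
    exact mul_ne_zero ih (one_sub_pow_ne_zero hq n.succ_ne_zero)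

lemma qFacInv_natCast (q : ℂ) (n : ℕ) : qFacInv q n = (qPoch q q n)⁻¹ := by
  simp [qFacInv]

lemma qFacInv_of_neg {z : ℤ} (hz : z < 0) : qFacInv q z = 0 := by
  simp [qFacInv, not_le.mpr hz]

@[simp] lemma qFacInv_zero (q : ℂ) : qFacInv q 0 = 1 := by
  simp [qFacInv]

lemma nonneg_of_qFacInv_ne_zero {z : ℤ} (h : qFacInv q z ≠ 0) : 0 ≤ z := by
  by_contra hz
  exact h (qFacInv_of_neg (not_le.mp hz))

lemma qFacInv_sub_one (hq : ‖q‖ < 1) (z : ℤ) :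
    qFacInv q (z - 1) = (1 - q ^ z) * qFacInv q z := by
  rcases lt_trichotomy z 0 with h | rfl | h
  · rw [qFacInv_of_neg h, qFacInv_of_neg (by omega), mul_zero]
  · rw [qFacInv_of_neg (by omega)]
    simp
  · obtain ⟨n, rfl⟩ : ∃ n : ℕ, z = (n + 1 : ℕ) := ⟨(z - 1).toNat, by omega⟩
    rw [show ((n + 1 : ℕ) : ℤ) - 1 = (n : ℕ) by push_cast; ring, qFacInv_natCast,
      qFacInv_natCast, zpow_natCast, qPoch_self_succ]
    have h1 := qPoch_self_ne_zero hq n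
    have h2 := one_sub_pow_ne_zero hq n.succ_ne_zero
    field_simp

lemma qFacInv_eq_succ (hq : ‖q‖ < 1) (z : ℤ) :
    qFacInv q z = (1 - q ^ (z + 1)) * qFacInv q (z + 1) := by
  simpa using qFacInv_sub_one hq (z + 1)

/-- A function on `ℤ` vanishing off a bounded interval is summable. -/
lemma summable_int_of_bounded {f : ℤ → ℂ} (a b : ℤ) (h : ∀ i, f i ≠ 0 → a ≤ i ∧ i ≤ b) :
    Summable f :=
  summable_of_ne_finset_zero (s := Finset.Icc a b) fun i hi => by
    by_contra hne
    exact hi (Finset.mem_Icc.mpr (h i hne))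

lemma qFacInv_vandermonde_aux (hq : ‖q‖ < 1) (hq0 : q ≠ 0) (n : ℕ) (M : ℤ) :
    ∑' i : ℤ, q ^ (i * (i + M)) * (qFacInv q i * qFacInv q (i + M) * qFacInv q (n - i)) =
      qFacInv q n * qFacInv q (n + M) := by
  have hs : ∀ (N M : ℤ), Summable fun i : ℤ =>
      q ^ (i * (i + M)) * (qFacInv q i * qFacInv q (i + M) * qFacInv q (N - i)) := by
    intro N M
    refine summable_int_of_bounded 0 N fun i hi => ?_
    simp only [ne_eq, mul_eq_zero, not_or] at hi
    have h1 := nonneg_of_qFacInv_ne_zero hi.2.1.1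
    have h2 := nonneg_of_qFacInv_ne_zero hi.2.2
    omega
  induction n generalizing M with
  | zero =>
    rw [tsum_eq_single 0]
    · simp
    · intro i hi
      rcases lt_or_gt_of_ne hi with h | h
      · simp [qFacInv_of_neg h]
      · simp [qFacInv_of_neg (show -i < 0 by omega)]
  | succ n ih =>
    have key : (1 - q ^ ((n : ℤ) + 1)) * ∑' i : ℤ, q ^ (i * (i + M)) *
        (qFacInv q i * qFacInv q (i + M) * qFacInv q (((n + 1 : ℕ) : ℤ) - i)) =
        ∑' i : ℤ, q ^ (i * (i + M)) * (qFacInv q i * qFacInv q (i + M) * qFacInv q (n - i)) +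
        q ^ ((n : ℤ) + M + 1) * ∑' i : ℤ, q ^ (i * (i + (M + 1))) *
          (qFacInv q i * qFacInv q (i + (M + 1)) * qFacInv q (n - i)) := by
      have e1 : ∑' i : ℤ, q ^ (i * (i + (M + 1))) *
          (qFacInv q i * qFacInv q (i + (M + 1)) * qFacInv q (n - i)) =
          ∑' i : ℤ, q ^ ((i - 1) * (i + M)) *
          (qFacInv q (i - 1) * qFacInv q (i + M) * qFacInv q (n + 1 - i)) := by
        rw [← (Equiv.subRight (1 : ℤ)).tsum_eq]
        refine tsum_congr fun i => ?_
        simp only [Equiv.subRight_apply]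
        congr 3 <;> ring_nf
      have hs2 : Summable fun i : ℤ => q ^ ((i - 1) * (i + M)) *
          (qFacInv q (i - 1) * qFacInv q (i + M) * qFacInv q (n + 1 - i)) := by
        refine summable_int_of_bounded 1 (n + 1) fun i hi => ?_
        simp only [ne_eq, mul_eq_zero, not_or] at hi
        have h1 := nonneg_of_qFacInv_ne_zero hi.2.1.1
        have h2 := nonneg_of_qFacInv_ne_zero hi.2.2
        omega
      rw [e1, ← tsum_mul_left, ← tsum_mul_left, ← (hs n M).tsum_add (hs2.mul_left _)]
      refine tsum_congr fun i => ?_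
      have h1 := qFacInv_sub_one hq (n + 1 - i)
      rw [show (n : ℤ) + 1 - i - 1 = n - i by ring] at h1
      rw [h1, qFacInv_sub_one hq i]
      push_cast
      have h2 : q ^ ((n : ℤ) + 1) = q ^ (n + 1 - i) * q ^ i := by
        rw [← zpow_add₀ hq0]; congr 1; ring
      have h3 : q ^ ((n : ℤ) + M + 1) * q ^ ((i - 1) * (i + M)) =
          q ^ (i * (i + M)) * q ^ (n + 1 - i) := by
        rw [← zpow_add₀ hq0, ← zpow_add₀ hq0]; congr 1; ring
      rw [h2]
      linear_combination (-(1 - q ^ i) * qFacInv q i * qFacInv q (i + M) *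
        qFacInv q (n + 1 - i)) * h3
    rw [ih, ih] at key
    have hne : (1 - q ^ ((n : ℤ) + 1)) ≠ 0 := by
      exact_mod_cast one_sub_pow_ne_zero hq n.succ_ne_zero
    apply mul_left_cancel₀ hne
    rw [key, qFacInv_eq_succ hq (n : ℤ), qFacInv_eq_succ hq ((n : ℤ) + M)]
    push_cast
    rw [show (n : ℤ) + (M + 1) = n + M + 1 by ring, show (n : ℤ) + 1 + M = n + M + 1 by ring]
    ring

/-- The `q`-Vandermonde summation in its confluent form, for reciprocals of `q`-factorials. -/
lemma qFacInv_vandermonde (hq : ‖q‖ < 1) (hq0 : q ≠ 0) (N M : ℤ) :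
    ∑' i : ℤ, q ^ (i * (i + M)) * (qFacInv q i * qFacInv q (i + M) * qFacInv q (N - i)) =
      qFacInv q N * qFacInv q (N + M) := by
  rcases lt_or_ge N 0 with h | h
  · rw [qFacInv_of_neg h, zero_mul]
    convert tsum_zero with i
    rcases lt_or_ge i 0 with h1 | h1
    · simp [qFacInv_of_neg h1]
    · simp [qFacInv_of_neg (show N - i < 0 by omega)]
  · lift N to ℕ using h
    exact qFacInv_vandermonde_aux hq hq0 N M

lemma qFacInv_vandermonde_two_aux (hq : ‖q‖ < 1) (hq0 : q ≠ 0) (n m : ℕ) (A : ℤ) :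
    ∑' i : ℤ, q ^ (i * (i + A)) * (qFacInv q i * qFacInv q (A + i) * qFacInv q (n - i) *
        qFacInv q (m - A - i)) =
      qFacInv q n * qFacInv q m * qFacInv q (n + A) * qFacInv q (m - A) * qPoch q q (n + m) := by
  have hs : ∀ (N A : ℤ), Summable fun i : ℤ =>
      q ^ (i * (i + A)) * (qFacInv q i * qFacInv q (A + i) * qFacInv q (N - i) *
        qFacInv q (m - A - i)) := by
    intro N M
    refine summable_int_of_bounded 0 N fun i hi => ?_
    simp only [ne_eq, mul_eq_zero, not_or] at hi
    have h1 := nonneg_of_qFacInv_ne_zero hi.2.1.1.1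
    have h2 := nonneg_of_qFacInv_ne_zero hi.2.1.2
    omega
  induction n generalizing A with
  | zero =>
    rw [tsum_eq_single 0]
    · have := qPoch_self_ne_zero hq m
      simp only [qFacInv_natCast]
      simp
      field_simp
    · intro i hi
      rcases lt_or_gt_of_ne hi with h | h
      · simp [qFacInv_of_neg h]
      · simp [qFacInv_of_neg (show -i < 0 by omega)]
  | succ n ih =>
    have key : (1 - q ^ ((n : ℤ) + 1)) * ∑' i : ℤ, q ^ (i * (i + A)) *
        (qFacInv q i * qFacInv q (A + i) * qFacInv q (((n + 1 : ℕ) : ℤ) - i) *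
          qFacInv q (m - A - i)) =
        ∑' i : ℤ, q ^ (i * (i + A)) * (qFacInv q i * qFacInv q (A + i) * qFacInv q (n - i) *
          qFacInv q (m - A - i)) +
        q ^ ((n : ℤ) + A + 1) * ∑' i : ℤ, q ^ (i * (i + (A + 1))) *
          (qFacInv q i * qFacInv q (A + 1 + i) * qFacInv q (n - i) *
          qFacInv q (m - (A + 1) - i)) := by
      have e1 : ∑' i : ℤ, q ^ (i * (i + (A + 1))) *
          (qFacInv q i * qFacInv q (A + 1 + i) * qFacInv q (n - i) *
          qFacInv q (m - (A + 1) - i)) =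
          ∑' i : ℤ, q ^ ((i - 1) * (i + A)) *
          (qFacInv q (i - 1) * qFacInv q (A + i) * qFacInv q (n + 1 - i) *
          qFacInv q (m - A - i)) := by
        rw [← (Equiv.subRight (1 : ℤ)).tsum_eq]
        refine tsum_congr fun i => ?_
        simp only [Equiv.subRight_apply]
        congr 3 <;> ring_nf
      have hs2 : Summable fun i : ℤ => q ^ ((i - 1) * (i + A)) *
          (qFacInv q (i - 1) * qFacInv q (A + i) * qFacInv q (n + 1 - i) *
          qFacInv q (m - A - i)) := by
        refine summable_int_of_bounded 1 (n + 1) fun i hi => ?_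
        simp only [ne_eq, mul_eq_zero, not_or] at hi
        have h1 := nonneg_of_qFacInv_ne_zero hi.2.1.1.1
        have h2 := nonneg_of_qFacInv_ne_zero hi.2.1.2
        omega
      rw [e1, ← tsum_mul_left, ← tsum_mul_left, ← (hs n A).tsum_add (hs2.mul_left _)]
      refine tsum_congr fun i => ?_
      have h1 := qFacInv_sub_one hq (n + 1 - i)
      rw [show (n : ℤ) + 1 - i - 1 = n - i by ring] at h1
      rw [h1, qFacInv_sub_one hq i]
      push_cast
      have h2 : q ^ ((n : ℤ) + 1) = q ^ (n + 1 - i) * q ^ i := by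
        rw [← zpow_add₀ hq0]; congr 1; ring
      have h3 : q ^ ((n : ℤ) + A + 1) * q ^ ((i - 1) * (i + A)) =
          q ^ (i * (i + A)) * q ^ (n + 1 - i) := by
        rw [← zpow_add₀ hq0, ← zpow_add₀ hq0]; congr 1; ring
      rw [h2]
      linear_combination (-(1 - q ^ i) * qFacInv q i * qFacInv q (A + i) *
        qFacInv q (n + 1 - i) * qFacInv q (m - A - i)) * h3
    rw [ih, ih] at key
    have hne : (1 - q ^ ((n : ℤ) + 1)) ≠ 0 := by
      exact_mod_cast one_sub_pow_ne_zero hq n.succ_ne_zero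
    apply mul_left_cancel₀ hne
    rw [key, qFacInv_eq_succ hq (n : ℤ), qFacInv_eq_succ hq ((n : ℤ) + A),
      show n + 1 + m = n + m + 1 by ring, qPoch_self_succ,
      show (m : ℤ) - (A + 1) = m - A - 1 by ring, qFacInv_sub_one hq ((m : ℤ) - A)]
    push_cast
    rw [show (n : ℤ) + (A + 1) = n + A + 1 by ring, show (n : ℤ) + 1 + A = n + A + 1 by ring]
    have h4 : q ^ ((n : ℤ) + A + 1) * q ^ ((m : ℤ) - A) = q ^ (n + m + 1) := by
      rw [← zpow_add₀ hq0, ← zpow_natCast]; congr 1; push_cast; ring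
    linear_combination (-(1 - q ^ ((n : ℤ) + 1)) * qFacInv q (n + 1) * qFacInv q m *
      qFacInv q (n + A + 1) * qFacInv q (m - A) * qPoch q q (n + m)) * h4

/-- The `q`-Vandermonde summation, for reciprocals of `q`-factorials. -/
lemma qFacInv_vandermonde_two (hq : ‖q‖ < 1) (hq0 : q ≠ 0) (n m : ℤ) (A : ℤ) :
    ∑' i : ℤ, q ^ (i * (i + A)) * (qFacInv q i * qFacInv q (A + i) * qFacInv q (n - i) *
        qFacInv q (m - A - i)) =
      qFacInv q n * qFacInv q m * qFacInv q (n + A) * qFacInv q (m - A) *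
        qPoch q q (n + m).toNat := by
  rcases lt_or_ge n 0 with h | h
  · rw [qFacInv_of_neg h]
    simp only [zero_mul]
    convert tsum_zero with i
    rcases lt_or_ge i 0 with h1 | h1
    · simp [qFacInv_of_neg h1]
    · simp [qFacInv_of_neg (show n - i < 0 by omega)]
  rcases lt_or_ge m 0 with h' | h'
  · rw [qFacInv_of_neg h']
    simp only [zero_mul, mul_zero]
    convert tsum_zero with i
    rcases lt_or_ge (A + i) 0 with h1 | h1
    · simp [qFacInv_of_neg h1]
    · simp [qFacInv_of_neg (show m - A - i < 0 by omega)]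
  · lift n to ℕ using h
    lift m to ℕ using h'
    rw [qFacInv_vandermonde_two_aux hq hq0]
    congr 2

end Basic

section Bailey

variable {q : ℂ}

/-- A function on `ℤ × ℤ` vanishing off a bounded box is summable. -/
lemma summable_int_prod_of_bounded {f : ℤ × ℤ → ℂ} (a b : ℤ)
    (h : ∀ p, f p ≠ 0 → (a ≤ p.1 ∧ p.1 ≤ b) ∧ (a ≤ p.2 ∧ p.2 ≤ b)) : Summable f :=
  summable_of_ne_finset_zero (s := Finset.Icc a b ×ˢ Finset.Icc a b) fun p hp => by
    by_contra hne
    exact hp (by simpa only [Finset.mem_product, Finset.mem_Icc] using h p hne)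

lemma qPoch_mul_qFacInv_expand (hq : ‖q‖ < 1) (hq0 : q ≠ 0) (r s A : ℤ) :
    qPoch q q (r + s).toNat * qFacInv q r * qFacInv q s * qFacInv q (r + A) * qFacInv q (s - A) =
      ∑' i : ℤ, q ^ ((s - A - i) * (r - i)) *
        (qFacInv q i * qFacInv q (r - i) * qFacInv q (A + i) * qFacInv q (s - A - i)) := by
  have h := qFacInv_vandermonde_two hq hq0 r s (s - A - r)
  rw [show r + (s - A - r) = s - A by ring, show s - (s - A - r) = r + A by ring] at h
  trans qFacInv q r * qFacInv q s * qFacInv q (s - A) * qFacInv q (r + A) *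
    qPoch q q (r + s).toNat
  · ring
  rw [← h, ← (Equiv.subLeft r).tsum_eq]
  refine tsum_congr fun i => ?_
  simp only [Equiv.subLeft_apply]
  rw [show (r - i) * (r - i + (s - A - r)) = (s - A - i) * (r - i) by ring,
    show s - A - r + (r - i) = s - A - i by ring, show r - (r - i) = i by ring,
    show r + A - (r - i) = A + i by ring]
  ring

lemma tsum_bailey_fst (hq : ‖q‖ < 1) (hq0 : q ≠ 0) (n B i : ℤ) :
    ∑' r : ℤ, q ^ (r ^ 2 + B * r - i * r) *
      (qFacInv q (n - r) * qFacInv q (r - i) * qFacInv q (r + B)) =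
      q ^ (B * i) * (qFacInv q (n - i) * qFacInv q (n + B)) := by
  have h := qFacInv_vandermonde hq hq0 (n - i) (i + B)
  rw [show n - i + (i + B) = n + B by ring] at h
  rw [← h, ← tsum_mul_left, ← (Equiv.addRight i).tsum_eq]
  refine tsum_congr fun r => ?_
  simp only [Equiv.coe_addRight]
  rw [show (r + i) ^ 2 + B * (r + i) - i * (r + i) = B * i + r * (r + (i + B)) by ring,
    zpow_add₀ hq0, show n - (r + i) = n - i - r by ring, show r + i - i = r by ring,
    show r + i + B = r + (i + B) by ring]
  ring

/-- The two-variable summation underlying the `A₂` Bailey lemma. -/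
lemma tsum_bailey (hq : ‖q‖ < 1) (hq0 : q ≠ 0) (n m A B : ℤ) :
    ∑' r : ℤ, ∑' s : ℤ, q ^ (r ^ 2 - r * s + s ^ 2 + (A + B) * (r - s)) *
      (qFacInv q (n - r) * qFacInv q (m - s) *
        (qPoch q q (r + s).toNat * qFacInv q r * qFacInv q s * qFacInv q (r + A) *
          qFacInv q (s - A)) * qFacInv q (r + B) * qFacInv q (s - B)) =
      q ^ (-(A * B)) * (qPoch q q (n + m).toNat * qFacInv q n * qFacInv q (n + A) *
        qFacInv q (n + B) * qFacInv q m * qFacInv q (m - A) * qFacInv q (m - B)) := by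
  set f : ℤ → ℤ → ℂ := fun i r => q ^ (r ^ 2 + B * r - i * r) *
      (qFacInv q (n - r) * qFacInv q (r - i) * qFacInv q (r + B)) with hf
  set g : ℤ → ℤ → ℂ := fun i s => q ^ (s ^ 2 + (-B) * s - (A + i) * s) *
      (qFacInv q (m - s) * qFacInv q (s - (A + i)) * qFacInv q (s + -B)) with hg
  set P : ℤ → ℂ := fun i => q ^ (i * (i + A)) * (qFacInv q i * qFacInv q (A + i)) with hP
  have expand : ∀ r s : ℤ, q ^ (r ^ 2 - r * s + s ^ 2 + (A + B) * (r - s)) *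
      (qFacInv q (n - r) * qFacInv q (m - s) *
        (qPoch q q (r + s).toNat * qFacInv q r * qFacInv q s * qFacInv q (r + A) *
          qFacInv q (s - A)) * qFacInv q (r + B) * qFacInv q (s - B)) =
      ∑' i : ℤ, P i * f i r * g i s := by
    intro r s
    rw [qPoch_mul_qFacInv_expand hq hq0]
    rw [← tsum_mul_left, ← tsum_mul_right, ← tsum_mul_right, ← tsum_mul_left]
    refine tsum_congr fun i => ?_
    have h : q ^ (r ^ 2 - r * s + s ^ 2 + (A + B) * (r - s)) * q ^ ((s - A - i) * (r - i)) =
        q ^ (i * (i + A)) * q ^ (r ^ 2 + B * r - i * r) *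
          q ^ (s ^ 2 + (-B) * s - (A + i) * s) := by
      rw [← zpow_add₀ hq0, ← zpow_add₀ hq0, ← zpow_add₀ hq0]; congr 1; ring
    simp only [hf, hg, hP]
    rw [show s - (A + i) = s - A - i by ring, show s + -B = s - B by ring]
    linear_combination (qFacInv q (n - r) * qFacInv q (m - s) * (qFacInv q i * qFacInv q (r - i) *
      qFacInv q (A + i) * qFacInv q (s - A - i)) * qFacInv q (r + B) * qFacInv q (s - B)) * h
  have supp : ∀ i r s, P i * f i r * g i s ≠ 0 →
      0 ≤ i ∧ i ≤ n ∧ 0 ≤ r ∧ r ≤ n ∧ i + A ≤ s ∧ s ≤ m ∧ 0 ≤ A + i := by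
    intro i r s h
    simp only [hf, hg, hP, ne_eq, mul_eq_zero, not_or] at h
    have h1 := nonneg_of_qFacInv_ne_zero h.1.1.2.1
    have h2 := nonneg_of_qFacInv_ne_zero h.1.1.2.2
    have h3 := nonneg_of_qFacInv_ne_zero h.1.2.2.1.1
    have h4 := nonneg_of_qFacInv_ne_zero h.1.2.2.1.2
    have h5 := nonneg_of_qFacInv_ne_zero h.2.2.1.1
    have h6 := nonneg_of_qFacInv_ne_zero h.2.2.1.2
    omega
  have swap1 : ∀ r, ∑' s : ℤ, ∑' i : ℤ, P i * f i r * g i s =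
      ∑' i : ℤ, ∑' s : ℤ, P i * f i r * g i s := by
    intro r
    refine Summable.tsum_comm (f := fun i s => P i * f i r * g i s) ?_
    refine summable_int_prod_of_bounded (min 0 (A)) (max n m) fun p hp => ?_
    have := supp _ _ _ hp
    simp only [le_max_iff, min_le_iff]
    omega
  have swap2 : ∑' r : ℤ, ∑' i : ℤ, P i * f i r * ∑' s : ℤ, g i s =
      ∑' i : ℤ, ∑' r : ℤ, P i * f i r * ∑' s : ℤ, g i s := by
    refine Summable.tsum_comm (f := fun i r => P i * f i r * ∑' s : ℤ, g i s) ?_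
    refine summable_int_prod_of_bounded 0 n fun p hp => ?_
    have hp' : P p.1 * f p.1 p.2 ≠ 0 := left_ne_zero_of_mul hp
    simp only [hf, hP, ne_eq, mul_eq_zero, not_or] at hp'
    have h1 := nonneg_of_qFacInv_ne_zero hp'.1.2.1
    have h3 := nonneg_of_qFacInv_ne_zero hp'.2.2.1.1
    have h4 := nonneg_of_qFacInv_ne_zero hp'.2.2.1.2
    omega
  simp_rw [expand, swap1, tsum_mul_left]
  rw [swap2]
  simp_rw [tsum_mul_right, tsum_mul_left, hf, hg]
  simp_rw [tsum_bailey_fst hq hq0]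
  have hV := qFacInv_vandermonde_two hq hq0 n m A
  trans q ^ (-(A * B)) * qFacInv q (n + B) * qFacInv q (m - B) *
    ∑' i : ℤ, q ^ (i * (i + A)) * (qFacInv q i * qFacInv q (A + i) * qFacInv q (n - i) *
        qFacInv q (m - A - i))
  · rw [← tsum_mul_left]
    refine tsum_congr fun i => ?_
    have h : q ^ (B * i) * q ^ (-B * (A + i)) = q ^ (-(A * B)) := by
      rw [← zpow_add₀ hq0]; congr 1; ring
    rw [show m - (A + i) = m - A - i by ring, show m + -B = m - B by ring]
    simp only [hP]
    linear_combination (q ^ (i * (i + A)) * (qFacInv q i * qFacInv q (A + i)) *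
      (qFacInv q (n - i) * qFacInv q (n + B)) * (qFacInv q (m - A - i) * qFacInv q (m - B))) * h
  · rw [hV]; ring

/-- The kernel of the `A₂` Bailey transform. -/
def ker (q : ℂ) (c : ℕ) (X Y Z : ℤ) (n m : ℕ) : ℂ :=
  qPoch q q (n + m + c) * (qFacInv q (n + X) * qFacInv q (n + Y) * qFacInv q (n + Z)) *
    (qFacInv q (m + c - X) * qFacInv q (m + c - Y) * qFacInv q (m + c - Z))

/-- One step of the `A₂` Bailey chain, with weight `q^{c r + d s}`. -/
def step (q : ℂ) (c d : ℕ) (f : ℕ → ℕ → ℂ) (n m : ℕ) : ℂ :=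
  ∑ r ∈ Finset.range (n + 1), ∑ s ∈ Finset.range (m + 1),
    q ^ (r ^ 2 + s ^ 2 - r * s + c * r + d * s) * qFacInv q ((n : ℤ) - r) *
      qFacInv q ((m : ℤ) - s) * f r s

lemma sum_range_eq_tsum_int {h : ℤ → ℂ} (n : ℕ) (hh : ∀ i, h i ≠ 0 → 0 ≤ i ∧ i ≤ n) :
    ∑ i ∈ Finset.range (n + 1), h i = ∑' i : ℤ, h i := by
  rw [tsum_eq_sum (s := (Finset.range (n + 1)).map Nat.castEmbedding), Finset.sum_map]
  · rfl
  · intro i hi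
    by_contra hne
    obtain ⟨h0, h1⟩ := hh i hne
    apply hi
    simp only [Finset.mem_map, Finset.mem_range, Nat.castEmbedding_apply]
    exact ⟨i.toNat, by omega, by omega⟩

lemma step_ker_aux (hq : ‖q‖ < 1) (hq0 : q ≠ 0) (n m c d e : ℕ) (X Y Z : ℤ)
    (hd : (d : ℤ) = X + Y + Z - c) (he : (e : ℤ) = 2 * c - (X + Y + Z))
    (hX : c ≤ X) (hZ : Z ≤ 0) :
    step q d e (ker q c X Y Z) n m =
      q ^ ((X + Y + Z) * c - c ^ 2 - (X * Y + X * Z + Y * Z)) * ker q c X Y Z n m := by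
  have hb := tsum_bailey hq hq0 (n + Z) (m + c - Z) (X - Z) (Y - Z)
  set F : ℤ → ℤ → ℂ := fun r s => q ^ (r ^ 2 - r * s + s ^ 2 + d * r + e * s) *
    (qFacInv q (n - r) * qFacInv q (m - s)) * (qPoch q q (r + s + c).toNat *
      (qFacInv q (r + X) * qFacInv q (r + Y) * qFacInv q (r + Z)) *
    (qFacInv q (s + c - X) * qFacInv q (s + c - Y) * qFacInv q (s + c - Z))) with hF
  have hsupp : ∀ r s, F r s ≠ 0 → (0 ≤ r ∧ r ≤ n) ∧ (0 ≤ s ∧ s ≤ m) := by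
    intro r s h
    simp only [hF, ne_eq, mul_eq_zero, not_or] at h
    have h1 := nonneg_of_qFacInv_ne_zero h.1.2.1
    have h2 := nonneg_of_qFacInv_ne_zero h.1.2.2
    have h3 := nonneg_of_qFacInv_ne_zero h.2.1.2.2
    have h4 := nonneg_of_qFacInv_ne_zero h.2.2.1.1
    omega
  have h1 : step q d e (ker q c X Y Z) n m = ∑' r : ℤ, ∑' s : ℤ, F r s := by
    rw [← sum_range_eq_tsum_int (h := fun r => ∑' s : ℤ, F r s) n]
    · refine Finset.sum_congr rfl fun r _ => ?_
      rw [← sum_range_eq_tsum_int (h := fun s => F r s) m fun s hs => (hsupp _ _ hs).2]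
      refine Finset.sum_congr rfl fun s _ => ?_
      simp only [hF, ker]
      rw [show ((r : ℤ) + s + c).toNat = r + s + c by omega]
      have hpow : q ^ (r ^ 2 + s ^ 2 - r * s + d * r + e * s) =
          q ^ ((r : ℤ) ^ 2 - r * s + s ^ 2 + d * r + e * s) := by
        rw [← zpow_natCast]
        congr 1
        have : r * s ≤ r ^ 2 + s ^ 2 := by nlinarith [sq_nonneg ((r : ℤ) - s)]
        push_cast [Nat.cast_sub this]
        ring
      rw [hpow]
      ring
    · intro r hr
      by_contra hcon
      apply hr
      convert tsum_zero with s
      by_contra hne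
      exact hcon (hsupp _ _ hne).1
  rw [h1, ← (Equiv.subRight Z).tsum_eq]
  have h2 : ∀ r : ℤ, ∑' s : ℤ, F (Equiv.subRight Z r) s =
      ∑' s : ℤ, F (Equiv.subRight Z r) (Equiv.subRight ((c : ℤ) - Z) s) :=
    fun r => ((Equiv.subRight ((c : ℤ) - Z)).tsum_eq _).symm
  simp_rw [h2]
  have h3 : ∀ r s : ℤ, F (Equiv.subRight Z r) (Equiv.subRight ((c : ℤ) - Z) s) =
      q ^ ((X + Y + Z) * c - c ^ 2 - (X * Y + X * Z + Y * Z) + (X - Z) * (Y - Z)) *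
      (q ^ (r ^ 2 - r * s + s ^ 2 + (X - Z + (Y - Z)) * (r - s)) *
      (qFacInv q (n + Z - r) * qFacInv q (m + c - Z - s) *
        (qPoch q q (r + s).toNat * qFacInv q r * qFacInv q s * qFacInv q (r + (X - Z)) *
          qFacInv q (s - (X - Z))) * qFacInv q (r + (Y - Z)) * qFacInv q (s - (Y - Z)))) := by
    intro r s
    simp only [hF, Equiv.subRight_apply, hd, he]
    rw [show n - (r - Z) = n + Z - r by ring, show m - (s - (c - Z)) = m + c - Z - s by ring,
      show r - Z + (s - (c - Z)) + c = r + s by ring, show r - Z + X = r + (X - Z) by ring,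
      show r - Z + Y = r + (Y - Z) by ring, show r - Z + Z = r by ring,
      show s - (c - Z) + c - X = s - (X - Z) by ring,
      show s - (c - Z) + c - Y = s - (Y - Z) by ring, show s - (c - Z) + c - Z = s by ring]
    have hpow : q ^ ((r - Z) ^ 2 - (r - Z) * (s - (c - Z)) + (s - (c - Z)) ^ 2 +
        (X + Y + Z - c) * (r - Z) + (2 * c - (X + Y + Z)) * (s - (c - Z))) =
        q ^ ((X + Y + Z) * c - c ^ 2 - (X * Y + X * Z + Y * Z) + (X - Z) * (Y - Z)) *
      q ^ (r ^ 2 - r * s + s ^ 2 + (X - Z + (Y - Z)) * (r - s)) := by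
      rw [← zpow_add₀ hq0]; congr 1; ring
    rw [hpow]
    ring
  simp_rw [h3, tsum_mul_left]
  rw [hb, zpow_add₀ hq0, ker, show ((n : ℤ) + Z + (m + c - Z)).toNat = n + m + c by omega,
    show (n : ℤ) + Z + (X - Z) = n + X by ring, show (n : ℤ) + Z + (Y - Z) = n + Y by ring,
    show (m : ℤ) + c - Z - (X - Z) = m + c - X by ring,
    show (m : ℤ) + c - Z - (Y - Z) = m + c - Y by ring]
  have h4 : q ^ ((X - Z) * (Y - Z)) * q ^ (-((X - Z) * (Y - Z))) = 1 := by
    rw [← zpow_add₀ hq0]; simp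
  linear_combination (q ^ ((X + Y + Z) * c - c ^ 2 - (X * Y + X * Z + Y * Z)) *
    qPoch q q (n + m + c) * (qFacInv q (n + X) * qFacInv q (n + Y) * qFacInv q (n + Z)) *
    (qFacInv q (m + c - X) * qFacInv q (m + c - Y) * qFacInv q (m + c - Z))) * h4

/-- The `A₂` Bailey lemma: the kernels are eigenfunctions of the chain steps. -/
lemma step_ker (hq : ‖q‖ < 1) (hq0 : q ≠ 0) (n m c d e : ℕ) (X Y Z : ℤ)
    (hd : (d : ℤ) = X + Y + Z - c) (he : (e : ℤ) = 2 * c - (X + Y + Z))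
    (hmax : c ≤ X ∨ c ≤ Y ∨ c ≤ Z) (hmin : X ≤ 0 ∨ Y ≤ 0 ∨ Z ≤ 0) :
    step q d e (ker q c X Y Z) n m =
      q ^ ((X + Y + Z) * c - c ^ 2 - (X * Y + X * Z + Y * Z)) * ker q c X Y Z n m := by
  have s1 : ∀ X Y Z : ℤ, ker q c X Y Z = ker q c Y X Z := by
    intro X Y Z; ext n m; simp only [ker]; ring
  have s2 : ∀ X Y Z : ℤ, ker q c X Y Z = ker q c X Z Y := by
    intro X Y Z; ext n m; simp only [ker]; ring
  -- reduce to the case in which the first entry is largest and the last one smallest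
  wlog hXY : Y ≤ X generalizing X Y Z
  · rw [s1, this Y X Z (by omega) (by omega) (by tauto) (by tauto) (by omega)]
    congr 2; ring
  wlog hYZ : Z ≤ Y generalizing X Y Z
  · by_cases hXZ : Z ≤ X
    · rw [s2, this X Z Y (by omega) (by omega) (by tauto) (by tauto) (by omega) (by omega)]
      congr 2; ring
    · rw [s2, s1, this Z X Y (by omega) (by omega) (by tauto) (by tauto) (by omega) (by omega)]
      congr 2; ring
  exact step_ker_aux hq hq0 n m c d e X Y Z hd he (by omega) (by omega)

end Bailey

section Kernels

variable {q : ℂ}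

/-- The kernel `ker` at level `0`, indexed by `(x, y)` standing for the `A₂` root lattice vector
`(x, -x-y, y)`. -/
def kerZero (q : ℂ) (u : ℤ × ℤ) : ℕ → ℕ → ℂ := ker q 0 (u.1 - 1) (-u.1 - u.2) (u.2 + 1)

/-- The kernel `ker` at level `1`, indexed by the `A₂` root lattice. -/
def kerOne (q : ℂ) (u : ℤ × ℤ) : ℕ → ℕ → ℂ := ker q 1 u.1 (-u.1 - u.2) (u.2 + 1)

/-- The kernel `ker` at level `2`, indexed by the `A₂` root lattice. -/
def kerTwo (q : ℂ) (u : ℤ × ℤ) : ℕ → ℕ → ℂ := ker q 2 (u.1 + 1) (1 - u.1 - u.2) (u.2 + 1)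

/-- The quadratic form of the `A₂` root lattice. -/
def quad (u : ℤ × ℤ) : ℤ := u.1 ^ 2 + u.1 * u.2 + u.2 ^ 2

/-- The transposition of the first two coordinates of `(x, -x-y, y)`. -/
def swapFst : ℤ × ℤ ≃ ℤ × ℤ where
  toFun u := (-u.1 - u.2, u.2)
  invFun u := (-u.1 - u.2, u.2)
  left_inv u := by ext <;> simp
  right_inv u := by ext <;> simp

/-- The transposition of the last two coordinates of `(x, -x-y, y)`. -/
def swapSnd : ℤ × ℤ ≃ ℤ × ℤ where
  toFun u := (u.1, -u.1 - u.2)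
  invFun u := (u.1, -u.1 - u.2)
  left_inv u := by ext <;> simp
  right_inv u := by ext <;> simp

/-- The transposition of the outer coordinates of `(x, -x-y, y)`. -/
def swapOut : ℤ × ℤ ≃ ℤ × ℤ where
  toFun u := (u.2, u.1)
  invFun u := (u.2, u.1)
  left_inv u := by ext <;> simp
  right_inv u := by ext <;> simp

lemma ker_support {c : ℕ} {X Y Z : ℤ} {n m : ℕ} (h : ker q c X Y Z n m ≠ 0) :
    (-n ≤ X ∧ X ≤ m + c) ∧ (-n ≤ Y ∧ Y ≤ m + c) ∧ (-n ≤ Z ∧ Z ≤ m + c) := by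
  simp only [ker, ne_eq, mul_eq_zero, not_or] at h
  have h1 := nonneg_of_qFacInv_ne_zero h.1.2.1.1
  have h2 := nonneg_of_qFacInv_ne_zero h.1.2.1.2
  have h3 := nonneg_of_qFacInv_ne_zero h.1.2.2
  have h4 := nonneg_of_qFacInv_ne_zero h.2.1.1
  have h5 := nonneg_of_qFacInv_ne_zero h.2.1.2
  have h6 := nonneg_of_qFacInv_ne_zero h.2.2
  omega

lemma summable_mul_kerZero (C : ℤ × ℤ → ℂ) (n m : ℕ) :
    Summable fun u => C u * kerZero q u n m := by
  refine summable_int_prod_of_bounded (-(n : ℤ) - 5) (m + 5) fun u hu => ?_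
  have := ker_support (right_ne_zero_of_mul hu)
  push_cast at this
  omega

lemma summable_mul_kerOne (C : ℤ × ℤ → ℂ) (n m : ℕ) :
    Summable fun u => C u * kerOne q u n m := by
  refine summable_int_prod_of_bounded (-(n : ℤ) - 5) (m + 5) fun u hu => ?_
  have := ker_support (right_ne_zero_of_mul hu)
  push_cast at this
  omega

lemma summable_mul_kerTwo (C : ℤ × ℤ → ℂ) (n m : ℕ) :
    Summable fun u => C u * kerTwo q u n m := by
  refine summable_int_prod_of_bounded (-(n : ℤ) - 5) (m + 5) fun u hu => ?_
  have := ker_support (right_ne_zero_of_mul hu)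
  push_cast at this
  omega

lemma step_tsum (d e : ℕ) {C : ℤ × ℤ → ℂ} {K : ℤ × ℤ → ℕ → ℕ → ℂ}
    (hK : ∀ n m, Summable fun u => C u * K u n m) (n m : ℕ) :
    step q d e (fun n m => ∑' u, C u * K u n m) n m = ∑' u, C u * step q d e (K u) n m := by
  have hs : ∀ r s, Summable fun u => q ^ (r ^ 2 + s ^ 2 - r * s + d * r + e * s) *
      qFacInv q ((n : ℤ) - r) * qFacInv q ((m : ℤ) - s) * (C u * K u r s) :=
    fun r s => (hK r s).mul_left _
  simp only [step]
  simp_rw [← tsum_mul_left]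
  have h1 : ∀ r, ∑ s ∈ Finset.range (m + 1), ∑' u, q ^ (r ^ 2 + s ^ 2 - r * s + d * r + e * s) *
      qFacInv q ((n : ℤ) - r) * qFacInv q ((m : ℤ) - s) * (C u * K u r s) =
      ∑' u, ∑ s ∈ Finset.range (m + 1), q ^ (r ^ 2 + s ^ 2 - r * s + d * r + e * s) *
      qFacInv q ((n : ℤ) - r) * qFacInv q ((m : ℤ) - s) * (C u * K u r s) :=
    fun r => (Summable.tsum_finsetSum fun s _ => hs r s).symm
  simp_rw [h1]
  rw [← Summable.tsum_finsetSum fun r _ => summable_sum fun s _ => hs r s]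
  refine tsum_congr fun u => ?_
  simp_rw [Finset.mul_sum]
  refine Finset.sum_congr rfl fun r _ => Finset.sum_congr rfl fun s _ => ?_
  ring

lemma step_tsum_kerZero (hq : ‖q‖ < 1) (hq0 : q ≠ 0) (C : ℤ × ℤ → ℂ) (n m : ℕ) :
    step q 0 0 (fun n m => ∑' u, C u * kerZero q u n m) n m =
      ∑' u, C u * q ^ (quad u - u.1 + u.2 + 1) * kerZero q u n m := by
  rw [step_tsum 0 0 fun n m => summable_mul_kerZero C n m]
  refine tsum_congr fun u => ?_
  rw [kerZero, step_ker hq hq0 n m 0 0 0 _ _ _ (by push_cast; ring) (by push_cast; ring)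
    (by push_cast; omega) (by omega), ← mul_assoc]
  congr 3
  simp only [quad]; push_cast; ring

lemma step_tsum_kerOne (hq : ‖q‖ < 1) (hq0 : q ≠ 0) (C : ℤ × ℤ → ℂ) (n m : ℕ) :
    step q 0 1 (fun n m => ∑' u, C u * kerOne q u n m) n m =
      ∑' u, C u * q ^ (quad u + u.2) * kerOne q u n m := by
  rw [step_tsum 0 1 fun n m => summable_mul_kerOne C n m]
  refine tsum_congr fun u => ?_
  rw [kerOne, step_ker hq hq0 n m 1 0 1 _ _ _ (by push_cast; ring) (by push_cast; ring)
    (by push_cast; omega) (by omega), ← mul_assoc]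
  congr 3
  simp only [quad]; push_cast; ring

lemma step_tsum_kerTwo (hq : ‖q‖ < 1) (hq0 : q ≠ 0) (C : ℤ × ℤ → ℂ) (hC : C 0 = 0) (n m : ℕ) :
    step q 1 1 (fun n m => ∑' u, C u * kerTwo q u n m) n m =
      ∑' u, C u * q ^ (quad u - 1) * kerTwo q u n m := by
  rw [step_tsum 1 1 fun n m => summable_mul_kerTwo C n m]
  refine tsum_congr fun u => ?_
  by_cases hu : u = 0
  · simp [hu, hC]
  have hu' : ¬ (u.1 = 0 ∧ u.2 = 0) := fun h => hu (Prod.ext h.1 h.2)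
  rw [kerTwo, step_ker hq hq0 n m 2 1 1 _ _ _ (by push_cast; ring) (by push_cast; ring)
    (by push_cast; omega) (by omega), ← mul_assoc]
  congr 3
  simp only [quad]; push_cast; ring

lemma tsum_antisymm_eq_zero {α : Type*} (σ : α ≃ α) {C D : α → ℂ} (hC : ∀ u, C (σ u) = -C u)
    (hD : ∀ u, D (σ u) = D u) : ∑' u, C u * D u = 0 := by
  have h : ∑' u, C u * D u = -∑' u, C u * D u := by
    rw [← tsum_neg, ← σ.tsum_eq]
    refine tsum_congr fun u => ?_
    rw [hC, hD, neg_mul]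
  linear_combination h / 2

lemma kerOne_swapFst (u : ℤ × ℤ) : kerOne q (swapFst u) = kerOne q u := by
  ext n m
  simp only [kerOne, swapFst, ker, Equiv.coe_fn_mk]
  rw [show -(-u.1 - u.2) - u.2 = u.1 by ring]
  ring

lemma kerTwo_swapFst (u : ℤ × ℤ) : kerTwo q (swapFst u) = kerTwo q u := by
  ext n m
  simp only [kerTwo, swapFst, ker, Equiv.coe_fn_mk]
  rw [show 1 - (-u.1 - u.2) - u.2 = u.1 + 1 by ring, show -u.1 - u.2 + 1 = 1 - u.1 - u.2 by ring]
  ring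

lemma kerTwo_swapSnd (u : ℤ × ℤ) : kerTwo q (swapSnd u) = kerTwo q u := by
  ext n m
  simp only [kerTwo, swapSnd, ker, Equiv.coe_fn_mk]
  rw [show 1 - u.1 - (-u.1 - u.2) = u.2 + 1 by ring, show -u.1 - u.2 + 1 = 1 - u.1 - u.2 by ring]
  ring

lemma kerTwo_swapOut (u : ℤ × ℤ) : kerTwo q (swapOut u) = kerTwo q u := by
  ext n m
  simp only [kerTwo, swapOut, ker, Equiv.coe_fn_mk]
  rw [show 1 - u.2 - u.1 = 1 - u.1 - u.2 by ring]
  ring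

lemma kerZero_mul (hq : ‖q‖ < 1) (u : ℤ × ℤ) (n m : ℕ) :
    kerZero q u n m * (1 - q ^ (n + m + 1)) = kerOne q u n m *
      ((1 - q ^ ((n : ℤ) + u.1)) * (1 - q ^ ((m : ℤ) + 1 + u.1 + u.2)) *
        (1 - q ^ ((m : ℤ) - u.2))) := by
  simp only [kerZero, kerOne, ker]
  have h1 := qFacInv_sub_one hq ((n : ℤ) + u.1)
  have h2 := qFacInv_sub_one hq ((m : ℤ) + 1 + u.1 + u.2)
  have h3 := qFacInv_sub_one hq ((m : ℤ) - u.2)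
  rw [qPoch_self_succ]
  push_cast
  rw [show (n : ℤ) + (u.1 - 1) = n + u.1 - 1 by ring,
    show (m : ℤ) + 0 - (-u.1 - u.2) = m + 1 + u.1 + u.2 - 1 by ring,
    show (m : ℤ) + 0 - (u.2 + 1) = m - u.2 - 1 by ring, h1, h2, h3,
    show (m : ℤ) + 1 - (-u.1 - u.2) = m + 1 + u.1 + u.2 by ring,
    show (m : ℤ) + 1 - (u.2 + 1) = m - u.2 by ring,
    show (m : ℤ) + 0 - (u.1 - 1) = m + 1 - u.1 by ring]
  ring_nf

lemma kerOne_mul (hq : ‖q‖ < 1) (u : ℤ × ℤ) (n m : ℕ) :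
    kerOne q u n m * (1 - q ^ (n + m + 2)) = kerTwo q u n m *
      ((1 - q ^ ((n : ℤ) + 1 + u.1)) * (1 - q ^ ((n : ℤ) + 1 - u.1 - u.2)) *
        (1 - q ^ ((m : ℤ) + 1 - u.2))) := by
  simp only [kerOne, kerTwo, ker]
  have h1 := qFacInv_sub_one hq ((n : ℤ) + 1 + u.1)
  have h2 := qFacInv_sub_one hq ((n : ℤ) + 1 - u.1 - u.2)
  have h3 := qFacInv_sub_one hq ((m : ℤ) + 1 - u.2)
  rw [show n + m + 2 = n + m + 1 + 1 by ring, qPoch_self_succ q (n + m + 1)]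
  push_cast
  rw [show (n : ℤ) + u.1 = n + 1 + u.1 - 1 by ring,
    show (n : ℤ) + (-u.1 - u.2) = n + 1 - u.1 - u.2 - 1 by ring,
    show (m : ℤ) + 1 - (u.2 + 1) = m + 1 - u.2 - 1 by ring, h1, h2, h3,
    show (m : ℤ) + 1 - (-u.1 - u.2) = m + 2 - (1 - u.1 - u.2) by ring,
    show (m : ℤ) + 1 - u.1 = m + 2 - (u.1 + 1) by ring,
    show (m : ℤ) + 1 - u.2 = m + 2 - (u.2 + 1) by ring]
  ring_nf

lemma tsum_kerZero_eq (hq : ‖q‖ < 1) (hq0 : q ≠ 0) {C : ℤ × ℤ → ℂ}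
    (hC : ∀ u, C (swapFst u) = -C u) (n m : ℕ) :
    ∑' u, C u * q ^ (u.2 - u.1) * kerZero q u n m =
      ∑' u, C u * q ^ (u.2 - u.1) * kerOne q u n m -
        q ^ m * ∑' u, C u * q ^ (-u.1) * kerOne q u n m := by
  set D : ℤ × ℤ → ℂ := fun u => (q ^ u.2 - q ^ m) * (-q ^ n - q ^ (m + 1) * q ^ u.2 +
    q ^ (n + m + 1) * (q ^ (-u.1) + q ^ (u.1 + u.2))) * kerOne q u n m with hD
  have h0 : ∑' u, C u * D u = 0 := by
    refine tsum_antisymm_eq_zero swapFst hC fun u => ?_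
    simp only [hD, kerOne_swapFst]
    simp only [swapFst, Equiv.coe_fn_mk]
    rw [show -(-u.1 - u.2) = u.1 + u.2 by ring, show -u.1 - u.2 + u.2 = -u.1 by ring]
    ring
  have s0 := summable_mul_kerZero (q := q) (fun u => C u * q ^ (u.2 - u.1)) n m
  have s1 := summable_mul_kerOne (q := q) (fun u => C u * q ^ (u.2 - u.1)) n m
  have s2 := (summable_mul_kerOne (q := q) (fun u => C u * q ^ (-u.1)) n m).mul_left (q ^ m)
  rw [← sub_eq_zero]
  refine mul_left_cancel₀ (one_sub_pow_ne_zero hq (n := n + m + 1) (by omega)) ?_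
  rw [mul_zero, ← h0, ← tsum_mul_left, ← s1.tsum_sub s2, ← s0.tsum_sub (s1.sub s2),
    ← tsum_mul_left]
  refine tsum_congr fun u => ?_
  have hk := kerZero_mul hq u n m
  simp only [hD]
  have e1 : q ^ ((n : ℤ) + u.1) = q ^ n * q ^ u.1 := by rw [zpow_add₀ hq0, zpow_natCast]
  have e2 : q ^ ((m : ℤ) + 1 + u.1 + u.2) = q ^ m * q * q ^ u.1 * q ^ u.2 := by
    rw [zpow_add₀ hq0, zpow_add₀ hq0, zpow_add₀ hq0, zpow_natCast, zpow_one]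
  have e3 : q ^ ((m : ℤ) - u.2) = q ^ m * (q ^ u.2)⁻¹ := by
    rw [zpow_sub₀ hq0, zpow_natCast, div_eq_mul_inv]
  have h1 := mul_inv_cancel₀ (zpow_ne_zero u.1 hq0)
  have h2 := mul_inv_cancel₀ (zpow_ne_zero u.2 hq0)
  rw [e1, e2, e3] at hk
  rw [zpow_sub₀ hq0, zpow_neg, zpow_add₀ hq0, div_eq_mul_inv]
  set x := q ^ u.1
  set y := q ^ u.2
  rw [pow_add, pow_add] at hk ⊢
  generalize x⁻¹ = X at *
  generalize y⁻¹ = Y at *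
  grind

lemma tsum_kerOne_eq (hq : ‖q‖ < 1) (hq0 : q ≠ 0) {C : ℤ × ℤ → ℂ}
    (hC : ∀ u, C (swapFst u) = -C u) (hC' : ∀ u, C (swapOut u) = -C u)
    (hC'' : ∀ u, C (swapSnd u) = -C u) (n m : ℕ) :
    ∑' u, C u * q ^ (u.2 - u.1) * kerOne q u n m =
      ∑' u, C u * q ^ (u.2 - u.1) * kerTwo q u n m := by
  set D₁ : ℤ × ℤ → ℂ := fun u => -q ^ (n + 1) * q ^ u.2 * kerTwo q u n m with hD₁
  set D₂ : ℤ × ℤ → ℂ := fun u => (-q ^ (n + 1) * q ^ (-2 * u.1) + q ^ (2 * n + 2) * q ^ (-u.1)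
    - q ^ (m + 1) * q ^ (-u.1) + q ^ (n + m + 2) * (1 + q ^ (-2 * u.1 - u.2) + q ^ (u.2 - u.1)))
      * kerTwo q u n m with hD₂
  set D₃ : ℤ × ℤ → ℂ := fun u => -q ^ (2 * n + m + 3) * q ^ (-u.1 - u.2) * kerTwo q u n m
    with hD₃
  have h1 : ∑' u, C u * D₁ u = 0 :=
    tsum_antisymm_eq_zero swapFst hC fun u => by
      simp only [hD₁, kerTwo_swapFst]
      simp [swapFst]
  have h2 : ∑' u, C u * D₂ u = 0 :=
    tsum_antisymm_eq_zero swapSnd hC'' fun u => by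
      simp only [hD₂, kerTwo_swapSnd]
      simp only [swapSnd, Equiv.coe_fn_mk]
      rw [show -2 * u.1 - (-u.1 - u.2) = u.2 - u.1 by ring,
        show -u.1 - u.2 - u.1 = -2 * u.1 - u.2 by ring]
      ring
  have h3 : ∑' u, C u * D₃ u = 0 :=
    tsum_antisymm_eq_zero swapOut hC' fun u => by
      simp only [hD₃, kerTwo_swapOut]
      simp only [swapOut, Equiv.coe_fn_mk]
      rw [show -u.2 - u.1 = -u.1 - u.2 by ring]
  have s0 := summable_mul_kerOne (q := q) (fun u => C u * q ^ (u.2 - u.1)) n m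
  have s1 := summable_mul_kerTwo (q := q) (fun u => C u * q ^ (u.2 - u.1)) n m
  have t1 : Summable fun u => C u * D₁ u := by
    simp only [hD₁, ← mul_assoc]; exact summable_mul_kerTwo _ n m
  have t2 : Summable fun u => C u * D₂ u := by
    simp only [hD₂, ← mul_assoc]; exact summable_mul_kerTwo _ n m
  have t3 : Summable fun u => C u * D₃ u := by
    simp only [hD₃, ← mul_assoc]; exact summable_mul_kerTwo _ n m
  rw [← sub_eq_zero]
  refine mul_left_cancel₀ (one_sub_pow_ne_zero hq (n := n + m + 2) (by omega)) ?_
  have h0 : (0 : ℂ) = ∑' u, (C u * D₁ u + C u * D₂ u + C u * D₃ u) := by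
    rw [(t1.add t2).tsum_add t3, t1.tsum_add t2, h1, h2, h3]; simp
  rw [mul_zero, h0, ← s0.tsum_sub s1, ← tsum_mul_left]
  refine tsum_congr fun u => ?_
  have hk := kerOne_mul hq u n m
  simp only [hD₁, hD₂, hD₃]
  have e1 : q ^ ((n : ℤ) + 1 + u.1) = q ^ n * q * q ^ u.1 := by
    rw [zpow_add₀ hq0, zpow_add₀ hq0, zpow_natCast, zpow_one]
  have e2 : q ^ ((n : ℤ) + 1 - u.1 - u.2) = q ^ n * q * (q ^ u.1)⁻¹ * (q ^ u.2)⁻¹ := by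
    rw [zpow_sub₀ hq0, zpow_sub₀ hq0, zpow_add₀ hq0, zpow_natCast, zpow_one]
    simp only [div_eq_mul_inv]
  have e3 : q ^ ((m : ℤ) + 1 - u.2) = q ^ m * q * (q ^ u.2)⁻¹ := by
    rw [zpow_sub₀ hq0, zpow_add₀ hq0, zpow_natCast, zpow_one, div_eq_mul_inv]
  have e4 : q ^ (-2 * u.1) = (q ^ u.1)⁻¹ * (q ^ u.1)⁻¹ := by
    rw [← zpow_neg, ← zpow_add₀ hq0]; ring_nf
  have e5 : q ^ (-2 * u.1 - u.2) = (q ^ u.1)⁻¹ * (q ^ u.1)⁻¹ * (q ^ u.2)⁻¹ := by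
    rw [← zpow_neg, ← zpow_neg, ← zpow_add₀ hq0, ← zpow_add₀ hq0]; ring_nf
  have e6 : q ^ (-u.1 - u.2) = (q ^ u.1)⁻¹ * (q ^ u.2)⁻¹ := by
    rw [← zpow_neg, ← zpow_neg, ← zpow_add₀ hq0]; ring_nf
  have h1 := mul_inv_cancel₀ (zpow_ne_zero u.1 hq0)
  have h2 := mul_inv_cancel₀ (zpow_ne_zero u.2 hq0)
  rw [e1, e2, e3] at hk
  rw [e4, e5, e6, zpow_sub₀ hq0, zpow_neg, div_eq_mul_inv]
  have e7 : q ^ (n + m + 2) = q ^ n * q ^ m * q ^ 2 := by ring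
  have e8 : q ^ (2 * n + m + 3) = (q ^ n) ^ 2 * q ^ m * q ^ 3 := by ring
  have e9 : q ^ (2 * n + 2) = (q ^ n) ^ 2 * q ^ 2 := by ring
  rw [e7] at hk
  rw [e7, e8, e9, pow_succ q n, pow_succ q m]
  generalize q ^ u.1 = x at *
  generalize q ^ u.2 = y at *
  generalize x⁻¹ = X at *
  generalize y⁻¹ = Y at *
  generalize q ^ n = a at *
  generalize q ^ m = b at *
  clear_value D₁ D₂ D₃
  clear e1 e2 e3 e4 e5 e6 e7 e8 e9 s0 s1 t1 t2 t3 hD₁ hD₂ hD₃ hC hC' hC'' h0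
  grind

lemma tsum_kerOne_eq_pow_mul (hq : ‖q‖ < 1) (hq0 : q ≠ 0) {C : ℤ × ℤ → ℂ}
    (hC : ∀ u, C (swapFst u) = -C u) (hC' : ∀ u, C (swapOut u) = -C u)
    (hC'' : ∀ u, C (swapSnd u) = -C u) (n m : ℕ) :
    ∑' u, C u * q ^ (-u.1) * kerOne q u n m =
      q ^ (n + 1) * ∑' u, C u * q ^ (u.2 - u.1) * kerTwo q u n m := by
  set D₁ : ℤ × ℤ → ℂ := fun u => q ^ (n + m + 2) * q ^ (-u.2) * kerTwo q u n m with hD₁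
  set D₂ : ℤ × ℤ → ℂ := fun u => (q ^ (-u.1) - q ^ (n + 1) +
    (q ^ (2 * n + m + 3) - q ^ (n + 1)) * (q ^ (-2 * u.1 - u.2) + q ^ (u.2 - u.1)))
      * kerTwo q u n m with hD₂
  set D₃ : ℤ × ℤ → ℂ := fun u => ((q ^ (2 * n + 2) - q ^ (m + 1)) * q ^ (-u.1 - u.2) +
    q ^ (n + m + 2) * q ^ (-2 * u.1 - 2 * u.2) -
    q ^ (2 * n + m + 3) * (q ^ (-2 * u.1 - u.2) + q ^ (-u.1 - 2 * u.2))) * kerTwo q u n m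
    with hD₃
  have h1 : ∑' u, C u * D₁ u = 0 :=
    tsum_antisymm_eq_zero swapFst hC fun u => by
      simp only [hD₁, kerTwo_swapFst]
      simp [swapFst]
  have h2 : ∑' u, C u * D₂ u = 0 :=
    tsum_antisymm_eq_zero swapSnd hC'' fun u => by
      simp only [hD₂, kerTwo_swapSnd]
      simp only [swapSnd, Equiv.coe_fn_mk]
      rw [show -2 * u.1 - (-u.1 - u.2) = u.2 - u.1 by ring,
        show -u.1 - u.2 - u.1 = -2 * u.1 - u.2 by ring]
      ring
  have h3 : ∑' u, C u * D₃ u = 0 :=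
    tsum_antisymm_eq_zero swapOut hC' fun u => by
      simp only [hD₃, kerTwo_swapOut]
      simp only [swapOut, Equiv.coe_fn_mk]
      rw [show -u.2 - u.1 = -u.1 - u.2 by ring,
        show -2 * u.2 - u.1 = -u.1 - 2 * u.2 by ring,
        show -u.2 - 2 * u.1 = -2 * u.1 - u.2 by ring,
        show -2 * u.2 - 2 * u.1 = -2 * u.1 - 2 * u.2 by ring]
      ring
  have s0 := summable_mul_kerOne (q := q) (fun u => C u * q ^ (-u.1)) n m
  have s1 := (summable_mul_kerTwo (q := q) (fun u => C u * q ^ (u.2 - u.1)) n m).mul_left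
    (q ^ (n + 1))
  have t1 : Summable fun u => C u * D₁ u := by
    simp only [hD₁, ← mul_assoc]; exact summable_mul_kerTwo _ n m
  have t2 : Summable fun u => C u * D₂ u := by
    simp only [hD₂, ← mul_assoc]; exact summable_mul_kerTwo _ n m
  have t3 : Summable fun u => C u * D₃ u := by
    simp only [hD₃, ← mul_assoc]; exact summable_mul_kerTwo _ n m
  rw [← sub_eq_zero]
  refine mul_left_cancel₀ (one_sub_pow_ne_zero hq (n := n + m + 2) (by omega)) ?_
  have h0 : (0 : ℂ) = ∑' u, (C u * D₁ u + C u * D₂ u + C u * D₃ u) := by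
    rw [(t1.add t2).tsum_add t3, t1.tsum_add t2, h1, h2, h3]; simp
  rw [mul_zero, h0, ← tsum_mul_left, ← s0.tsum_sub s1, ← tsum_mul_left]
  refine tsum_congr fun u => ?_
  have hk := kerOne_mul hq u n m
  simp only [hD₁, hD₂, hD₃]
  have e1 : q ^ ((n : ℤ) + 1 + u.1) = q ^ n * q * q ^ u.1 := by
    rw [zpow_add₀ hq0, zpow_add₀ hq0, zpow_natCast, zpow_one]
  have e2 : q ^ ((n : ℤ) + 1 - u.1 - u.2) = q ^ n * q * (q ^ u.1)⁻¹ * (q ^ u.2)⁻¹ := by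
    rw [zpow_sub₀ hq0, zpow_sub₀ hq0, zpow_add₀ hq0, zpow_natCast, zpow_one]
    simp only [div_eq_mul_inv]
  have e3 : q ^ ((m : ℤ) + 1 - u.2) = q ^ m * q * (q ^ u.2)⁻¹ := by
    rw [zpow_sub₀ hq0, zpow_add₀ hq0, zpow_natCast, zpow_one, div_eq_mul_inv]
  have e4 : q ^ (-2 * u.1 - 2 * u.2) =
      (q ^ u.1)⁻¹ * (q ^ u.1)⁻¹ * ((q ^ u.2)⁻¹ * (q ^ u.2)⁻¹) := by
    simp only [← zpow_neg, ← zpow_add₀ hq0]; ring_nf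
  have e10 : q ^ (-u.1 - 2 * u.2) = (q ^ u.1)⁻¹ * ((q ^ u.2)⁻¹ * (q ^ u.2)⁻¹) := by
    simp only [← zpow_neg, ← zpow_add₀ hq0]; ring_nf
  have e5 : q ^ (-2 * u.1 - u.2) = (q ^ u.1)⁻¹ * (q ^ u.1)⁻¹ * (q ^ u.2)⁻¹ := by
    rw [← zpow_neg, ← zpow_neg, ← zpow_add₀ hq0, ← zpow_add₀ hq0]; ring_nf
  have e6 : q ^ (-u.1 - u.2) = (q ^ u.1)⁻¹ * (q ^ u.2)⁻¹ := by
    rw [← zpow_neg, ← zpow_neg, ← zpow_add₀ hq0]; ring_nf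
  have h1 := mul_inv_cancel₀ (zpow_ne_zero u.1 hq0)
  have h2 := mul_inv_cancel₀ (zpow_ne_zero u.2 hq0)
  rw [e1, e2, e3] at hk
  rw [e4, e5, e6, e10, zpow_sub₀ hq0, zpow_neg, zpow_neg, div_eq_mul_inv]
  have e7 : q ^ (n + m + 2) = q ^ n * q ^ m * q ^ 2 := by ring
  have e8 : q ^ (2 * n + m + 3) = (q ^ n) ^ 2 * q ^ m * q ^ 3 := by ring
  have e9 : q ^ (2 * n + 2) = (q ^ n) ^ 2 * q ^ 2 := by ring
  rw [e7] at hk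
  rw [e7, e8, e9, pow_succ q n, pow_succ q m]
  generalize q ^ u.1 = x at *
  generalize q ^ u.2 = y at *
  generalize x⁻¹ = X at *
  generalize y⁻¹ = Y at *
  generalize q ^ n = a at *
  generalize q ^ m = b at *
  clear_value D₁ D₂ D₃
  clear e10 e1 e2 e3 e4 e5 e6 e7 e8 e9 s0 s1 t1 t2 t3 hD₁ hD₂ hD₃ hC hC' hC'' h0
  grind

end Kernels

section Seed

variable {q : ℂ}

/-- The triangular exponent `n(n-1)/2`. -/
def tri (n : ℤ) : ℤ := n * (n - 1) / 2

lemma two_mul_tri (n : ℤ) : 2 * tri n = n * (n - 1) :=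
  Int.mul_ediv_cancel' (by simpa [mul_comm] using (Int.even_mul_pred_self n).two_dvd)

/-- The character `d ↦ 1, -1, 0` for `d ≡ 1, 2, 0` modulo `3`. -/
def chi (d : ℤ) : ℂ := if d % 3 = 1 then 1 else if d % 3 = 2 then -1 else 0

/-- The coefficients in the q-binomial theorem. -/
def binomCoeff (q : ℂ) (N : ℕ) (n : ℤ) : ℂ :=
  (-1) ^ n * q ^ tri n * (qPoch q q N * (qFacInv q n * qFacInv q (N - n)))

lemma binomCoeff_support {N : ℕ} {n : ℤ} (h : binomCoeff q N n ≠ 0) : 0 ≤ n ∧ n ≤ N := by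
  simp only [binomCoeff, ne_eq, mul_eq_zero, not_or] at h
  have h1 := nonneg_of_qFacInv_ne_zero h.2.2.1
  have h2 := nonneg_of_qFacInv_ne_zero h.2.2.2
  omega

lemma binomCoeff_succ (hq : ‖q‖ < 1) (hq0 : q ≠ 0) (N : ℕ) (n : ℤ) :
    binomCoeff q (N + 1) n = binomCoeff q N n - q ^ N * binomCoeff q N (n - 1) := by
  have h1 := qFacInv_sub_one hq n
  have h2 := qFacInv_sub_one hq (N + 1 - n)
  have e1 : (-1 : ℂ) ^ n = -(-1) ^ (n - 1) := by
    rw [zpow_sub_one₀ (by norm_num)]; ring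
  have e2 : q ^ tri n = q ^ tri (n - 1) * (q ^ n * q⁻¹) := by
    rw [← zpow_sub_one₀ hq0, ← zpow_add₀ hq0]
    congr 1
    linarith [two_mul_tri n, two_mul_tri (n - 1)]
  have e3 : q ^ ((N : ℤ) + 1 - n) = q ^ N * q * (q ^ n)⁻¹ := by
    rw [zpow_sub₀ hq0, zpow_add₀ hq0, zpow_natCast, zpow_one, div_eq_mul_inv]
  simp only [binomCoeff]
  rw [h1, show (N : ℤ) - n = N + 1 - n - 1 by ring, h2, e1, e2, e3, qPoch_self_succ,
    show (N : ℤ) - (n - 1) = N + 1 - n by ring]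
  push_cast
  have hn := zpow_ne_zero n hq0
  field_simp
  ring

open Polynomial in
lemma coeff_prod_one_sub (hq : ‖q‖ < 1) (hq0 : q ≠ 0) (N n : ℕ) :
    (∏ j ∈ Finset.range N, (1 - C (q ^ j) * X) : ℂ[X]).coeff n = binomCoeff q N n := by
  induction N generalizing n with
  | zero =>
    rcases Nat.eq_zero_or_pos n with rfl | hn
    · simp [binomCoeff, tri]
    · have : binomCoeff q 0 n = 0 := by
        by_contra h
        have := binomCoeff_support h
        omega
      rw [this]
      simp [coeff_one, hn.ne']
  | succ N ih =>
    rw [Finset.prod_range_succ, binomCoeff_succ hq hq0, mul_sub, mul_one, coeff_sub, ih,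
      mul_left_comm, coeff_C_mul]
    congr 2
    cases n with
    | zero =>
      rw [coeff_mul_X_zero]
      by_contra h
      have := binomCoeff_support (Ne.symm h)
      norm_num at this
    | succ n =>
      rw [coeff_mul_X, ih]
      simp

open Polynomial in
lemma coeff_prod_one_sub_mul (hq : ‖q‖ < 1) (hq0 : q ≠ 0) (w : ℂ) (N n : ℕ) :
    (∏ j ∈ Finset.range N, (1 - C (w * q ^ j) * X) : ℂ[X]).coeff n =
      w ^ n * binomCoeff q N n := by
  have h : (∏ j ∈ Finset.range N, (1 - C (w * q ^ j) * X) : ℂ[X]) =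
      (∏ j ∈ Finset.range N, (1 - C (q ^ j) * X) : ℂ[X]).comp (C w * X) := by
    rw [prod_comp]
    refine Finset.prod_congr rfl fun j _ => ?_
    simp only [sub_comp, one_comp, mul_comp, C_comp, X_comp, C_mul]
    ring
  rw [h, comp_C_mul_X_coeff, coeff_prod_one_sub hq hq0, mul_comm]

open Polynomial in
lemma coeff_mul_eq_tsum {P Q : ℂ[X]} {A B : ℤ → ℂ} (hA : ∀ i : ℕ, P.coeff i = A i)
    (hB : ∀ i : ℕ, Q.coeff i = B i) (hA' : ∀ i, A i ≠ 0 → 0 ≤ i) (hB' : ∀ i, B i ≠ 0 → 0 ≤ i)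
    (k : ℕ) : (P * Q).coeff k = ∑' i : ℤ, A i * B (k - i) := by
  rw [coeff_mul, Finset.Nat.sum_antidiagonal_eq_sum_range_succ (fun i j => P.coeff i * Q.coeff j),
    ← sum_range_eq_tsum_int (h := fun i => A i * B (k - i)) k]
  · refine Finset.sum_congr rfl fun i hi => ?_
    have := Finset.mem_range.mp hi
    rw [hA, hB, Nat.cast_sub (by omega)]
  · intro i hi
    have h1 := hA' _ (left_ne_zero_of_mul hi)
    have h2 := hB' _ (right_ne_zero_of_mul hi)
    omega

lemma exists_cube_root : ∃ w : ℂ, w ^ 2 + w + 1 = 0 := by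
  obtain ⟨z, hz⟩ := IsAlgClosed.exists_eq_mul_self (-3 : ℂ)
  exact ⟨(-1 + z) / 2, by linear_combination (-1 / 4) * hz⟩

open Polynomial in
lemma binomCoeff_cube (hq : ‖q‖ < 1) (hq0 : q ≠ 0) {w : ℂ} (hw : w ^ 2 + w + 1 = 0) (N n : ℕ) :
    binomCoeff (q ^ 3) N n = ∑' i : ℤ, binomCoeff q N i * ∑' j : ℤ, w ^ j * binomCoeff q N j *
      ((w ^ 2) ^ (3 * n - i - j) * binomCoeff q N (3 * n - i - j)) := by
  have hq3 : ‖q ^ 3‖ < 1 := by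
    rw [norm_pow]; exact pow_lt_one₀ (norm_nonneg _) hq (by norm_num)
  rw [← coeff_prod_one_sub hq3 (pow_ne_zero 3 hq0)]
  have hprod : expand ℂ 3 (∏ j ∈ Finset.range N, (1 - C ((q ^ 3) ^ j) * X) : ℂ[X]) =
      (∏ j ∈ Finset.range N, (1 - C (q ^ j) * X)) *
        ((∏ j ∈ Finset.range N, (1 - C (w * q ^ j) * X)) *
          ∏ j ∈ Finset.range N, (1 - C (w ^ 2 * q ^ j) * X)) := by
    rw [map_prod, ← Finset.prod_mul_distrib, ← Finset.prod_mul_distrib]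
    refine Finset.prod_congr rfl fun j _ => ?_
    have hw' : (C w : ℂ[X]) ^ 2 + C w + 1 = 0 := by
      rw [← C_pow, ← C_1, ← C_add, ← C_add, hw, C_0]
    rw [← pow_mul, mul_comm 3 j, pow_mul]
    simp only [map_sub, map_one, map_mul, expand_C, expand_X]
    rw [C_pow (a := w), C_pow (a := q ^ j) (n := 3)]
    set a : ℂ[X] := C (q ^ j)
    set W : ℂ[X] := C w
    linear_combination (a * X - a ^ 2 * X ^ 2 * W + a ^ 3 * X ^ 3 * (W - 1)) * hw'
  have hcoeff := congrArg (fun P => P.coeff (n * 3)) hprod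
  simp only [coeff_expand_mul (by norm_num : 0 < 3)] at hcoeff
  have hD : ∀ k : ℕ, ((∏ j ∈ Finset.range N, (1 - C (w * q ^ j) * X)) *
          ∏ j ∈ Finset.range N, (1 - C (w ^ 2 * q ^ j) * X) : ℂ[X]).coeff k =
      ∑' j : ℤ, w ^ j * binomCoeff q N j *
      ((w ^ 2) ^ ((k : ℤ) - j) * binomCoeff q N (k - j)) := by
    intro k
    refine coeff_mul_eq_tsum (A := fun j => w ^ j * binomCoeff q N j)
      (B := fun j => (w ^ 2) ^ j * binomCoeff q N j) (fun i => ?_) (fun i => ?_)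
      (fun i hi => ?_) (fun i hi => ?_) k
    · rw [coeff_prod_one_sub_mul hq hq0, zpow_natCast]
    · rw [coeff_prod_one_sub_mul hq hq0, zpow_natCast]
    · exact (binomCoeff_support (right_ne_zero_of_mul hi)).1
    · exact (binomCoeff_support (right_ne_zero_of_mul hi)).1
  rw [hcoeff, coeff_mul_eq_tsum (A := binomCoeff q N) (B := fun k => ∑' j : ℤ, w ^ j *
    binomCoeff q N j * ((w ^ 2) ^ (k - j) * binomCoeff q N (k - j)))
    (coeff_prod_one_sub hq hq0 N) hD (fun i hi => (binomCoeff_support hi).1)]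
  · push_cast
    simp only [mul_comm (n : ℤ) 3]
  · intro k hk
    by_contra hneg
    apply hk
    convert tsum_zero with j
    by_contra hne
    have h1 := (binomCoeff_support (right_ne_zero_of_mul (left_ne_zero_of_mul hne))).1
    have h2 := (binomCoeff_support (right_ne_zero_of_mul (right_ne_zero_of_mul hne))).1
    omega

lemma chi_eq {w : ℂ} (hw : w ^ 2 + w + 1 = 0) (d : ℤ) :
    chi d = w ^ (d - 1) - w ^ 2 * (if d % 3 = 0 then 1 else if d % 3 = 2 then -1 else 0) := by
  have hw3 : w ^ (3 : ℤ) = 1 := by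
    rw [zpow_ofNat]; linear_combination (w - 1) * hw
  have hw0 : w ≠ 0 := by rintro rfl; norm_num at hw
  obtain ⟨k, hk⟩ : ∃ k, k = d / 3 := ⟨_, rfl⟩
  have h3 := Int.mul_ediv_add_emod d 3
  rw [← hk] at h3
  have hpow : w ^ (d - 1) = w ^ (d % 3) * w⁻¹ := by
    conv_lhs => rw [← h3, add_sub_assoc, zpow_add₀ hw0, zpow_mul, hw3, one_zpow, one_mul,
      zpow_sub_one₀ hw0]
  rw [hpow, chi]
  have hcases : d % 3 = 0 ∨ d % 3 = 1 ∨ d % 3 = 2 := by omega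
  rcases hcases with h | h | h
  · simp only [h]
    norm_num
    field_simp
    linear_combination (w - 1) * hw
  · simp [h, hw0]
  · simp only [h]
    norm_num
    field_simp
    linear_combination -hw

lemma qBinom_cube (N n : ℕ) :
    qBinom (q ^ 3) (N + n) N * ((-1) ^ (N : ℤ) * q ^ (3 * tri N)) =
      binomCoeff (q ^ 3) (N + n) N := by
  have h : (q ^ 3) ^ tri (N : ℤ) = q ^ (3 * tri (N : ℤ)) := by
    rw [zpow_mul]; norm_cast
  rw [binomCoeff, h, qBinom, if_pos (by omega)]
  push_cast
  rw [show (N : ℤ) + n - N = (n : ℕ) by ring, qFacInv_natCast, qFacInv_natCast,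
    show ((N : ℤ) + n).toNat = N + n by omega, Int.toNat_natCast, Int.toNat_natCast,
    div_eq_mul_inv, mul_inv]
  ring

lemma seed_root (hq : ‖q‖ < 1) (hq0 : q ≠ 0) {w : ℂ} (hw : w ^ 2 + w + 1 = 0) (n m : ℕ) :
    qBinom (q ^ 3) (n + m) n = qPoch q q (n + m) ^ 2 *
      ∑' u : ℤ × ℤ, w ^ (u.2 - u.1 - 1) * (q ^ (quad u + 1) * q ^ (u.2 - u.1) *
        kerZero q u n m) := by
  have hw3 : w ^ 3 = 1 := by linear_combination (w - 1) * hw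
  have hw0 : w ≠ 0 := by rintro rfl; norm_num at hw
  have hne : (-1 : ℂ) ^ (n : ℤ) * q ^ (3 * tri n) ≠ 0 :=
    mul_ne_zero (zpow_ne_zero _ (by norm_num)) (zpow_ne_zero _ hq0)
  apply mul_right_cancel₀ hne
  have hs := (summable_mul_kerZero (q := q) (fun u => w ^ (u.2 - u.1 - 1) * (q ^ (quad u + 1) *
    q ^ (u.2 - u.1))) n m)
  simp only [← mul_assoc] at hs ⊢
  rw [mul_assoc, qBinom_cube, binomCoeff_cube hq hq0 hw, hs.tsum_prod, ← tsum_mul_left,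
    ← tsum_mul_right, ← tsum_mul_right, ← (Equiv.addRight ((n : ℤ) - 1)).tsum_eq (fun i => _ * _)]
  refine tsum_congr fun x => ?_
  rw [← tsum_mul_left, ← tsum_mul_left, ← tsum_mul_right, ← tsum_mul_right,
    ← (Equiv.subLeft ((n : ℤ) - x)).tsum_eq (fun i => binomCoeff q _ _ * _)]
  refine tsum_congr fun y => ?_
  simp only [Equiv.coe_addRight, Equiv.subLeft_apply]
  rw [show 3 * (n : ℤ) - (x + (n - 1)) - (n - x - y) = n + (y + 1) by ring,
    show x + ((n : ℤ) - 1) = n + (x - 1) by ring, show (n : ℤ) - x - y = n + (-x - y) by ring]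
  have e1 : w ^ ((n : ℤ) + (-x - y)) * (w ^ 2) ^ ((n : ℤ) + (y + 1)) = w ^ (y - x - 1) := by
    rw [← zpow_natCast w 2, ← zpow_mul, ← zpow_add₀ hw0,
      show (n : ℤ) + (-x - y) + (2 : ℕ) * (n + (y + 1)) = 3 * (n + 1) + (y - x - 1) by
        push_cast; ring, zpow_add₀ hw0, zpow_mul, zpow_ofNat, hw3, one_zpow, one_mul]
  have e2 : (-1 : ℂ) ^ ((n : ℤ) + (x - 1)) * (-1) ^ ((n : ℤ) + (-x - y)) *
      (-1) ^ ((n : ℤ) + (y + 1)) = (-1) ^ (n : ℤ) := by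
    rw [← zpow_add₀ (by norm_num), ← zpow_add₀ (by norm_num),
      show (n : ℤ) + (x - 1) + (n + (-x - y)) + (n + (y + 1)) = n + 2 * n by ring,
      zpow_add₀ (by norm_num), zpow_mul]
    norm_num
  have e3 : q ^ tri ((n : ℤ) + (x - 1)) * q ^ tri ((n : ℤ) + (-x - y)) *
      q ^ tri ((n : ℤ) + (y + 1)) = q ^ (quad (x, y) + 1) * q ^ (y - x) * q ^ (3 * tri n) := by
    simp only [← zpow_add₀ hq0, quad]
    congr 1
    linarith [two_mul_tri ((n : ℤ) + (x - 1)), two_mul_tri ((n : ℤ) + (-x - y)),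
      two_mul_tri ((n : ℤ) + (y + 1)), two_mul_tri (n : ℤ)]
  simp only [binomCoeff, kerZero, ker]
  push_cast
  rw [show (n : ℤ) + m - (n + (x - 1)) = m + 0 - (x - 1) by ring,
    show (n : ℤ) + m - (n + (-x - y)) = m + 0 - (-x - y) by ring,
    show (n : ℤ) + m - (n + (y + 1)) = m + 0 - (y + 1) by ring, add_zero (n + m)]
  generalize qFacInv q (n + (x - 1)) = j1
  generalize qFacInv q (n + (-x - y)) = j2
  generalize qFacInv q (n + (y + 1)) = j3
  generalize qFacInv q (m + 0 - (x - 1)) = j4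
  generalize qFacInv q (m + 0 - (-x - y)) = j5
  generalize qFacInv q (m + 0 - (y + 1)) = j6
  generalize qPoch q q (n + m) = p
  trans (w ^ ((n : ℤ) + (-x - y)) * (w ^ 2) ^ ((n : ℤ) + (y + 1))) *
    ((-1 : ℂ) ^ ((n : ℤ) + (x - 1)) * (-1) ^ ((n : ℤ) + (-x - y)) *
      (-1) ^ ((n : ℤ) + (y + 1))) * (q ^ tri ((n : ℤ) + (x - 1)) * q ^ tri ((n : ℤ) + (-x - y)) *
      q ^ tri ((n : ℤ) + (y + 1))) * (p ^ 3 * j1 * j2 * j3 * j4 * j5 * j6)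
  · ring
  · rw [e1, e2, e3]; ring

lemma seed (hq : ‖q‖ < 1) (hq0 : q ≠ 0) (n m : ℕ) :
    qBinom (q ^ 3) (n + m) n = qPoch q q (n + m) ^ 2 *
      ∑' u : ℤ × ℤ, chi (u.2 - u.1) * q ^ (quad u + 1) * q ^ (u.2 - u.1) * kerZero q u n m := by
  obtain ⟨w, hw⟩ := exists_cube_root
  rw [seed_root hq hq0 hw]
  congr 1
  set σ : ℤ × ℤ ≃ ℤ × ℤ :=
    { toFun := fun u => (u.1, -u.1 - u.2 - 1)
      invFun := fun u => (u.1, -u.1 - u.2 - 1)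
      left_inv := fun u => Prod.ext rfl (by simp only; ring)
      right_inv := fun u => Prod.ext rfl (by simp only; ring) } with hσ
  set D : ℤ × ℤ → ℂ := fun u => w ^ 2 * (q ^ (quad u + 1) * q ^ (u.2 - u.1) * kerZero q u n m)
    with hD
  set E : ℤ × ℤ → ℂ := fun u =>
    if (u.2 - u.1) % 3 = 0 then 1 else if (u.2 - u.1) % 3 = 2 then -1 else 0 with hE
  have h0 : ∑' u, E u * D u = 0 := by
    refine tsum_antisymm_eq_zero σ (fun u => ?_) (fun u => ?_)
    · have hc : (u.2 - u.1) % 3 = 0 ∨ (u.2 - u.1) % 3 = 1 ∨ (u.2 - u.1) % 3 = 2 := by omega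
      simp only [hE, hσ, Equiv.coe_fn_mk]
      rcases hc with h | h | h
      · rw [show (-u.1 - u.2 - 1 - u.1) % 3 = 2 by omega]; simp [h]
      · rw [show (-u.1 - u.2 - 1 - u.1) % 3 = 1 by omega]; simp [h]
      · rw [show (-u.1 - u.2 - 1 - u.1) % 3 = 0 by omega]; simp [h]
    · simp only [hD, hσ, Equiv.coe_fn_mk, kerZero, ker, ← zpow_add₀ hq0]
      rw [show -u.1 - (-u.1 - u.2 - 1) = u.2 + 1 by ring,
        show -u.1 - u.2 - 1 + 1 = -u.1 - u.2 by ring]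
      rw [show quad (u.1, -u.1 - u.2 - 1) + 1 + (-u.1 - u.2 - 1 - u.1) =
        quad u + 1 + (u.2 - u.1) by simp only [quad]; ring]
      ring
  have s1 := summable_mul_kerZero (q := q) (fun u => chi (u.2 - u.1) * q ^ (quad u + 1) *
    q ^ (u.2 - u.1)) n m
  have s2 : Summable fun u => E u * D u := by
    simp only [hD, ← mul_assoc]
    exact summable_mul_kerZero _ n m
  rw [← add_zero (∑' u, chi _ * _ * _ * _), ← h0, ← s1.tsum_add s2]
  refine tsum_congr fun u => ?_
  rw [chi_eq hw]
  simp only [hD, hE]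
  ring

end Seed

section Chain

variable {q : ℂ}

lemma chi_eq_neg {a b : ℤ} (h : (a + b) % 3 = 0) : chi a = -chi b := by
  have hc : b % 3 = 0 ∨ b % 3 = 1 ∨ b % 3 = 2 := by omega
  simp only [chi]
  rcases hc with hb | hb | hb
  · rw [show a % 3 = 0 by omega]; simp [hb]
  · rw [show a % 3 = 2 by omega]; simp [hb]
  · rw [show a % 3 = 1 by omega]; simp [hb]

lemma chi_swapFst (u : ℤ × ℤ) : chi ((swapFst u).2 - (swapFst u).1) = -chi (u.2 - u.1) :=
  chi_eq_neg (by simp only [swapFst, Equiv.coe_fn_mk]; omega)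

lemma chi_swapSnd (u : ℤ × ℤ) : chi ((swapSnd u).2 - (swapSnd u).1) = -chi (u.2 - u.1) :=
  chi_eq_neg (by simp only [swapSnd, Equiv.coe_fn_mk]; omega)

lemma chi_swapOut (u : ℤ × ℤ) : chi ((swapOut u).2 - (swapOut u).1) = -chi (u.2 - u.1) :=
  chi_eq_neg (by simp only [swapOut, Equiv.coe_fn_mk]; omega)

lemma quad_swapFst (u : ℤ × ℤ) : quad (swapFst u) = quad u := by
  simp only [quad, swapFst, Equiv.coe_fn_mk]; ring

lemma quad_swapSnd (u : ℤ × ℤ) : quad (swapSnd u) = quad u := by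
  simp only [quad, swapSnd, Equiv.coe_fn_mk]; ring

lemma quad_swapOut (u : ℤ × ℤ) : quad (swapOut u) = quad u := by
  simp only [quad, swapOut, Equiv.coe_fn_mk]; ring

lemma g0_eq_tsum (hq : ‖q‖ < 1) (hq0 : q ≠ 0) :
    g0 q = fun n m => ∑' u : ℤ × ℤ, (1 - q) * q * (chi (u.2 - u.1) * q ^ quad u) *
      q ^ (u.2 - u.1) * kerTwo q u n m := by
  ext n m
  have hC : ∀ u : ℤ × ℤ, chi ((swapFst u).2 - (swapFst u).1) * q ^ (quad (swapFst u) + 1) =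
      -(chi (u.2 - u.1) * q ^ (quad u + 1)) := fun u => by
    rw [chi_swapFst, quad_swapFst, neg_mul]
  have hC' : ∀ u : ℤ × ℤ, chi ((swapOut u).2 - (swapOut u).1) * q ^ (quad (swapOut u) + 1) =
      -(chi (u.2 - u.1) * q ^ (quad u + 1)) := fun u => by
    rw [chi_swapOut, quad_swapOut, neg_mul]
  have hC'' : ∀ u : ℤ × ℤ, chi ((swapSnd u).2 - (swapSnd u).1) * q ^ (quad (swapSnd u) + 1) =
      -(chi (u.2 - u.1) * q ^ (quad u + 1)) := fun u => by
    rw [chi_swapSnd, quad_swapSnd, neg_mul]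
  have h1 := tsum_kerZero_eq hq hq0 (C := fun u => chi (u.2 - u.1) * q ^ (quad u + 1)) hC n m
  have h2 := tsum_kerOne_eq hq hq0 (C := fun u => chi (u.2 - u.1) * q ^ (quad u + 1))
    hC hC' hC'' n m
  have h3 := tsum_kerOne_eq_pow_mul hq hq0 (C := fun u => chi (u.2 - u.1) * q ^ (quad u + 1))
    hC hC' hC'' n m
  rw [g0, seed hq hq0, h1, h2, h3]
  have h4 : (∑' u : ℤ × ℤ, (1 - q) * q * (chi (u.2 - u.1) * q ^ quad u) *
      q ^ (u.2 - u.1) * kerTwo q u n m) = (1 - q) *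
      ∑' u : ℤ × ℤ, chi (u.2 - u.1) * q ^ (quad u + 1) * q ^ (u.2 - u.1) * kerTwo q u n m := by
    rw [← tsum_mul_left]
    refine tsum_congr fun u => ?_
    rw [zpow_add_one₀ hq0]
    ring
  have h5 : (1 - q) * qPoch (q ^ 2) q (n + m) = qPoch q q (n + m) * (1 - q ^ (n + m + 1)) := by
    rw [← qPoch_self_succ, qPoch, qPoch, Finset.prod_range_succ', mul_comm]
    congr 1
    · exact Finset.prod_congr rfl fun j _ => by ring
    · simp
  have h6 := qPoch_self_ne_zero hq (n + m)
  have h7 : 1 - q ^ (n + m + 1) ≠ 0 := one_sub_pow_ne_zero hq (by omega)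
  have h8 : 1 - q ≠ 0 := by simpa using one_sub_pow_ne_zero hq one_ne_zero
  have h9 : qPoch (q ^ 2) q (n + m) ≠ 0 := fun h => by
    rw [h, mul_zero] at h5
    exact mul_ne_zero h6 h7 h5.symm
  rw [h4]
  generalize (∑' u : ℤ × ℤ, chi (u.2 - u.1) * q ^ (quad u + 1) * q ^ (u.2 - u.1) *
    kerTwo q u n m) = S
  rw [div_eq_iff (mul_ne_zero h6 h9)]
  linear_combination (-qPoch q q (n + m) * S) * h5

lemma step_sub (d e : ℕ) (f g : ℕ → ℕ → ℂ) :
    step q d e (f - g) = step q d e f - step q d e g := by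
  ext n m
  simp only [step, Pi.sub_apply, mul_sub, Finset.sum_sub_distrib]

lemma step_smul (d e : ℕ) (c : ℂ) (f : ℕ → ℕ → ℂ) :
    step q d e (c • f) = c • step q d e f := by
  ext n m
  simp only [step, Pi.smul_apply, smul_eq_mul, Finset.mul_sum]
  exact Finset.sum_congr rfl fun _ _ => Finset.sum_congr rfl fun _ _ => by ring

lemma iterate_step_sub (d e j : ℕ) (f g : ℕ → ℕ → ℂ) :
    (step q d e)^[j] (f - g) = (step q d e)^[j] f - (step q d e)^[j] g := by
  induction j generalizing f g with
  | zero => rfl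
  | succ j ih => simp only [Function.iterate_succ_apply, step_sub, ih]

lemma iterate_step_smul (d e j : ℕ) (c : ℂ) (f : ℕ → ℕ → ℂ) :
    (step q d e)^[j] (c • f) = c • (step q d e)^[j] f := by
  induction j generalizing f with
  | zero => rfl
  | succ j ih => simp only [Function.iterate_succ_apply, step_smul, ih]

lemma iterate_step_kerZero (hq : ‖q‖ < 1) (hq0 : q ≠ 0) (C : ℤ × ℤ → ℂ) (j : ℕ) :
    (step q 0 0)^[j] (fun n m => ∑' u, C u * kerZero q u n m) =
      fun n m => ∑' u, C u * q ^ (j * (quad u - u.1 + u.2 + 1)) * kerZero q u n m := by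
  induction j with
  | zero => simp
  | succ j ih =>
    rw [Function.iterate_succ_apply', ih]
    ext n m
    rw [step_tsum_kerZero hq hq0]
    refine tsum_congr fun u => ?_
    push_cast
    rw [add_mul, one_mul, zpow_add₀ hq0 (j * _)]
    ring

lemma iterate_step_kerOne (hq : ‖q‖ < 1) (hq0 : q ≠ 0) (C : ℤ × ℤ → ℂ) (j : ℕ) :
    (step q 0 1)^[j] (fun n m => ∑' u, C u * kerOne q u n m) =
      fun n m => ∑' u, C u * q ^ (j * (quad u + u.2)) * kerOne q u n m := by
  induction j with
  | zero => simp
  | succ j ih =>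
    rw [Function.iterate_succ_apply', ih]
    ext n m
    rw [step_tsum_kerOne hq hq0]
    refine tsum_congr fun u => ?_
    push_cast
    rw [add_mul, one_mul, zpow_add₀ hq0 (j * _)]
    ring

lemma iterate_step_kerTwo (hq : ‖q‖ < 1) (hq0 : q ≠ 0) (C : ℤ × ℤ → ℂ) (hC : C 0 = 0) (j : ℕ) :
    (step q 1 1)^[j] (fun n m => ∑' u, C u * kerTwo q u n m) =
      fun n m => ∑' u, C u * q ^ (j * (quad u - 1)) * kerTwo q u n m := by
  induction j with
  | zero => simp
  | succ j ih =>
    rw [Function.iterate_succ_apply', ih]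
    ext n m
    rw [step_tsum_kerTwo hq hq0 _ (by simp [hC])]
    refine tsum_congr fun u => ?_
    push_cast
    rw [add_mul, one_mul, zpow_add₀ hq0 (j * _)]
    ring

/-- The composition of `B + t + j` steps of the chain, applied to the seed and corrected so as to
become a single sum over the kernel `kerZero`. -/
lemma chain_seed (hq : ‖q‖ < 1) (hq0 : q ≠ 0) (B t j : ℕ) :
    (step q 0 0)^[B] ((step q 0 1)^[t] ((step q 1 1)^[j] (g0 q))) -
      (step q 0 0)^[B] (fun n m => q ^ m *
        (step q 0 1)^[t] (fun n m => q ^ (n + 1) * (step q 1 1)^[j] (g0 q) n m) n m) =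
    fun n m => ∑' u : ℤ × ℤ, (1 - q) * q * (chi (u.2 - u.1) * q ^ quad u * q ^ (j * (quad u - 1)) *
      q ^ (t * (quad u + u.2)) * q ^ (B * (quad u - u.1 + u.2 + 1))) *
      q ^ (u.2 - u.1) * kerZero q u n m := by
  set C : ℤ × ℤ → ℂ := fun u => (1 - q) * q * (chi (u.2 - u.1) * q ^ quad u) *
    q ^ (j * (quad u - 1)) with hC
  have a1 : ∀ u, C (swapFst u) = -C u := fun u => by
    simp only [hC, quad_swapFst, chi_swapFst]; ring
  have a2 : ∀ u, C (swapOut u) = -C u := fun u => by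
    simp only [hC, quad_swapOut, chi_swapOut]; ring
  have a3 : ∀ u, C (swapSnd u) = -C u := fun u => by
    simp only [hC, quad_swapSnd, chi_swapSnd]; ring
  have hf : (step q 1 1)^[j] (g0 q) = fun n m => ∑' u, C u * q ^ (u.2 - u.1) * kerTwo q u n m := by
    rw [g0_eq_tsum hq hq0, iterate_step_kerTwo hq hq0 _ (by simp [chi])]
    ext n m
    refine tsum_congr fun u => ?_
    simp only [hC]
    ring
  have hf1 : (step q 1 1)^[j] (g0 q) = fun n m => ∑' u, C u * q ^ (u.2 - u.1) * kerOne q u n m := by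
    rw [hf]; ext n m; exact (tsum_kerOne_eq hq hq0 a1 a2 a3 n m).symm
  have hf2 : (fun n m => q ^ (n + 1) * (step q 1 1)^[j] (g0 q) n m) =
      fun n m => ∑' u, C u * q ^ (-u.1) * kerOne q u n m := by
    rw [hf]; ext n m; exact (tsum_kerOne_eq_pow_mul hq hq0 a1 a2 a3 n m).symm
  rw [hf2, hf1, iterate_step_kerOne hq hq0, iterate_step_kerOne hq hq0, ← iterate_step_sub]
  have hC1 : ∀ u, C (swapFst u) * q ^ (t * (quad (swapFst u) + (swapFst u).2)) =
      -(C u * q ^ (t * (quad u + u.2))) := fun u => by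
    rw [a1, quad_swapFst]; simp [swapFst]
  have h4 : ((fun n m => ∑' u, C u * q ^ (u.2 - u.1) * q ^ (t * (quad u + u.2)) * kerOne q u n m) -
      fun n m => q ^ m * ∑' u, C u * q ^ (-u.1) * q ^ (t * (quad u + u.2)) * kerOne q u n m) =
      fun n m => ∑' u, C u * q ^ (t * (quad u + u.2)) * q ^ (u.2 - u.1) * kerZero q u n m := by
    ext n m
    simp only [Pi.sub_apply]
    rw [tsum_kerZero_eq hq hq0 (C := fun u => C u * q ^ (t * (quad u + u.2))) hC1]
    simp only [mul_right_comm (C _)]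
  rw [h4, iterate_step_kerZero hq hq0]
  ext n m
  refine tsum_congr fun u => ?_
  simp only [hC]
  ring

/-- The composition of the `k` steps belonging to the parameters `a` and `b`. -/
def chain (q : ℂ) (a b : ℕ) : ℕ → (ℕ → ℕ → ℂ) → ℕ → ℕ → ℂ
  | 0, g => g
  | k + 1, g => chain q a b k (step q (if a < k + 1 then 1 else 0) (if b < k + 1 then 1 else 0) g)

lemma chain_of_le {a b : ℕ} (k : ℕ) (hb : k ≤ b) (ha : k ≤ a) (g : ℕ → ℕ → ℂ) :
    chain q a b k g = (step q 0 0)^[k] g := by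
  induction k generalizing g with
  | zero => rfl
  | succ k ih =>
    rw [chain, if_neg (by omega), if_neg (by omega), ih (by omega) (by omega),
      Function.iterate_succ_apply]

lemma chain_add_of_le {a b : ℕ} (t : ℕ) (ha : b + t ≤ a) (g : ℕ → ℕ → ℂ) :
    chain q a b (b + t) g = (step q 0 0)^[b] ((step q 0 1)^[t] g) := by
  induction t generalizing g with
  | zero => simpa using chain_of_le b le_rfl (by omega) g
  | succ t ih =>
    rw [← add_assoc, chain, if_neg (by omega), if_pos (by omega), ih (by omega),
      Function.iterate_succ_apply]

lemma chain_eq (b t j : ℕ) (g : ℕ → ℕ → ℂ) :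
    chain q (b + t) b (b + t + j) g =
      (step q 0 0)^[b] ((step q 0 1)^[t] ((step q 1 1)^[j] g)) := by
  induction j generalizing g with
  | zero => simpa using chain_add_of_le t le_rfl g
  | succ j ih =>
    rw [← add_assoc, chain, if_pos (by omega), if_pos (by omega), ih,
      Function.iterate_succ_apply]

lemma step_one_one (h : ℕ → ℕ → ℂ) :
    step q 1 1 h = step q 0 1 (fun n m => q ^ n * h n m) := by
  ext n m
  simp only [step]
  exact Finset.sum_congr rfl fun r _ => Finset.sum_congr rfl fun s _ => by ring

lemma step_zero_one (h : ℕ → ℕ → ℂ) :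
    step q 0 1 h = step q 0 0 (fun n m => q ^ m * h n m) := by
  ext n m
  simp only [step]
  exact Finset.sum_congr rfl fun r _ => Finset.sum_congr rfl fun s _ => by ring

lemma iterate_step_correction (B t j : ℕ) (g : ℕ → ℕ → ℂ) :
    (step q 0 0)^[B + 1] (fun n m => q ^ m *
        (step q 0 1)^[t] (fun n m => q ^ (n + 1) * (step q 1 1)^[j] g n m) n m) =
      q • chain q (B + t) B (B + t + (j + 1)) g := by
  rw [chain_eq, Function.iterate_succ_apply, ← step_zero_one, ← Function.iterate_succ_apply' (step q 0 1),
    Function.iterate_succ_apply' (step q 1 1), step_one_one, ← Function.iterate_succ_apply (step q 0 1),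
    ← iterate_step_smul, ← iterate_step_smul]
  congr 3
  ext n m
  simp only [Pi.smul_apply, smul_eq_mul]
  ring

end Chain

section Limits

variable {q : ℂ}

open Filter Topology

lemma summable_norm_mul_pow (hq : ‖q‖ < 1) (a : ℂ) : Summable fun n : ℕ => ‖-(a * q ^ n)‖ := by
  simp only [norm_neg, norm_mul, norm_pow]
  exact (summable_geometric_of_lt_one (norm_nonneg q) hq).mul_left _

lemma tendsto_qPoch (hq : ‖q‖ < 1) (a : ℂ) :
    Tendsto (qPoch a q) atTop (𝓝 (qPochInf a q)) := by
  have h := (multipliable_one_add_of_summable (summable_norm_mul_pow hq a)).hasProd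
  have h2 := h.tendsto_prod_nat
  simp only [← sub_eq_add_neg] at h2
  exact h2

lemma qPochInf_ne_zero (hq : ‖q‖ < 1) {a : ℂ} (ha : ∀ n : ℕ, 1 - a * q ^ n ≠ 0) :
    qPochInf a q ≠ 0 := by
  have h := tprod_one_add_ne_zero_of_summable (f := fun n : ℕ => -(a * q ^ n))
    (by simpa only [← sub_eq_add_neg] using ha) (summable_norm_mul_pow hq a)
  simp only [← sub_eq_add_neg] at h
  exact h

lemma qPochInf_self_ne_zero (hq : ‖q‖ < 1) : qPochInf q q ≠ 0 :=
  qPochInf_ne_zero hq fun n => by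
    rw [← pow_succ']
    exact one_sub_pow_ne_zero hq n.succ_ne_zero

lemma qPochInf_eq_mul (hq : ‖q‖ < 1) (a : ℂ) : qPochInf a q = (1 - a) * qPochInf (a * q) q := by
  have h1 := (tendsto_qPoch hq a).comp (tendsto_add_atTop_nat 1)
  have h2 := (tendsto_qPoch hq (a * q)).const_mul (1 - a)
  refine tendsto_nhds_unique h1 (h2.congr fun n => ?_)
  simp only [Function.comp, qPoch, Finset.prod_range_succ']
  rw [mul_comm]
  simp [pow_succ', mul_assoc]

lemma tendsto_qFacInv_natCast (hq : ‖q‖ < 1) :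
    Tendsto (fun n : ℕ => qFacInv q n) atTop (𝓝 (qPochInf q q)⁻¹) := by
  simp only [qFacInv_natCast]
  exact (tendsto_qPoch hq q).inv₀ (qPochInf_self_ne_zero hq)

lemma tendsto_qFacInv (hq : ‖q‖ < 1) (z : ℤ) :
    Tendsto (fun n : ℕ => qFacInv q (n + z)) atTop (𝓝 (qPochInf q q)⁻¹) := by
  have h : Tendsto (fun n : ℕ => ((n : ℤ) + z).toNat) atTop atTop :=
    tendsto_atTop_mono (fun n => show n - z.natAbs ≤ _ by omega) (tendsto_sub_atTop_nat _)
  refine ((tendsto_qFacInv_natCast hq).comp h).congr' ?_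
  filter_upwards [eventually_ge_atTop z.natAbs] with n hn
  simp only [Function.comp]
  rw [Int.toNat_of_nonneg (by omega)]

lemma exists_norm_qFacInv_le (hq : ‖q‖ < 1) : ∃ M, 0 ≤ M ∧ ∀ z, ‖qFacInv q z‖ ≤ M := by
  obtain ⟨M, hM⟩ := (Metric.isBounded_range_of_tendsto _
    (tendsto_qFacInv_natCast hq)).exists_norm_le
  have hM0 : 0 ≤ M := (norm_nonneg _).trans (hM _ ⟨0, rfl⟩)
  refine ⟨M, hM0, fun z => ?_⟩
  rcases lt_or_ge z 0 with h | h
  · rwa [qFacInv_of_neg h, norm_zero]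
  · lift z to ℕ using h
    exact hM _ ⟨z, rfl⟩

lemma exists_norm_qPoch_le (hq : ‖q‖ < 1) (a : ℂ) : ∃ M, 0 ≤ M ∧ ∀ n, ‖qPoch a q n‖ ≤ M := by
  obtain ⟨M, hM⟩ := (Metric.isBounded_range_of_tendsto _ (tendsto_qPoch hq a)).exists_norm_le
  exact ⟨M, (norm_nonneg _).trans (hM _ ⟨0, rfl⟩), fun n => hM _ ⟨n, rfl⟩⟩

lemma exists_norm_g0_le (hq : ‖q‖ < 1) : ∃ M, 0 ≤ M ∧ ∀ n m, ‖g0 q n m‖ ≤ M := by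
  have hq3 : ‖q ^ 3‖ < 1 := by
    rw [norm_pow]
    exact pow_lt_one₀ (norm_nonneg q) hq (by norm_num)
  obtain ⟨M1, h1, hM1⟩ := exists_norm_qPoch_le hq3 (q ^ 3)
  obtain ⟨M2, h2, hM2⟩ := exists_norm_qFacInv_le hq3
  obtain ⟨M3, h3, hM3⟩ := exists_norm_qFacInv_le hq
  refine ⟨M1 * (M2 * M2) * (M3 * (M3 * (1 + 1))), by positivity, fun n m => ?_⟩
  have h : g0 q n m = qPoch (q ^ 3) (q ^ 3) (n + m) *
      (qFacInv (q ^ 3) n * qFacInv (q ^ 3) m) *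
        (qFacInv q (n + m : ℕ) * (qFacInv q (n + m + 1 : ℕ) * (1 - q))) := by
    have h4 : qPoch q q (n + m + 1) = (1 - q) * qPoch (q ^ 2) q (n + m) := by
      simp only [qPoch, Finset.prod_range_succ']
      rw [mul_comm]
      simp [pow_succ', mul_assoc]
    have h5 : 1 - q ≠ 0 := by simpa using one_sub_pow_ne_zero hq one_ne_zero
    simp only [g0, qBinom, qFacInv_natCast, h4]
    rw [if_pos (by omega), show ((n : ℤ) + m).toNat = n + m by omega,
      show ((n : ℤ) + m - n).toNat = m by omega, Int.toNat_natCast]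
    field_simp
  have h6 : ‖1 - q‖ ≤ 1 + 1 := (norm_sub_le _ _).trans (by simpa using hq.le)
  rw [h]
  simp only [norm_mul]
  gcongr <;> apply_assumption

end Limits

section Multisum

variable {q : ℂ}

open Filter Topology

lemma norm_pow_quad_le (hq : ‖q‖ < 1) (r s c d : ℕ) :
    ‖q ^ (r ^ 2 + s ^ 2 - r * s + c * r + d * s)‖ ≤ √‖q‖ ^ r * √‖q‖ ^ s := by
  have ht : √‖q‖ ≤ 1 := by
    rw [Real.sqrt_le_iff]
    simpa using hq.le
  have h : r + s ≤ 2 * (r ^ 2 + s ^ 2 - r * s + c * r + d * s) := by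
    have h1 : r * s ≤ r ^ 2 + s ^ 2 := by nlinarith
    zify [h1]
    have h2 : (r : ℤ) ≤ r ^ 2 := by exact_mod_cast Nat.le_self_pow two_ne_zero r
    have h3 : (s : ℤ) ≤ s ^ 2 := by exact_mod_cast Nat.le_self_pow two_ne_zero s
    have h4 : (0 : ℤ) ≤ c * r := by positivity
    have h5 : (0 : ℤ) ≤ d * s := by positivity
    nlinarith [sq_nonneg ((r : ℤ) - s)]
  rw [norm_pow, ← pow_add]
  nth_rw 1 [← Real.sq_sqrt (norm_nonneg q)]
  rw [← pow_mul]
  exact pow_le_pow_of_le_one (Real.sqrt_nonneg _) ht h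

lemma sqrt_norm_lt_one (hq : ‖q‖ < 1) : √‖q‖ < 1 := by
  rw [Real.sqrt_lt' one_pos]
  simpa using hq

lemma exists_norm_step_le (hq : ‖q‖ < 1) (c d : ℕ) {f : ℕ → ℕ → ℂ}
    (hf : ∃ M, 0 ≤ M ∧ ∀ n m, ‖f n m‖ ≤ M) : ∃ M, 0 ≤ M ∧ ∀ n m, ‖step q c d f n m‖ ≤ M := by
  obtain ⟨F, hF0, hF⟩ := hf
  obtain ⟨M, hM0, hM⟩ := exists_norm_qFacInv_le hq
  set t := √‖q‖ with htdef
  have ht : t < 1 := sqrt_norm_lt_one hq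
  have ht0 : 0 ≤ t := Real.sqrt_nonneg _
  have hg : ∀ n : ℕ, ∑ i ∈ Finset.range n, t ^ i ≤ (1 - t)⁻¹ := fun n => by
    rw [← tsum_geometric_of_lt_one ht0 ht]
    exact (summable_geometric_of_lt_one ht0 ht).sum_le_tsum _ fun i _ => by positivity
  refine ⟨(1 - t)⁻¹ * ((1 - t)⁻¹ * (M * M * F)), ?_, fun n m => ?_⟩
  · have : 0 ≤ (1 - t)⁻¹ := inv_nonneg.mpr (by linarith)
    positivity
  calc ‖step q c d f n m‖
      ≤ ∑ r ∈ Finset.range (n + 1), ∑ s ∈ Finset.range (m + 1), t ^ r * (t ^ s * (M * M * F)) := by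
        refine norm_sum_le_of_le _ fun r _ => norm_sum_le_of_le _ fun s _ => ?_
        rw [norm_mul, norm_mul, norm_mul]
        calc _ ≤ t ^ r * t ^ s * M * M * F := by
              gcongr
              · exact norm_pow_quad_le hq r s c d
              · exact hM _
              · exact hM _
              · exact hF _ _
          _ = _ := by ring
    _ = (∑ r ∈ Finset.range (n + 1), t ^ r) *
          ((∑ s ∈ Finset.range (m + 1), t ^ s) * (M * M * F)) := by
        rw [Finset.sum_mul]
        simp only [Finset.sum_mul, Finset.mul_sum]
    _ ≤ _ := by
        have h0 : 0 ≤ (1 - t)⁻¹ := inv_nonneg.mpr (by linarith)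
        gcongr
        · exact hg _
        · exact hg _

lemma exists_norm_iterate_step_le (hq : ‖q‖ < 1) (c d k : ℕ) {f : ℕ → ℕ → ℂ}
    (hf : ∃ M, 0 ≤ M ∧ ∀ n m, ‖f n m‖ ≤ M) :
    ∃ M, 0 ≤ M ∧ ∀ n m, ‖(step q c d)^[k] f n m‖ ≤ M := by
  induction k with
  | zero => exact hf
  | succ k ih =>
    rw [Function.iterate_succ_apply']
    exact exists_norm_step_le hq c d ih

/-- The summand of an iterated sum obtained by composing `k` steps. -/
def multi (q : ℂ) (g : ℕ → ℕ → ℂ) :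
    (k : ℕ) → (d e : ℕ → ℕ) → (l μ : Fin k → ℕ) → (n m : ℕ) → ℂ
  | 0, _, _, _, _, n, m => g n m
  | k + 1, d, e, l, μ, n, m =>
    q ^ (l 0 ^ 2 + μ 0 ^ 2 - l 0 * μ 0 + d 0 * l 0 + e 0 * μ 0) * qFacInv q ((n : ℤ) - l 0) *
      qFacInv q ((m : ℤ) - μ 0) *
        multi q g k (fun i => d (i + 1)) (fun i => e (i + 1)) (Fin.tail l) (Fin.tail μ) (l 0) (μ 0)

/-- The composition of `k` steps with weights `d` and `e`. -/
def compSteps (q : ℂ) (g : ℕ → ℕ → ℂ) : ℕ → (d e : ℕ → ℕ) → ℕ → ℕ → ℂ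
  | 0, _, _ => g
  | k + 1, d, e => step q (d 0) (e 0) (compSteps q g k (fun i => d (i + 1)) (fun i => e (i + 1)))

lemma compSteps_succ (g : ℕ → ℕ → ℂ) (k : ℕ) (d e : ℕ → ℕ) :
    compSteps q g (k + 1) d e = compSteps q (step q (d k) (e k) g) k d e := by
  induction k generalizing d e with
  | zero => rfl
  | succ k ih => rw [compSteps, ih, compSteps]

lemma chain_eq_compSteps (a b k : ℕ) (g : ℕ → ℕ → ℂ) :
    chain q a b k g = compSteps q g k (fun i => if a < i + 1 then 1 else 0)
      (fun i => if b < i + 1 then 1 else 0) := by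
  induction k generalizing g with
  | zero => rfl
  | succ k ih => rw [chain, ih, compSteps_succ]

/-- A summable weight on sequences of natural numbers. -/
def geomWeight (q : ℂ) {k : ℕ} (l : Fin k → ℕ) : ℝ := ∏ i, √‖q‖ ^ l i

lemma geomWeight_nonneg {k : ℕ} (l : Fin k → ℕ) : 0 ≤ geomWeight q l :=
  Finset.prod_nonneg fun _ _ => pow_nonneg (Real.sqrt_nonneg _) _

lemma geomWeight_succ {k : ℕ} (l : Fin (k + 1) → ℕ) :
    geomWeight q l = √‖q‖ ^ l 0 * geomWeight q (Fin.tail l) := by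
  simp [geomWeight, Fin.prod_univ_succ, Fin.tail]

lemma summable_geomWeight (hq : ‖q‖ < 1) (k : ℕ) :
    Summable fun l : Fin k → ℕ => geomWeight q l := by
  induction k with
  | zero => exact (hasSum_fintype _).summable
  | succ k ih =>
    rw [← (Fin.consEquiv fun _ : Fin (k + 1) => ℕ).summable_iff]
    refine ((summable_geometric_of_lt_one (Real.sqrt_nonneg _) (sqrt_norm_lt_one hq)).mul_of_nonneg
      ih (fun n => pow_nonneg (Real.sqrt_nonneg _) n) geomWeight_nonneg).congr fun p => ?_
    rw [Function.comp_apply, geomWeight_succ]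
    rfl

lemma summable_geomWeight_mul (hq : ‖q‖ < 1) (k : ℕ) :
    Summable fun p : (Fin k → ℕ) × (Fin k → ℕ) => geomWeight q p.1 * geomWeight q p.2 :=
  (summable_geomWeight hq k).mul_of_nonneg (summable_geomWeight hq k) geomWeight_nonneg
    geomWeight_nonneg

lemma exists_norm_multi_le (hq : ‖q‖ < 1) {g : ℕ → ℕ → ℂ}
    (hg : ∃ M, 0 ≤ M ∧ ∀ n m, ‖g n m‖ ≤ M) (k : ℕ) (d e : ℕ → ℕ) :
    ∃ C, 0 ≤ C ∧ ∀ l μ n m, ‖multi q g k d e l μ n m‖ ≤ C * (geomWeight q l * geomWeight q μ) := by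
  induction k generalizing d e with
  | zero =>
    obtain ⟨C, h0, hC⟩ := hg
    exact ⟨C, h0, fun l μ n m => by simpa [multi, geomWeight] using hC n m⟩
  | succ k ih =>
    obtain ⟨C, h0, hC⟩ := ih (fun i => d (i + 1)) (fun i => e (i + 1))
    obtain ⟨M, hM0, hM⟩ := exists_norm_qFacInv_le hq
    refine ⟨M * M * C, by positivity, fun l μ n m => ?_⟩
    rw [multi, norm_mul, norm_mul, norm_mul, geomWeight_succ, geomWeight_succ]
    calc _ ≤ √‖q‖ ^ l 0 * √‖q‖ ^ μ 0 * M * M *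
          (C * (geomWeight q (Fin.tail l) * geomWeight q (Fin.tail μ))) := by
          gcongr
          · exact norm_pow_quad_le hq _ _ _ _
          · exact hM _
          · exact hM _
          · exact hC _ _ _ _
      _ = _ := by ring

lemma summable_multi (hq : ‖q‖ < 1) {g : ℕ → ℕ → ℂ} (hg : ∃ M, 0 ≤ M ∧ ∀ n m, ‖g n m‖ ≤ M)
    (k : ℕ) (d e : ℕ → ℕ) (n m : ℕ) :
    Summable fun p : (Fin k → ℕ) × (Fin k → ℕ) => multi q g k d e p.1 p.2 n m := by
  obtain ⟨C, -, hC⟩ := exists_norm_multi_le hq hg k d e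
  exact ((summable_geomWeight_mul hq k).mul_left C).of_norm_bounded fun p => hC _ _ _ _

lemma tsum_multi (hq : ‖q‖ < 1) {g : ℕ → ℕ → ℂ} (hg : ∃ M, 0 ≤ M ∧ ∀ n m, ‖g n m‖ ≤ M)
    (k : ℕ) (d e : ℕ → ℕ) (n m : ℕ) :
    ∑' p : (Fin k → ℕ) × (Fin k → ℕ), multi q g k d e p.1 p.2 n m = compSteps q g k d e n m := by
  induction k generalizing d e n m with
  | zero => simp [multi, compSteps]
  | succ k ih =>
    let E : (ℕ × ℕ) × ((Fin k → ℕ) × (Fin k → ℕ)) ≃ (Fin (k + 1) → ℕ) × (Fin (k + 1) → ℕ) :=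
      (Equiv.prodProdProdComm _ _ _ _).trans
        ((Fin.consEquiv fun _ : Fin (k + 1) => ℕ).prodCongr
          (Fin.consEquiv fun _ : Fin (k + 1) => ℕ))
    have hs := E.summable_iff.mpr (summable_multi hq hg (k + 1) d e n m)
    rw [← E.tsum_eq, compSteps]
    have h : ∀ c : ℕ × ℕ, ∑' p, (fun p : (Fin (k + 1) → ℕ) × (Fin (k + 1) → ℕ) =>
        multi q g (k + 1) d e p.1 p.2 n m) (E (c, p)) =
        q ^ (c.1 ^ 2 + c.2 ^ 2 - c.1 * c.2 + d 0 * c.1 + e 0 * c.2) *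
          qFacInv q ((n : ℤ) - c.1) * qFacInv q ((m : ℤ) - c.2) *
            compSteps q g k (fun i => d (i + 1)) (fun i => e (i + 1)) c.1 c.2 := fun c => by
      rw [← ih, ← tsum_mul_left]
      rfl
    refine hs.tsum_prod.trans ((tsum_congr h).trans ?_)
    rw [tsum_eq_sum (s := Finset.range (n + 1) ×ˢ Finset.range (m + 1)), Finset.sum_product]
    · rfl
    · rintro ⟨r, s⟩ hrs
      simp only [Finset.mem_product, Finset.mem_range, not_and_or, not_lt] at hrs
      rcases hrs with h1 | h1
      · rw [qFacInv_of_neg (z := (n : ℤ) - r) (by omega)]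
        ring
      · rw [qFacInv_of_neg (z := (m : ℤ) - s) (by omega)]
        ring

end Multisum

section Fab

variable {q : ℂ}

open Filter Topology

lemma nth_one {k : ℕ} (l : Fin (k + 1) → ℕ) : nth l 1 = l 0 := by
  simp [nth]

lemma nth_succ {k : ℕ} (l : Fin k → ℕ) (i : Fin k) : nth l (i + 1) = l i := by
  rw [nth, dif_pos (by omega)]
  rfl

lemma nth_tail {k : ℕ} (l : Fin (k + 1) → ℕ) (i : ℕ) :
    nth (Fin.tail l) (i + 1) = nth l (i + 2) := by
  unfold nth
  split_ifs <;> first | omega | rfl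

/-- The summand of `Fab` without its numerator, for a general seed `g`. -/
def summand (q : ℂ) (g : ℕ → ℕ → ℂ) (a b k : ℕ) (p : (Fin k → ℕ) × (Fin k → ℕ)) : ℂ :=
  q ^ ((∑ i ∈ Finset.Icc 1 k, (nth p.1 i ^ 2 + nth p.2 i ^ 2 - nth p.1 i * nth p.2 i)) +
      (∑ i ∈ Finset.Icc (a + 1) k, nth p.1 i) + (∑ i ∈ Finset.Icc (b + 1) k, nth p.2 i)) *
    (∏ i ∈ Finset.Icc 1 (k - 1),
      qFacInv q ((nth p.1 i : ℤ) - (nth p.1 (i + 1) : ℤ)) *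
        qFacInv q ((nth p.2 i : ℤ) - (nth p.2 (i + 1) : ℤ))) *
    g (nth p.1 k) (nth p.2 k)

lemma multi_eq (g : ℕ → ℕ → ℂ) (k : ℕ) (d e : ℕ → ℕ) (l μ : Fin (k + 1) → ℕ) (n m : ℕ) :
    multi q g (k + 1) d e l μ n m = qFacInv q ((n : ℤ) - l 0) * qFacInv q ((m : ℤ) - μ 0) *
      (q ^ (∑ i ∈ Finset.range (k + 1), (nth l (i + 1) ^ 2 + nth μ (i + 1) ^ 2 -
          nth l (i + 1) * nth μ (i + 1) + d i * nth l (i + 1) + e i * nth μ (i + 1))) *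
        (∏ i ∈ Finset.range k, qFacInv q ((nth l (i + 1) : ℤ) - (nth l (i + 2) : ℤ)) *
          qFacInv q ((nth μ (i + 1) : ℤ) - (nth μ (i + 2) : ℤ))) *
        g (nth l (k + 1)) (nth μ (k + 1))) := by
  induction k generalizing d e n m with
  | zero =>
    simp only [multi, zero_add, Finset.range_one, Finset.sum_singleton, Finset.range_zero,
      Finset.prod_empty, nth_one]
    ring
  | succ k ih =>
    have h (l : Fin (k + 1 + 1) → ℕ) : Fin.tail l 0 = nth l 2 :=
      (nth_one _).symm.trans (nth_tail l 0)
    rw [multi, ih, Finset.sum_range_succ' _ (k + 1), Finset.prod_range_succ', pow_add q (∑ _ ∈ _, _)]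
    simp only [nth_tail, zero_add, nth_one, h, add_assoc, Nat.reduceAdd]
    ring

lemma sum_Icc_eq_range (a k : ℕ) (f : ℕ → ℕ) :
    ∑ i ∈ Finset.Icc (a + 1) k, f i =
      ∑ i ∈ Finset.range k, (if a < i + 1 then 1 else 0) * f (i + 1) := by
  induction k with
  | zero => simp
  | succ k ih =>
    rw [Finset.sum_range_succ, ← ih]
    by_cases h : a < k + 1
    · rw [Finset.sum_Icc_succ_top (by omega), if_pos h, one_mul]
    · rw [if_neg h, Finset.Icc_eq_empty (by omega), Finset.Icc_eq_empty (by omega)]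
      simp

lemma multi_eq_summand (g : ℕ → ℕ → ℂ) (a b k : ℕ) (p : (Fin (k + 1) → ℕ) × (Fin (k + 1) → ℕ))
    (n m : ℕ) :
    multi q g (k + 1) (fun i => if a < i + 1 then 1 else 0) (fun i => if b < i + 1 then 1 else 0)
      p.1 p.2 n m = qFacInv q ((n : ℤ) - p.1 0) * qFacInv q ((m : ℤ) - p.2 0) *
        summand q g a b (k + 1) p := by
  rw [multi_eq, summand, sum_Icc_eq_range, sum_Icc_eq_range, sum_Icc_eq_range,
    ← Finset.sum_add_distrib, ← Finset.sum_add_distrib]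
  have h : ∏ i ∈ Finset.Icc 1 k, qFacInv q ((nth p.1 i : ℤ) - (nth p.1 (i + 1) : ℤ)) *
        qFacInv q ((nth p.2 i : ℤ) - (nth p.2 (i + 1) : ℤ)) =
      ∏ i ∈ Finset.range k, qFacInv q ((nth p.1 (i + 1) : ℤ) - (nth p.1 (i + 2) : ℤ)) *
          qFacInv q ((nth p.2 (i + 1) : ℤ) - (nth p.2 (i + 2) : ℤ)) := by
    rw [← Finset.Ico_add_one_right_eq_Icc, Finset.range_eq_Ico]
    exact (Finset.prod_Ico_add' (fun i => qFacInv q ((nth p.1 i : ℤ) - (nth p.1 (i + 1) : ℤ)) *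
      qFacInv q ((nth p.2 i : ℤ) - (nth p.2 (i + 1) : ℤ))) 0 k 1).symm
  simp [h, add_assoc]

lemma summable_summand (hq : ‖q‖ < 1) {g : ℕ → ℕ → ℂ} (hg : ∃ M, 0 ≤ M ∧ ∀ n m, ‖g n m‖ ≤ M)
    (a b k : ℕ) : Summable (summand q g a b (k + 1)) := by
  obtain ⟨C, -, hC⟩ := exists_norm_multi_le hq hg (k + 1) (fun i => if a < i + 1 then 1 else 0)
    (fun i => if b < i + 1 then 1 else 0)
  refine ((summable_geomWeight_mul hq (k + 1)).mul_left C).of_norm_bounded fun p => ?_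
  have h := hC p.1 p.2 (p.1 0) (p.2 0)
  rwa [multi_eq_summand, sub_self, sub_self, qFacInv_zero, one_mul, one_mul] at h

lemma tendsto_chain (hq : ‖q‖ < 1) {g : ℕ → ℕ → ℂ} (hg : ∃ M, 0 ≤ M ∧ ∀ n m, ‖g n m‖ ≤ M)
    (a b k : ℕ) :
    Tendsto (fun n => chain q a b (k + 1) g n n) atTop
      (𝓝 ((qPochInf q q)⁻¹ * (qPochInf q q)⁻¹ * ∑' p, summand q g a b (k + 1) p)) := by
  obtain ⟨C, -, hC⟩ := exists_norm_multi_le hq hg (k + 1) (fun i => if a < i + 1 then 1 else 0)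
    (fun i => if b < i + 1 then 1 else 0)
  rw [← tsum_mul_left]
  refine (tendsto_tsum_of_dominated_convergence ((summable_geomWeight_mul hq (k + 1)).mul_left C)
    (fun p => ?_) (Eventually.of_forall fun n p => hC p.1 p.2 n n)).congr fun n => ?_
  · simp only [multi_eq_summand, sub_eq_add_neg]
    exact ((tendsto_qFacInv hq _).mul (tendsto_qFacInv hq _)).mul_const _
  · rw [chain_eq_compSteps, tsum_multi hq hg]

lemma antitone_of_summand_ne_zero {g : ℕ → ℕ → ℂ} {a b k : ℕ}
    {p : (Fin k → ℕ) × (Fin k → ℕ)} (h : summand q g a b k p ≠ 0) :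
    (∀ i j, i ≤ j → p.1 j ≤ p.1 i) ∧ ∀ i j, i ≤ j → p.2 j ≤ p.2 i := by
  obtain _ | k := k
  · exact ⟨fun i => i.elim0, fun i => i.elim0⟩
  have h1 := Finset.prod_ne_zero_iff.mp (right_ne_zero_of_mul (left_ne_zero_of_mul h))
  have h2 : ∀ i : Fin k, p.1 i.succ ≤ p.1 i.castSucc ∧ p.2 i.succ ≤ p.2 i.castSucc := fun i => by
    have h3 := h1 (i + 1) (Finset.mem_Icc.mpr ⟨by omega, by simp⟩)
    have h4 := nonneg_of_qFacInv_ne_zero (left_ne_zero_of_mul h3)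
    have h5 := nonneg_of_qFacInv_ne_zero (right_ne_zero_of_mul h3)
    have e1 := nth_succ p.1 i.castSucc
    have e2 := nth_succ p.1 i.succ
    have e3 := nth_succ p.2 i.castSucc
    have e4 := nth_succ p.2 i.succ
    simp only [Fin.val_castSucc, Fin.val_succ] at e1 e2 e3 e4
    rw [e1, e2] at h4
    rw [e3, e4] at h5
    omega
  exact ⟨Fin.antitone_iff_succ_le.mpr fun i => (h2 i).1,
    Fin.antitone_iff_succ_le.mpr fun i => (h2 i).2⟩

lemma tsum_decr {k : ℕ} {f : (Fin k → ℕ) × (Fin k → ℕ) → ℂ}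
    (h : ∀ p, f p ≠ 0 → (∀ i j, i ≤ j → p.1 j ≤ p.1 i) ∧ ∀ i j, i ≤ j → p.2 j ≤ p.2 i) :
    ∑' p : Decr k × Decr k, f (p.1.1, p.2.1) = ∑' p, f p := by
  have hi : Function.Injective fun p : Decr k × Decr k => (p.1.1, p.2.1) := fun p r hpr =>
    Prod.ext (Subtype.ext (Prod.ext_iff.mp hpr).1) (Subtype.ext (Prod.ext_iff.mp hpr).2)
  refine hi.tsum_eq (f := f) fun p hp => ?_
  obtain ⟨h1, h2⟩ := h p hp
  exact ⟨(⟨p.1, h1⟩, ⟨p.2, h2⟩), rfl⟩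

lemma Fab_eq_of_eq_zero (a k : ℕ) :
    Fab q a 0 k = (1 - q)⁻¹ * ∑' p, summand q (g0 q) a 0 k p := by
  rw [← tsum_decr fun p => antitone_of_summand_ne_zero, ← tsum_mul_left]
  refine tsum_congr fun p => ?_
  simp only [or_true, if_true, summand]
  ring

lemma pow_mul_summand (g : ℕ → ℕ → ℂ) {a b k : ℕ} (ha : a < k) (hb : b < k)
    (p : (Fin k → ℕ) × (Fin k → ℕ)) :
    q ^ (nth p.1 (a + 1) + nth p.2 (b + 1)) * summand q g (a + 1) (b + 1) k p =
      summand q g a b k p := by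
  have h1 : ∑ i ∈ Finset.Icc (a + 1) k, nth p.1 i =
      nth p.1 (a + 1) + ∑ i ∈ Finset.Icc (a + 1 + 1) k, nth p.1 i := by
    rw [← Finset.insert_Icc_add_one_left_eq_Icc (by omega), Finset.sum_insert (by simp)]
  have h2 : ∑ i ∈ Finset.Icc (b + 1) k, nth p.2 i =
      nth p.2 (b + 1) + ∑ i ∈ Finset.Icc (b + 1 + 1) k, nth p.2 i := by
    rw [← Finset.insert_Icc_add_one_left_eq_Icc (by omega), Finset.sum_insert (by simp)]
  rw [summand, summand, h1, h2]
  simp only [pow_add]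
  ring

lemma Fab_succ_succ (hq : ‖q‖ < 1) {a b k : ℕ} (ha : a < k + 1) (hb : b < k + 1) :
    Fab q (a + 1) (b + 1) (k + 1) = (1 - q)⁻¹ *
      (∑' p, summand q (g0 q) (a + 1) (b + 1) (k + 1) p -
        q * ∑' p, summand q (g0 q) a b (k + 1) p) := by
  have hg := exists_norm_g0_le hq
  rw [← tsum_mul_left, ← (summable_summand hq hg _ _ _).tsum_sub
    ((summable_summand hq hg _ _ _).mul_left q), ← tsum_mul_left]
  simp only [← pow_mul_summand (g0 q) ha hb]
  rw [← tsum_decr]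
  · refine tsum_congr fun p => ?_
    simp only [Nat.add_eq_zero_iff, one_ne_zero, and_false, or_self, if_false, summand]
    ring
  · refine fun p hp => antitone_of_summand_ne_zero (q := q) (g := g0 q) (a := a + 1) (b := b + 1)
      fun h0 => hp ?_
    rw [h0]
    simp

end Fab

section ThetaSeries

variable {q : ℂ}

open Filter Topology

lemma norm_chi_le (d : ℤ) : ‖chi d‖ ≤ 1 := by
  unfold chi
  split_ifs <;> simp

/-- The summand of the `A₂` theta series of level `L`. -/
def latticeTerm (q : ℂ) (L α β : ℤ) (u : ℤ × ℤ) : ℂ :=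
  chi (u.2 - u.1) * q ^ (L * quad u + α * u.2 - β * u.1)

/-- The `A₂` theta series of level `L`. -/
def latticeSum (q : ℂ) (L α β : ℤ) : ℂ := ∑' u, latticeTerm q L α β u

lemma summable_pow_natAbs {r : ℝ} (h0 : 0 ≤ r) (h1 : r < 1) :
    Summable fun x : ℤ => r ^ x.natAbs :=
  summable_int_iff_summable_nat_and_neg.mpr
    ⟨by simpa using summable_geometric_of_lt_one h0 h1,
      by simpa using summable_geometric_of_lt_one h0 h1⟩

lemma summable_zpow_of_le (hq : ‖q‖ < 1) (hq0 : q ≠ 0) {E : ℤ × ℤ → ℤ} (D : ℤ)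
    (hE : ∀ u, |u.1| + |u.2| - D ≤ E u) : Summable fun u => ‖q ^ E u‖ := by
  have h0 : 0 < ‖q‖ := norm_pos_iff.mpr hq0
  refine Summable.of_nonneg_of_le (fun _ => norm_nonneg _) (fun u => ?_)
    (((summable_pow_natAbs h0.le hq).mul_of_nonneg (summable_pow_natAbs h0.le hq)
      (fun _ => by positivity) (fun _ => by positivity)).mul_left (‖q‖ ^ (-D)))
  rw [norm_zpow, ← zpow_natCast, ← zpow_natCast, ← zpow_add₀ h0.ne', ← zpow_add₀ h0.ne',
    Int.natCast_natAbs, Int.natCast_natAbs]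
  exact zpow_le_zpow_right_of_le_one₀ h0 hq.le (by have := hE u; omega)

lemma abs_add_abs_sub_le {L : ℤ} (hL : 1 ≤ L) (α β : ℤ) (u : ℤ × ℤ) :
    |u.1| + |u.2| - ((|α| + 1) ^ 2 + (|β| + 1) ^ 2) ≤ L * quad u + α * u.2 - β * u.1 := by
  obtain ⟨x, y⟩ := u
  simp only [quad]
  have h1 : x ^ 2 + x * y + y ^ 2 ≤ L * (x ^ 2 + x * y + y ^ 2) :=
    le_mul_of_one_le_left (by nlinarith [sq_nonneg (x + y), sq_nonneg x, sq_nonneg y]) hL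
  have h2 : -(|α| * |y|) ≤ α * y := by rw [← abs_mul]; exact neg_abs_le _
  have h3 : β * x ≤ |β| * |x| := by rw [← abs_mul]; exact le_abs_self _
  nlinarith [sq_nonneg (x + y), sq_abs x, sq_abs y, sq_nonneg (|y| - (|α| + 1)),
    sq_nonneg (|x| - (|β| + 1))]

lemma summable_norm_latticeTerm (hq : ‖q‖ < 1) (hq0 : q ≠ 0) {L : ℤ} (hL : 1 ≤ L) (α β : ℤ) :
    Summable fun u => ‖latticeTerm q L α β u‖ := by
  refine (summable_zpow_of_le hq hq0 _ (abs_add_abs_sub_le hL α β)).of_nonneg_of_le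
    (fun _ => norm_nonneg _) fun u => ?_
  rw [latticeTerm, norm_mul]
  exact mul_le_of_le_one_left (norm_nonneg _) (norm_chi_le _)

lemma exists_norm_kerZero_le (hq : ‖q‖ < 1) :
    ∃ M, 0 ≤ M ∧ ∀ u n m, ‖kerZero q u n m‖ ≤ M := by
  obtain ⟨P, hP0, hP⟩ := exists_norm_qPoch_le hq q
  obtain ⟨M, hM0, hM⟩ := exists_norm_qFacInv_le hq
  refine ⟨P * (M * M * M) * (M * M * M), by positivity, fun u n m => ?_⟩
  simp only [kerZero, ker, norm_mul]
  gcongr <;> apply_assumption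

lemma tendsto_kerZero (hq : ‖q‖ < 1) (u : ℤ × ℤ) :
    Tendsto (fun n => kerZero q u n n) atTop (𝓝 ((qPochInf q q)⁻¹ ^ 5)) := by
  have h1 : Tendsto (fun n : ℕ => qPoch q q (n + n + 0)) atTop (𝓝 (qPochInf q q)) :=
    (tendsto_qPoch hq q).comp (tendsto_atTop_mono (fun n => show n ≤ n + n + 0 by omega) tendsto_id)
  have h2 : (qPochInf q q)⁻¹ ^ 5 = qPochInf q q *
      ((qPochInf q q)⁻¹ * (qPochInf q q)⁻¹ * (qPochInf q q)⁻¹) *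
        ((qPochInf q q)⁻¹ * (qPochInf q q)⁻¹ * (qPochInf q q)⁻¹) := by
    have := qPochInf_self_ne_zero hq
    field_simp
  rw [h2]
  have h3 := tendsto_qFacInv hq
  simp only [kerZero, ker, Nat.cast_zero, add_zero, sub_eq_add_neg] at h1 ⊢
  exact (h1.mul (((h3 _).mul (h3 _)).mul (h3 _))).mul (((h3 _).mul (h3 _)).mul (h3 _))

lemma tendsto_tsum_kerZero (hq : ‖q‖ < 1) {c : ℤ × ℤ → ℂ} (hc : Summable fun u => ‖c u‖) :
    Tendsto (fun n => ∑' u, c u * kerZero q u n n) atTop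
      (𝓝 ((∑' u, c u) * (qPochInf q q)⁻¹ ^ 5)) := by
  obtain ⟨M, -, hM⟩ := exists_norm_kerZero_le hq
  rw [← tsum_mul_right]
  refine tendsto_tsum_of_dominated_convergence (hc.mul_right M)
    (fun u => (tendsto_kerZero hq u).const_mul _) (Eventually.of_forall fun n u => ?_)
  rw [norm_mul]
  exact mul_le_mul_of_nonneg_left (hM _ _ _) (norm_nonneg _)

lemma tendsto_pow_mul (hq : ‖q‖ < 1) {f : ℕ → ℕ → ℂ}
    (hf : ∃ M, 0 ≤ M ∧ ∀ n m, ‖f n m‖ ≤ M) :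
    Tendsto (fun n => q ^ n * f n n) atTop (𝓝 0) := by
  obtain ⟨M, -, hM⟩ := hf
  exact (tendsto_pow_atTop_nhds_zero_of_norm_lt_one hq).zero_mul_isBoundedUnder_le
    (isBoundedUnder_of ⟨M, fun n => hM n n⟩)

lemma tendsto_chain_sub (hq : ‖q‖ < 1) {B t j : ℕ} (hk : B + t + j ≠ 0) :
    Tendsto (fun n => ((step q 0 0)^[B] ((step q 0 1)^[t] ((step q 1 1)^[j] (g0 q))) -
      (step q 0 0)^[B] (fun n m => q ^ m *
        (step q 0 1)^[t] (fun n m => q ^ (n + 1) * (step q 1 1)^[j] (g0 q) n m) n m)) n n) atTop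
      (𝓝 ((qPochInf q q)⁻¹ * (qPochInf q q)⁻¹ * ((1 - q) * Fab q (B + t) B (B + t + j)))) := by
  have hg := exists_norm_g0_le hq
  have h1q : 1 - q ≠ 0 := by simpa using one_sub_pow_ne_zero hq one_ne_zero
  obtain ⟨k, hk⟩ := Nat.exists_eq_succ_of_ne_zero hk
  rw [Nat.succ_eq_add_one] at hk
  have h1 := tendsto_chain hq hg (B + t) B k
  simp only [← hk, chain_eq] at h1
  obtain _ | B := B
  · have h2 : ∃ M, 0 ≤ M ∧ ∀ n m, ‖(step q 0 1)^[t]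
        (fun n m => q ^ (n + 1) * (step q 1 1)^[j] (g0 q) n m) n m‖ ≤ M := by
      refine exists_norm_iterate_step_le hq 0 1 t ?_
      obtain ⟨M, hM0, hM⟩ := exists_norm_iterate_step_le hq 1 1 j hg
      refine ⟨M, hM0, fun n m => ?_⟩
      rw [norm_mul, norm_pow]
      exact (mul_le_of_le_one_left (norm_nonneg _) (pow_le_one₀ (norm_nonneg _) hq.le)).trans (hM _ _)
    rw [Fab_eq_of_eq_zero, mul_inv_cancel_left₀ h1q, hk]
    simpa using h1.sub (tendsto_pow_mul hq h2)
  · have h2 := (tendsto_chain hq hg (B + t) B k).const_mul q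
    obtain rfl : k = B + t + j := by omega
    rw [hk]
    rw [show B + 1 + t = B + t + 1 by ring] at h1 ⊢
    rw [Fab_succ_succ hq (by omega) (by omega), mul_inv_cancel_left₀ h1q]
    rw [iterate_step_correction, mul_sub, mul_left_comm _ q]
    exact h1.sub h2

lemma Fab_eq_latticeSum (hq : ‖q‖ < 1) (hq0 : q ≠ 0) {A B k : ℕ} (hBA : B ≤ A) (hAk : A ≤ k)
    (hk : k ≠ 0) :
    Fab q A B k = q ^ ((A : ℤ) + B + 1 - k) * latticeSum q (k + 1) (A + 1) (B + 1) *
      (qPochInf q q)⁻¹ ^ 3 := by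
  obtain ⟨t, rfl⟩ := Nat.exists_eq_add_of_le hBA
  obtain ⟨j, rfl⟩ := Nat.exists_eq_add_of_le hAk
  have h1q : 1 - q ≠ 0 := by simpa using one_sub_pow_ne_zero hq one_ne_zero
  have hP := qPochInf_self_ne_zero hq
  have h1 := tendsto_chain_sub hq hk
  rw [chain_seed hq hq0] at h1
  set C : ℂ := (1 - q) * q ^ (((B + t : ℕ) : ℤ) + B + 1 - (B + t + j : ℕ)) with hC
  have h2 := tendsto_tsum_kerZero hq
    (c := fun u => C * latticeTerm q ((B + t + j : ℕ) + 1) ((B + t : ℕ) + 1) (B + 1) u)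
    (by
      simp only [norm_mul]
      exact (summable_norm_latticeTerm hq hq0 (by omega) _ _).mul_left _)
  rw [tsum_mul_left] at h2
  have h3 := tendsto_nhds_unique h1 (h2.congr fun n => tsum_congr fun u => ?_)
  · rw [← latticeSum, hC] at h3
    field_simp at h3 ⊢
    linear_combination h3
  · rw [hC, latticeTerm]
    have : q ^ (((B + t : ℕ) : ℤ) + B + 1 - (B + t + j : ℕ)) *
        q ^ ((((B + t + j : ℕ) : ℤ) + 1) * quad u + ((B + t : ℕ) + 1) * u.2 - (B + 1) * u.1) =
        q * q ^ quad u * q ^ (j * (quad u - 1)) * q ^ (t * (quad u + u.2)) *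
          q ^ (B * (quad u - u.1 + u.2 + 1)) * q ^ (u.2 - u.1) := by
      nth_rw 3 [← zpow_one q]
      simp only [← zpow_add₀ hq0]
      congr 1
      push_cast
      ring
    linear_combination ((1 - q) * chi (u.2 - u.1) * kerZero q u n n) * this

end ThetaSeries

section ThreeTerm

variable {q : ℂ}

/-- The affine involution `(x, y) ↦ (x, -x-y-1)`. -/
def reflectSnd : ℤ × ℤ ≃ ℤ × ℤ where
  toFun u := (u.1, -u.1 - u.2 - 1)
  invFun u := (u.1, -u.1 - u.2 - 1)
  left_inv u := Prod.ext rfl (by dsimp only; ring)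
  right_inv u := Prod.ext rfl (by dsimp only; ring)

/-- The affine rotation `(x, y) ↦ (-x-y, x-1)`. -/
def rotate : ℤ × ℤ ≃ ℤ × ℤ where
  toFun u := (-u.1 - u.2, u.1 - 1)
  invFun u := (u.2 + 1, -u.1 - u.2 - 1)
  left_inv u := by ext <;> (dsimp only; ring)
  right_inv u := by ext <;> (dsimp only; ring)

lemma chi_three_term {d e f : ℤ} (he : (e + d + 1) % 3 = 0) (hf : (f - d + 1) % 3 = 0) :
    chi d = chi e - chi f := by
  have hc : d % 3 = 0 ∨ d % 3 = 1 ∨ d % 3 = 2 := by omega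
  simp only [chi]
  rcases hc with h | h | h
  · rw [h, show e % 3 = 2 by omega, show f % 3 = 2 by omega]; simp
  · rw [h, show e % 3 = 1 by omega, show f % 3 = 0 by omega]; simp
  · rw [h, show e % 3 = 0 by omega, show f % 3 = 1 by omega]; simp

lemma latticeSum_three_term (hq : ‖q‖ < 1) (hq0 : q ≠ 0) {L : ℤ} (hL : 1 ≤ L) (α β : ℤ) :
    q ^ (α + β - L) * latticeSum q L α β = q ^ β * latticeSum q L (2 * L - α) (α + β - L) -
      latticeSum q L (2 * L - α - β) (α - L) := by
  have h1 := (summable_norm_latticeTerm hq hq0 hL (2 * L - α) (α + β - L)).of_norm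
  have h2 := (summable_norm_latticeTerm hq hq0 hL (2 * L - α - β) (α - L)).of_norm
  simp only [latticeSum]
  rw [← reflectSnd.tsum_eq (latticeTerm q L (2 * L - α) (α + β - L)),
    ← rotate.tsum_eq (latticeTerm q L (2 * L - α - β) (α - L)), ← tsum_mul_left, ← tsum_mul_left,
    ← Summable.tsum_sub]
  · refine tsum_congr fun u => ?_
    obtain ⟨x, y⟩ := u
    simp only [latticeTerm, reflectSnd, rotate, Equiv.coe_fn_mk, quad]
    rw [mul_left_comm, mul_left_comm (q ^ β), ← zpow_add₀ hq0, ← zpow_add₀ hq0,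
      chi_three_term (d := y - x) (e := -x - y - 1 - x) (f := x - 1 - (-x - y)) (by omega) (by omega),
      sub_mul]
    congr 3 <;> ring
  · exact (reflectSnd.summable_iff.mpr h1).mul_left _
  · exact rotate.summable_iff.mpr h2

end ThreeTerm

section TripleProduct

variable {q : ℂ}

open Filter Topology

lemma tri_sub_one (n : ℤ) : tri n = tri (n - 1) + (n - 1) := by
  linarith [two_mul_tri n, two_mul_tri (n - 1)]

lemma tri_neg (n : ℤ) : tri (-n) = tri n + n := by
  linarith [two_mul_tri n, two_mul_tri (-n)]

/-- The summand of the finite form of Jacobi's triple product. -/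
def finiteJacobi (q z : ℂ) (N M n : ℤ) : ℂ :=
  (-1) ^ n * q ^ tri n * z ^ n * (qFacInv q (N + n) * qFacInv q (M - n))

lemma summable_finiteJacobi (q z : ℂ) (N M : ℤ) : Summable (finiteJacobi q z N M) :=
  summable_int_of_bounded (-N) M fun n hn => by
    have h := right_ne_zero_of_mul hn
    have h1 := nonneg_of_qFacInv_ne_zero (left_ne_zero_of_mul h)
    have h2 := nonneg_of_qFacInv_ne_zero (right_ne_zero_of_mul h)
    omega

lemma tsum_finiteJacobi_succ (hq : ‖q‖ < 1) (hq0 : q ≠ 0) {z : ℂ} (hz : z ≠ 0) (N M : ℤ) :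
    (1 - q ^ (N + M + 1)) * ∑' n, finiteJacobi q z N (M + 1) n =
      (1 - z * q ^ M) * ∑' n, finiteJacobi q z N M n := by
  have hs := summable_finiteJacobi q z N M
  have hs1 := (Equiv.subRight (1 : ℤ)).summable_iff.mpr hs
  rw [sub_mul 1 (z * q ^ M), one_mul]
  rw [← tsum_mul_left, ← tsum_mul_left,
    ← (Equiv.subRight (1 : ℤ)).tsum_eq (fun n => z * q ^ M * finiteJacobi q z N M n)]
  refine Eq.trans ?_ (hs.tsum_sub (hs1.mul_left _))
  refine tsum_congr fun n => ?_
  have h1 := qFacInv_eq_succ hq (M - n)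
  have h2 := qFacInv_sub_one hq (N + n)
  simp only [finiteJacobi, Equiv.subRight_apply]
  rw [h1, show N + (n - 1) = N + n - 1 by ring, h2, show M - (n - 1) = M - n + 1 by ring,
    show M + 1 - n = M - n + 1 by ring, tri_sub_one n, zpow_add₀ hq0 (tri (n - 1)),
    zpow_sub_one₀ hz, zpow_sub_one₀ (a := (-1 : ℂ)) (by norm_num)]
  have e1 : q ^ (N + M + 1) = q ^ (M - n + 1) * q ^ (N + n) := by
    rw [← zpow_add₀ hq0]; congr 1; ring
  have e2 : q ^ M = q ^ (M - n + 1) * q ^ (n - 1) := by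
    rw [← zpow_add₀ hq0]; congr 1; ring
  rw [e1, e2]
  field_simp
  ring

lemma tsum_finiteJacobi_symm (hq0 : q ≠ 0) (z : ℂ) (N M : ℤ) :
    ∑' n, finiteJacobi q z N M n = ∑' n, finiteJacobi q (q / z) M N n := by
  rw [← (Equiv.neg ℤ).tsum_eq]
  refine tsum_congr fun n => ?_
  simp only [finiteJacobi, Equiv.neg_apply, tri_neg]
  rw [zpow_add₀ hq0, div_zpow, zpow_neg, zpow_neg, ← inv_zpow (-1 : ℂ), inv_neg_one, sub_neg_eq_add,
    ← sub_eq_add_neg]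
  ring

lemma tsum_finiteJacobi (hq : ‖q‖ < 1) (hq0 : q ≠ 0) {z : ℂ} (hz : z ≠ 0) (N M : ℕ) :
    qPoch q q (N + M) * ∑' n, finiteJacobi q z N M n = qPoch z q M * qPoch (q / z) q N := by
  have key (z : ℂ) (hz : z ≠ 0) (N M : ℕ) :
      qPoch q q (N + M) * ∑' n, finiteJacobi q z N M n =
        qPoch z q M * (qPoch q q N * ∑' n, finiteJacobi q z N 0 n) := by
    induction M with
    | zero => simp
    | succ M ih =>
      have h := tsum_finiteJacobi_succ hq hq0 hz N M
      rw [← add_assoc, qPoch_self_succ, qPoch_succ]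
      push_cast
      norm_cast at h ⊢
      linear_combination qPoch q q (N + M) * h + (1 - z * q ^ M) * ih
  have h0 (z : ℂ) : ∑' n, finiteJacobi q z 0 0 n = 1 := by
    rw [tsum_eq_single 0]
    · simp [finiteJacobi, tri]
    · intro n hn
      rw [finiteJacobi]
      rcases lt_or_gt_of_ne hn with h | h
      · rw [qFacInv_of_neg (z := 0 + n) (by omega)]; ring
      · rw [qFacInv_of_neg (z := 0 - n) (by omega)]; ring
  rw [key z hz, tsum_finiteJacobi_symm hq0]
  have h1 := key (q / z) (div_ne_zero hq0 hz) 0 N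
  rw [Nat.cast_zero, h0, zero_add, qPoch_zero] at h1
  rw [h1]
  ring

/-- The summand of Jacobi's theta series. -/
def thetaTerm (q z : ℂ) (n : ℤ) : ℂ := (-1) ^ n * q ^ tri n * z ^ n

lemma summable_norm_thetaTerm (hq : ‖q‖ < 1) (hq0 : q ≠ 0) {z : ℂ} (hz : z ≠ 0) :
    Summable fun n => ‖thetaTerm q z n‖ := by
  have key (w : ℂ) (hw : w ≠ 0) : Summable fun n : ℕ => ‖thetaTerm q w n‖ := by
    refine summable_of_ratio_test_tendsto_lt_one zero_lt_one (Eventually.of_forall fun n => ?_)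
      (?_ : Tendsto (fun n : ℕ => ‖‖thetaTerm q w (n + 1 : ℕ)‖‖ / ‖‖thetaTerm q w n‖‖) atTop (𝓝 0))
    · simp [thetaTerm, hq0, hw, zpow_ne_zero]
    · have h : Tendsto (fun n : ℕ => ‖q ^ n * w‖) atTop (𝓝 0) := by
        have := ((tendsto_pow_atTop_nhds_zero_of_norm_lt_one hq).mul_const w).norm
        simpa using this
      refine h.congr fun n => ?_
      rw [norm_norm, norm_norm, ← norm_div]
      have h2 : thetaTerm q w (n + 1 : ℕ) = -(q ^ n * w) * thetaTerm q w n := by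
        simp only [thetaTerm]
        rw [tri_sub_one]
        push_cast
        rw [add_sub_cancel_right, zpow_add₀ hq0, zpow_add_one₀ hw,
          zpow_add_one₀ (neg_ne_zero.mpr one_ne_zero), zpow_natCast q]
        ring
      rw [h2, mul_div_cancel_right₀, norm_neg]
      simp [thetaTerm, hq0, hw, zpow_ne_zero]
  refine summable_int_iff_summable_nat_and_neg.mpr ⟨key z hz, ?_⟩
  refine (key (q / z) (div_ne_zero hq0 hz)).congr fun n => ?_
  simp only [thetaTerm, tri_neg]
  rw [zpow_add₀ hq0, div_zpow, zpow_neg, zpow_neg, ← inv_zpow (-1 : ℂ), inv_neg_one]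
  congr 1
  ring

/-- Jacobi's triple product identity. -/
lemma tsum_thetaTerm (hq : ‖q‖ < 1) (hq0 : q ≠ 0) {z : ℂ} (hz : z ≠ 0) :
    ∑' n, thetaTerm q z n = qPochInf q q * theta z q := by
  have hP := qPochInf_self_ne_zero hq
  obtain ⟨M, -, hM⟩ := exists_norm_qFacInv_le hq
  have h1 : Tendsto (fun N : ℕ => ∑' n, finiteJacobi q z N N n) atTop
      (𝓝 (∑' n, thetaTerm q z n * ((qPochInf q q)⁻¹ * (qPochInf q q)⁻¹))) := by
    refine tendsto_tsum_of_dominated_convergence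
      ((summable_norm_thetaTerm hq hq0 hz).mul_right (M * M)) (fun n => ?_)
      (Eventually.of_forall fun N n => ?_)
    · simp only [finiteJacobi, sub_eq_add_neg]
      exact ((tendsto_qFacInv hq n).mul (tendsto_qFacInv hq (-n))).const_mul _
    · rw [finiteJacobi, norm_mul, norm_mul (qFacInv q _)]
      exact mul_le_mul_of_nonneg_left (mul_le_mul (hM _) (hM _) (norm_nonneg _)
        ((norm_nonneg _).trans (hM 0))) (norm_nonneg _)
  have h2 : Tendsto (fun n : ℕ => qPoch q q (n + n)) atTop (𝓝 (qPochInf q q)) :=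
    (tendsto_qPoch hq q).comp (tendsto_atTop_mono (fun n => show n ≤ n + n by omega) tendsto_id)
  have h3 := tendsto_nhds_unique (h2.mul h1) (((tendsto_qPoch hq z).mul
    (tendsto_qPoch hq (q / z))).congr fun N => (tsum_finiteJacobi hq hq0 hz N N).symm)
  rw [tsum_mul_right] at h3
  rw [theta, ← h3]
  field_simp

lemma tsum_thetaTerm_mul (hq0 : q ≠ 0) {z : ℂ} (hz : z ≠ 0) :
    ∑' n, thetaTerm q (q * z) n = -z⁻¹ * ∑' n, thetaTerm q z n := by
  rw [← (Equiv.addRight (1 : ℤ)).tsum_eq (thetaTerm q z), ← tsum_mul_left]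
  refine tsum_congr fun n => ?_
  simp only [thetaTerm, Equiv.coe_addRight]
  rw [tri_sub_one (n + 1), add_sub_cancel_right, zpow_add₀ hq0, zpow_add_one₀ hz,
    zpow_add_one₀ (neg_ne_zero.mpr one_ne_zero), mul_zpow]
  field_simp

end TripleProduct

section Macdonald

variable {q : ℂ}

open Filter Topology

lemma norm_pow_lt_one (hq : ‖q‖ < 1) {n : ℕ} (hn : n ≠ 0) : ‖q ^ n‖ < 1 := by
  rw [norm_pow]
  exact pow_lt_one₀ (norm_nonneg q) hq hn

lemma qPoch_three_mul (q : ℂ) (n : ℕ) :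
    qPoch q q (3 * n) = qPoch q (q ^ 3) n * qPoch (q ^ 2) (q ^ 3) n * qPoch (q ^ 3) (q ^ 3) n := by
  induction n with
  | zero => simp
  | succ n ih =>
    rw [show 3 * (n + 1) = 3 * n + 1 + 1 + 1 by ring]
    simp only [qPoch_succ, ih]
    ring

lemma qPochInf_trisect (hq : ‖q‖ < 1) :
    qPochInf q q = qPochInf q (q ^ 3) * qPochInf (q ^ 2) (q ^ 3) * qPochInf (q ^ 3) (q ^ 3) := by
  have hq3 := norm_pow_lt_one hq three_ne_zero
  have h1 : Tendsto (fun n => qPoch q q (3 * n)) atTop (𝓝 (qPochInf q q)) :=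
    (tendsto_qPoch hq q).comp (tendsto_atTop_mono (fun n => show n ≤ 3 * n by omega) tendsto_id)
  simp only [qPoch_three_mul] at h1
  exact tendsto_nhds_unique h1
    (((tendsto_qPoch hq3 q).mul (tendsto_qPoch hq3 _)).mul (tendsto_qPoch hq3 _))

lemma theta_one (hq : ‖q‖ < 1) : theta 1 q = 0 := by
  rw [theta, qPochInf_eq_mul hq]
  simp

lemma tsum_thetaTerm_cube (hq : ‖q‖ < 1) (hq0 : q ≠ 0) (h : ℤ) :
    ∑' n, thetaTerm ((q ^ 3) ^ 3) ((q ^ 3) ^ (2 - h)) n =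
      (-1) ^ h * chi (h + 1) * q ^ (-tri h) * qPochInf (q ^ 3) (q ^ 3) := by
  set p := q ^ 3 with hp
  have hp1 : ‖p‖ < 1 := norm_pow_lt_one hq three_ne_zero
  have hp0 : p ≠ 0 := pow_ne_zero _ hq0
  have hp3 : ‖p ^ 3‖ < 1 := norm_pow_lt_one hp1 three_ne_zero
  have hp30 : p ^ 3 ≠ 0 := pow_ne_zero _ hp0
  have hm1 : (-1 : ℂ) ≠ 0 := by norm_num
  have step (h : ℤ) : (∑' n, thetaTerm (p ^ 3) (p ^ (2 - h)) n =
        (-1) ^ h * chi (h + 1) * q ^ (-tri h) * qPochInf p p) ↔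
      ∑' n, thetaTerm (p ^ 3) (p ^ (2 - (h - 3))) n =
        (-1) ^ (h - 3) * chi (h - 3 + 1) * q ^ (-tri (h - 3)) * qPochInf p p := by
    have e1 : p ^ (2 - (h - 3)) = p ^ 3 * p ^ (2 - h) := by
      rw [← zpow_natCast p 3, ← zpow_add₀ hp0]; congr 1; push_cast; ring
    have e2 : chi (h - 3 + 1) = chi (h + 1) := by
      simp only [chi, show (h - 3 + 1) % 3 = (h + 1) % 3 by omega]
    have e3 : q ^ (-tri (h - 3)) = q ^ (-tri h) * (p ^ (2 - h))⁻¹ := by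
      rw [hp, ← zpow_natCast q 3, ← zpow_mul, ← zpow_neg, ← zpow_add₀ hq0]
      congr 1
      push_cast
      linarith [two_mul_tri h, two_mul_tri (h - 3)]
    have e4 : (-1 : ℂ) ^ (h - 3) = -(-1) ^ h := by
      rw [zpow_sub₀ hm1]; norm_num; ring
    have hz : p ^ (2 - h) ≠ 0 := zpow_ne_zero _ hp0
    rw [e1, e2, e3, e4, tsum_thetaTerm_mul hp30 hz]
    constructor
    · intro h1
      rw [h1]; ring
    · intro h1
      have := mul_left_cancel₀ (neg_ne_zero.mpr (inv_ne_zero hz)) (h1.trans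
        (show _ = -(p ^ (2 - h))⁻¹ * ((-1) ^ h * chi (h + 1) * q ^ (-tri h) * qPochInf p p) by ring))
      exact this
  have base (r : ℤ) (hr : r = 0 ∨ r = 1 ∨ r = 2) :
      ∑' n, thetaTerm (p ^ 3) (p ^ (2 - r)) n =
        (-1) ^ r * chi (r + 1) * q ^ (-tri r) * qPochInf p p := by
    rw [tsum_thetaTerm hp3 hp30 (zpow_ne_zero _ hp0)]
    rcases hr with rfl | rfl | rfl
    · rw [qPochInf_trisect hp1, theta, show p ^ 3 / p ^ (2 - 0 : ℤ) = p by
        rw [sub_zero, zpow_ofNat]; field_simp]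
      simp only [sub_zero, zpow_ofNat]
      simp [chi, tri]
      ring
    · rw [qPochInf_trisect hp1, theta, show p ^ 3 / p ^ (2 - 1 : ℤ) = p ^ 2 by
        norm_num; field_simp]
      norm_num [chi, tri]
      ring
    · rw [sub_self, zpow_zero, theta_one hp3]
      norm_num [chi]
  obtain ⟨k, r, hr, rfl⟩ : ∃ k r : ℤ, (r = 0 ∨ r = 1 ∨ r = 2) ∧ h = 3 * k + r :=
    ⟨h / 3, h % 3, by omega, by omega⟩
  induction k using Int.induction_on with
  | zero => simpa using base r hr
  | succ k ih =>
    rw [step]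
    rwa [show 3 * ((k : ℤ) + 1) + r - 3 = 3 * k + r by ring]
  | pred k ih =>
    rw [step] at ih
    rwa [show 3 * (-(k : ℤ)) + r - 3 = 3 * (-(k : ℤ) - 1) + r by ring] at ih

/-- The reindexing `(i, j, n) ↦ (i - n, j - n, n)`. -/
def shearEquiv : (ℤ × ℤ) × ℤ ≃ (ℤ × ℤ) × ℤ where
  toFun t := ((t.1.1 - t.2, t.1.2 - t.2), t.2)
  invFun t := ((t.1.1 + t.2, t.1.2 + t.2), t.2)
  left_inv t := by simp
  right_inv t := by simp

/-- The reindexing `(x, y) ↦ (y + 1, 1 - x)`. -/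
def cornerEquiv : ℤ × ℤ ≃ ℤ × ℤ where
  toFun u := (u.2 + 1, 1 - u.1)
  invFun u := (1 - u.2, u.1 - 1)
  left_inv u := by simp
  right_inv u := by simp

/-- The Macdonald identity of type `A₂`. -/
lemma macdonald (hq : ‖q‖ < 1) (hq0 : q ≠ 0) {z w : ℂ} (hz : z ≠ 0) (hw : w ≠ 0) :
    qPochInf (q ^ 3) (q ^ 3) ^ 2 *
        (theta z (q ^ 3) * theta w (q ^ 3) * theta (z * w) (q ^ 3)) =
      ∑' u : ℤ × ℤ, chi (u.2 - u.1) * q ^ (quad u - 1) * z ^ (u.2 + 1) * w ^ (1 - u.1) := by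
  set p := q ^ 3 with hp
  have hp1 : ‖p‖ < 1 := norm_pow_lt_one hq three_ne_zero
  have hp0 : p ≠ 0 := pow_ne_zero _ hq0
  have hP := qPochInf_self_ne_zero hp1
  have hm1 : (-1 : ℂ) ≠ 0 := by norm_num
  have s1 := summable_norm_thetaTerm hp1 hp0 hz
  have s2 := summable_norm_thetaTerm hp1 hp0 hw
  have s3 := summable_norm_thetaTerm hp1 hp0 (mul_ne_zero hz hw)
  have s12 := s1.mul_norm s2
  have s123 := (s12.mul_norm s3).of_norm
  have hprod : (qPochInf p p * theta z p) * (qPochInf p p * theta w p) *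
      (qPochInf p p * theta (z * w) p) =
      ∑' t : (ℤ × ℤ) × ℤ, thetaTerm p z t.1.1 * thetaTerm p w t.1.2 * thetaTerm p (z * w) t.2 := by
    rw [← tsum_thetaTerm hp1 hp0 hz, ← tsum_thetaTerm hp1 hp0 hw,
      ← tsum_thetaTerm hp1 hp0 (mul_ne_zero hz hw), tsum_mul_tsum_of_summable_norm s1 s2,
      tsum_mul_tsum_of_summable_norm s12 s3]
  have hinner (u : ℤ × ℤ) : ∑' n, thetaTerm p z (u.1 - n) * thetaTerm p w (u.2 - n) *
      thetaTerm p (z * w) n = chi (u.1 + u.2 + 1) *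
        q ^ (3 * tri u.1 + 3 * tri u.2 - tri (u.1 + u.2)) * z ^ u.1 * w ^ u.2 * qPochInf p p := by
    obtain ⟨i, j⟩ := u
    dsimp only
    have h1 : ∀ n, thetaTerm p z (i - n) * thetaTerm p w (j - n) * thetaTerm p (z * w) n =
        (-1) ^ (i + j) * p ^ (tri i + tri j) * z ^ i * w ^ j *
          thetaTerm (p ^ 3) (p ^ (2 - (i + j))) n := fun n => by
      have e1 : p ^ tri (i - n) * p ^ tri (j - n) * p ^ tri n =
          p ^ (tri i + tri j) * ((p ^ 3) ^ tri n * (p ^ (2 - (i + j))) ^ n) := by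
        rw [← zpow_natCast p 3]
        simp only [← zpow_mul, ← zpow_add₀ hp0]
        congr 1
        push_cast
        linarith [two_mul_tri (i - n), two_mul_tri (j - n), two_mul_tri n, two_mul_tri i,
          two_mul_tri j]
      have e2 : (-1 : ℂ) ^ n * (-1) ^ n = 1 := by
        rw [← mul_zpow]; norm_num
      have e3 : ((-1 : ℂ) ^ n)⁻¹ = (-1) ^ n := by
        rw [← inv_zpow]; norm_num
      have hzn := zpow_ne_zero n hz
      have hwn := zpow_ne_zero n hw
      simp only [thetaTerm, zpow_sub₀ hm1, zpow_sub₀ hz, zpow_sub₀ hw, mul_zpow, zpow_add₀ hm1,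
        div_eq_mul_inv, e3]
      calc _ = (-1) ^ i * (-1) ^ j * z ^ i * w ^ j * (z ^ n * (z ^ n)⁻¹) * (w ^ n * (w ^ n)⁻¹) *
            ((-1) ^ n * (-1) ^ n * (-1) ^ n) *
              (p ^ tri (i - n) * p ^ tri (j - n) * p ^ tri n) := by ring
        _ = _ := by
          rw [e1, e2, mul_inv_cancel₀ hzn, mul_inv_cancel₀ hwn]
          ring
    rw [tsum_congr h1, tsum_mul_left, tsum_thetaTerm_cube hq hq0]
    have e4 : (-1 : ℂ) ^ (i + j) * (-1) ^ (i + j) = 1 := by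
      rw [← mul_zpow]; norm_num
    have e5 : q ^ (3 * tri i + 3 * tri j - tri (i + j)) =
        p ^ (tri i + tri j) * q ^ (-tri (i + j)) := by
      rw [hp, ← zpow_natCast q 3, ← zpow_mul, ← zpow_add₀ hq0]
      congr 1
      push_cast
      ring
    rw [e5]
    linear_combination (chi (i + j + 1) * p ^ (tri i + tri j) * q ^ (-tri (i + j)) * z ^ i *
      w ^ j * qPochInf p p) * e4
  refine mul_left_cancel₀ hP ?_
  calc _ = (qPochInf p p * theta z p) * (qPochInf p p * theta w p) *
      (qPochInf p p * theta (z * w) p) := by ring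
    _ = ∑' u : ℤ × ℤ, chi (u.1 + u.2 + 1) *
        q ^ (3 * tri u.1 + 3 * tri u.2 - tri (u.1 + u.2)) * z ^ u.1 * w ^ u.2 * qPochInf p p := by
      rw [hprod, ← shearEquiv.tsum_eq]
      refine (shearEquiv.summable_iff.mpr s123).tsum_prod.trans (tsum_congr fun u => ?_)
      exact hinner u
    _ = _ := by
      rw [tsum_mul_right, mul_comm, ← cornerEquiv.tsum_eq]
      congr 1
      refine tsum_congr fun u => ?_
      obtain ⟨x, y⟩ := u
      simp only [cornerEquiv, Equiv.coe_fn_mk, quad]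
      congr 3
      · simp only [chi, show (y + 1 + (1 - x) + 1) % 3 = (y - x) % 3 by omega]
      · congr 1
        linarith [two_mul_tri (y + 1), two_mul_tri (1 - x), two_mul_tri (y + 1 + (1 - x))]

lemma latticeSum_eq_theta (hq : ‖q‖ < 1) (hq0 : q ≠ 0) {L : ℕ} (hL : L ≠ 0) (α β : ℤ) :
    q ^ (α + β - L) * latticeSum q L α β = qPochInf (q ^ (3 * L)) (q ^ (3 * L)) ^ 2 *
      (theta (q ^ α) (q ^ (3 * L)) * theta (q ^ β) (q ^ (3 * L)) *
        theta (q ^ (α + β)) (q ^ (3 * L))) := by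
  have h := macdonald (norm_pow_lt_one hq hL) (pow_ne_zero L hq0) (zpow_ne_zero α hq0)
    (zpow_ne_zero β hq0)
  rw [← pow_mul, mul_comm L 3, ← zpow_add₀ hq0] at h
  rw [h, latticeSum, ← tsum_mul_left]
  refine tsum_congr fun u => ?_
  rw [latticeTerm, mul_left_comm, mul_assoc, mul_assoc, ← zpow_natCast q L]
  simp only [← zpow_mul, ← zpow_add₀ hq0]
  congr 2
  ring

end Macdonald

section Main

variable {q : ℂ}

lemma qPochInf_zero_left (q : ℂ) : qPochInf 0 q = 1 := by
  simp [qPochInf]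

lemma sq_add_sq_sub_mul_pos {n m : ℕ} (h : n ≠ 0 ∨ m ≠ 0) : 0 < n ^ 2 + m ^ 2 - n * m := by
  rw [Nat.sub_pos_iff_lt]
  rcases le_total n m with h1 | h1 <;> rcases h with h | h <;>
    nlinarith [Nat.pos_of_ne_zero h, Nat.mul_le_mul_left n h1, Nat.mul_le_mul_right m h1,
      Nat.pow_pos (n := 2) (Nat.pos_of_ne_zero h)]

lemma Fab_zero_base (A B k : ℕ) : Fab 0 A B k = 1 := by
  let z : Decr k := ⟨fun _ => 0, fun _ _ _ => le_rfl⟩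
  have hz (i : ℕ) : nth z.1 i = 0 := by
    simp [nth, z]
  rw [Fab, tsum_eq_single (z, z)]
  · simp [hz, g0, qBinom, qFacInv, qPoch]
  · intro p hp
    obtain ⟨i, hi⟩ : ∃ i, p.1.1 i ≠ 0 ∨ p.2.1 i ≠ 0 := by
      by_contra! h
      exact hp (Prod.ext (Subtype.ext (funext fun i => (h i).1))
        (Subtype.ext (funext fun i => (h i).2)))
    rw [← nth_succ p.1.1, ← nth_succ p.2.1] at hi
    have h := (sq_add_sq_sub_mul_pos hi).trans_le (Finset.single_le_sum
      (f := fun i => nth p.1.1 i ^ 2 + nth p.2.1 i ^ 2 - nth p.1.1 i * nth p.2.1 i)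
      (fun _ _ => Nat.zero_le _) (Finset.mem_Icc.mpr ⟨Nat.le_add_left 1 _, i.isLt⟩))
    exact mul_eq_zero_of_left (mul_eq_zero_of_left (mul_eq_zero_of_right _
      (zero_pow (by omega))) _) _

lemma Fab_sub_Fab_eq {k a b : ℕ} (hka : k < a) (ha : 2 * a ≤ 3 * k)
    (hb : b + 2 * a ≤ 3 * k) (hq : ‖q‖ < 1) (hq0 : q ≠ 0) :
    Fab q (2 * k - a) (a + b - k) k - q ^ (b + 1) * Fab q (2 * k - a - b - 1) (a - k - 1) k
      = qPochInf (q ^ (3 * k + 3)) (q ^ (3 * k + 3)) ^ 2 / qPochInf q q ^ 3 *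
          (theta (q ^ (a + 1)) (q ^ (3 * k + 3)) * theta (q ^ (b + 1)) (q ^ (3 * k + 3)) *
            theta (q ^ (a + b + 2)) (q ^ (3 * k + 3))) := by
  have h3 := latticeSum_three_term hq hq0 (L := (k : ℤ) + 1) (by omega) (a + 1) (b + 1)
  have ht := latticeSum_eq_theta hq hq0 (L := k + 1) (by omega) (a + 1) (b + 1)
  rw [Fab_eq_latticeSum hq hq0 (by omega) (by omega) (by omega),
    Fab_eq_latticeSum hq hq0 (by omega) (by omega) (by omega)]
  have e1 : ((2 * k - a : ℕ) : ℤ) = 2 * k - a := by omega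
  have e2 : ((a + b - k : ℕ) : ℤ) = a + b - k := by omega
  have e3 : ((2 * k - a - b - 1 : ℕ) : ℤ) = 2 * k - a - b - 1 := by omega
  have e4 : ((a - k - 1 : ℕ) : ℤ) = a - k - 1 := by omega
  have f1 : (2 * k - a + (a + b - k) + 1 - k : ℤ) = b + 1 := by ring
  have f2 : (2 * k - a - b - 1 + (a - k - 1) + 1 - k : ℤ) = -(b + 1) := by ring
  have f3 : (2 * k - a + 1 : ℤ) = 2 * (k + 1) - (a + 1) := by ring
  have f4 : (a + b - k + 1 : ℤ) = a + 1 + (b + 1) - (k + 1) := by ring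
  have f5 : (2 * k - a - b - 1 + 1 : ℤ) = 2 * (k + 1) - (a + 1) - (b + 1) := by ring
  have f6 : (a - k - 1 + 1 : ℤ) = a + 1 - (k + 1) := by ring
  rw [e1, e2, e3, e4, f1, f2, f3, f4, f5, f6]
  have g1 : q ^ (b + 1) * q ^ (-(b + 1) : ℤ) = 1 := by
    rw [← zpow_natCast, ← zpow_add₀ hq0]
    simp
  have g2 : q ^ (a + 1 : ℤ) = q ^ (a + 1) := mod_cast zpow_natCast q (a + 1)
  have g3 : q ^ (b + 1 : ℤ) = q ^ (b + 1) := mod_cast zpow_natCast q (b + 1)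
  have g4 : q ^ (a + 1 + (b + 1) : ℤ) = q ^ (a + b + 2) := by
    rw [← zpow_natCast]
    congr 1
    push_cast
    ring
  rw [Nat.cast_succ, h3, g2, g3, g4, mul_add_one 3 k] at ht
  rw [g3, div_eq_mul_inv, ← inv_pow]
  linear_combination (qPochInf q q)⁻¹ ^ 3 * ht -
    latticeSum q (k + 1) (2 * (k + 1) - (a + 1) - (b + 1)) (a + 1 - (k + 1)) *
      (qPochInf q q)⁻¹ ^ 3 * g1

end Main

/-- The below-the-line Andrews–Schilling–Warnaar identities for `τ = 0`
(Theorem 6.1 of the paper). -/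
theorem below_the_line
    (k a b : ℕ) (hk : 2 ≤ k) (hka : k < a) (ha : 2 * a ≤ 3 * k)
    (hb : b + 2 * a ≤ 3 * k)
    (q : ℂ) (hq : ‖q‖ < 1) :
    Fab q (2 * k - a) (a + b - k) k - q ^ (b + 1) * Fab q (2 * k - a - b - 1) (a - k - 1) k
      = qPochInf (q ^ (3 * k + 3)) (q ^ (3 * k + 3)) ^ 2 / qPochInf q q ^ 3 *
          (theta (q ^ (a + 1)) (q ^ (3 * k + 3)) * theta (q ^ (b + 1)) (q ^ (3 * k + 3)) *
            theta (q ^ (a + b + 2)) (q ^ (3 * k + 3))) := by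
  obtain rfl | hq0 := eq_or_ne q 0
  · simp [Fab_zero_base, theta, qPochInf_zero_left]
  · exact Fab_sub_Fab_eq hka ha hb hq hq0

end Stmt6
end
end

section
/- Lemma (A₁ Bailey chain). For every nonnegative integer n, Σ_{r=0}^n 𝒦_{n;r}(z;q) Φ_r(z;q) = Φ_n(z;q); explicitly, Σ_{r=0}^n z^r q^{r²} / [(q;q)_{n−r} (q;q)_r (zq;q)_r] = 1/[(q;q)_n (zq;q)_n], as an identity of rational functions in z and q over ℚ. -/
noncomputable section

namespace Stmt7

/-- The field `ℚ(z, q)` of rational functions in two variables over `ℚ`. -/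
abbrev F : Type := FractionRing (MvPolynomial (Fin 2) ℚ)

/-- The variable `z`. -/
def z : F := algebraMap (MvPolynomial (Fin 2) ℚ) F (MvPolynomial.X 0)

/-- The variable `q`. -/
def q : F := algebraMap (MvPolynomial (Fin 2) ℚ) F (MvPolynomial.X 1)

/-- `(a; b)_n`, the finite q-Pochhammer symbol. -/
def qPoch (a b : F) (n : ℕ) : F := ∏ j ∈ Finset.range n, (1 - a * b ^ j)

theorem qPoch_zero (a b : F) : qPoch a b 0 = 1 := by
  simp [qPoch]

theorem qPoch_succ (a b : F) (n : ℕ) :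
    qPoch a b (n + 1) = qPoch a b n * (1 - a * b ^ n) :=
  Finset.prod_range_succ _ n

theorem qPoch_succ' (a b : F) (n : ℕ) :
    qPoch a b (n + 1) = (1 - a) * qPoch (a * b) b n := by
  simp only [qPoch, Finset.prod_range_succ', pow_zero, mul_one]
  rw [mul_comm]
  congr 1
  exact Finset.prod_congr rfl fun j _ => by ring

/-- The summand `a ^ r b ^ (r ^ 2) / ((b; b)_(n - r) (b; b)_r (a b; b)_r)` of the Bailey chain. -/
def chainTerm (a b : F) (n r : ℕ) : F :=
  a ^ r * b ^ (r ^ 2) / (qPoch b b (n - r) * (qPoch b b r * qPoch (a * b) b r))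

theorem one_sub_pow_mul_chainTerm {a b : F} (hb : ∀ j : ℕ, 1 - b * b ^ j ≠ 0)
    {n r : ℕ} (hr : r ≤ n) :
    (1 - b ^ (n + 1 - r)) * chainTerm a b (n + 1) r = chainTerm a b n r := by
  obtain ⟨m, rfl⟩ := Nat.exists_eq_add_of_le hr
  have e₁ : r + m + 1 - r = m + 1 := by omega
  have e₂ : r + m - r = m := by omega
  rw [chainTerm, chainTerm, e₁, e₂, qPoch_succ, pow_succ' b m, mul_assoc (qPoch b b m),
    mul_left_comm (qPoch b b m), mul_div_assoc', mul_div_mul_left _ _ (hb m)]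

theorem pow_mul_one_sub_pow_mul_chainTerm_succ {a b : F} (hb : ∀ j : ℕ, 1 - b * b ^ j ≠ 0)
    {n r : ℕ} (hr : r ≤ n) :
    b ^ (n + 1 - (r + 1)) * (1 - b ^ (r + 1)) * chainTerm a b (n + 1) (r + 1) =
      a * b ^ (n + 1) / (1 - a * b) * chainTerm (a * b) b n r := by
  obtain ⟨m, rfl⟩ := Nat.exists_eq_add_of_le hr
  have e₁ : r + m + 1 - (r + 1) = m := by omega
  have e₂ : r + m - r = m := by omega
  have h₁ := hb r
  rw [chainTerm, chainTerm, e₁, e₂, qPoch_succ b b r, qPoch_succ' (a * b), pow_succ' b r,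
    pow_succ' b (r + m)]
  field_simp
  ring

/-- The recurrence obtained by splitting
`1 - b ^ (n + 1) = (1 - b ^ (n + 1 - r)) + b ^ (n + 1 - r) (1 - b ^ r)`. -/
theorem sum_chainTerm_succ (a : F) {b : F} (hb : ∀ j : ℕ, 1 - b * b ^ j ≠ 0) (n : ℕ) :
    (1 - b ^ (n + 1)) * ∑ r ∈ Finset.range (n + 2), chainTerm a b (n + 1) r =
      ∑ r ∈ Finset.range (n + 1), chainTerm a b n r +
        a * b ^ (n + 1) / (1 - a * b) * ∑ r ∈ Finset.range (n + 1), chainTerm (a * b) b n r := by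
  have split : ∀ r ∈ Finset.range (n + 2), (1 - b ^ (n + 1)) * chainTerm a b (n + 1) r =
      (1 - b ^ (n + 1 - r)) * chainTerm a b (n + 1) r +
        b ^ (n + 1 - r) * (1 - b ^ r) * chainTerm a b (n + 1) r := fun r hr => by
    have : b ^ (n + 1) = b ^ (n + 1 - r) * b ^ r := by
      rw [← pow_add, Nat.sub_add_cancel (Nat.lt_succ_iff.mp (Finset.mem_range.mp hr))]
    rw [this]
    ring
  rw [Finset.mul_sum, Finset.sum_congr rfl split, Finset.sum_add_distrib]
  congr 1
  · rw [Finset.sum_range_succ, Nat.sub_self, pow_zero, sub_self, zero_mul, add_zero]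
    exact Finset.sum_congr rfl fun r hr =>
      one_sub_pow_mul_chainTerm hb (Nat.lt_succ_iff.mp (Finset.mem_range.mp hr))
  · rw [Finset.sum_range_succ', pow_zero, sub_self, mul_zero, zero_mul, add_zero, Finset.mul_sum]
    exact Finset.sum_congr rfl fun r hr =>
      pow_mul_one_sub_pow_mul_chainTerm_succ hb (Nat.lt_succ_iff.mp (Finset.mem_range.mp hr))

theorem sum_chainTerm {b : F} (hb : ∀ j : ℕ, 1 - b * b ^ j ≠ 0) (n : ℕ) {a : F}
    (ha : ∀ j : ℕ, 1 - a * b * b ^ j ≠ 0) :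
    ∑ r ∈ Finset.range (n + 1), chainTerm a b n r = 1 / (qPoch b b n * qPoch (a * b) b n) := by
  induction n generalizing a with
  | zero => simp [chainTerm, qPoch_zero]
  | succ n ih =>
    have ha' : ∀ j : ℕ, 1 - a * b * b * b ^ j ≠ 0 := fun j => by
      have := ha (j + 1)
      rwa [pow_succ', ← mul_assoc] at this
    have h₁ := hb n
    have h₂ := ha n
    have key : (1 - a * b) * qPoch (a * b * b) b n = qPoch (a * b) b n * (1 - a * b * b ^ n) := by
      rw [← qPoch_succ', qPoch_succ]
    have hrec := sum_chainTerm_succ a hb n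
    rw [ih ha, ih ha', div_mul_div_comm, mul_left_comm (1 - a * b), key, pow_succ'] at hrec
    refine mul_left_cancel₀ h₁ (hrec.trans ?_)
    rw [qPoch_succ, qPoch_succ]
    field_simp
    ring

theorem one_sub_algebraMap_ne_zero {p : MvPolynomial (Fin 2) ℚ}
    (hp : MvPolynomial.constantCoeff p = 0) :
    1 - algebraMap (MvPolynomial (Fin 2) ℚ) F p ≠ 0 := by
  rw [← map_one (algebraMap (MvPolynomial (Fin 2) ℚ) F), ← map_sub]
  refine (map_ne_zero_iff _ (IsFractionRing.injective _ _)).mpr fun h => ?_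
  simpa [hp] using congrArg MvPolynomial.constantCoeff h

theorem one_sub_q_mul_pow_ne_zero (j : ℕ) : 1 - q * q ^ j ≠ 0 := by
  have := one_sub_algebraMap_ne_zero (p := MvPolynomial.X 1 * MvPolynomial.X 1 ^ j) (by simp)
  rwa [map_mul, map_pow] at this

theorem one_sub_z_mul_q_mul_pow_ne_zero (j : ℕ) : 1 - z * q * q ^ j ≠ 0 := by
  have := one_sub_algebraMap_ne_zero
    (p := MvPolynomial.X 0 * MvPolynomial.X 1 * MvPolynomial.X 1 ^ j) (by simp)
  rwa [map_mul, map_mul, map_pow] at this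

/-- The `A₁` Bailey chain (Lemma 3.1 of the paper):
`Σ_{r=0}^n 𝒦_{n;r}(z;q) Φ_r(z;q) = Φ_n(z;q)` as rational functions in `z, q`. -/
theorem A1_bailey_chain (n : ℕ) :
    ∑ r ∈ Finset.range (n + 1),
      z ^ r * q ^ (r ^ 2) / (qPoch q q (n - r) * (qPoch q q r * qPoch (z * q) q r))
      = 1 / (qPoch q q n * qPoch (z * q) q n) :=
  sum_chainTerm one_sub_q_mul_pow_ne_zero n one_sub_z_mul_q_mul_pow_ne_zero

end Stmt7
end
end

section
/- Lemma (A₁ Bailey tree step). For every nonnegative integer n, Σ_{r=0}^n 𝒦_{n;r}(z/q;q) Φ_r(u;z;q) = Φ_n(uz;z;q), i.e., Σ_{r=0}^n (z/q)^r q^{r²} / (q;q)_{n−r} · (1−uz−(1−u)z q^r)/[(q;q)_r (z;q)_{r+1}] = (1−uz²−(1−uz)z q^n)/[(q;q)_n (z;q)_{n+1}], as an identity of rational functions in u, z and q over ℚ. -/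
noncomputable section

namespace Stmt8

/-- The field `ℚ(u, z, q)` of rational functions in three variables over `ℚ`. -/
abbrev F : Type := FractionRing (MvPolynomial (Fin 3) ℚ)

/-- The variable `u`. -/
def u : F := algebraMap (MvPolynomial (Fin 3) ℚ) F (MvPolynomial.X 0)

/-- The variable `z`. -/
def z : F := algebraMap (MvPolynomial (Fin 3) ℚ) F (MvPolynomial.X 1)

/-- The variable `q`. -/
def q : F := algebraMap (MvPolynomial (Fin 3) ℚ) F (MvPolynomial.X 2)

/-- `(a; b)_n`, the finite q-Pochhammer symbol. -/
def qPoch (a b : F) (n : ℕ) : F := ∏ j ∈ Finset.range n, (1 - a * b ^ j)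

section General

variable {K : Type*} [Field K]

/-- The finite q-Pochhammer symbol over an arbitrary field. -/
def qPochhammer (a b : K) (n : ℕ) : K := ∏ j ∈ Finset.range n, (1 - a * b ^ j)

/-- The Gaussian binomial coefficient, defined by its q-Pascal recurrence. -/
def gaussBinom (q : K) : ℕ → ℕ → K
  | _, 0 => 1
  | 0, _ + 1 => 0
  | n + 1, r + 1 => q ^ (r + 1) * gaussBinom q n (r + 1) + gaussBinom q n r

lemma qPochhammer_zero (a b : K) : qPochhammer a b 0 = 1 := by
  simp [qPochhammer]

lemma qPochhammer_succ (a b : K) (n : ℕ) :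
    qPochhammer a b (n + 1) = qPochhammer a b n * (1 - a * b ^ n) :=
  Finset.prod_range_succ _ _

lemma qPochhammer_succ' (a b : K) (n : ℕ) :
    qPochhammer a b (n + 1) = (1 - a) * qPochhammer (a * b) b n := by
  simp [qPochhammer, Finset.prod_range_succ', pow_succ', mul_assoc, mul_comm]

lemma qPochhammer_ne_zero {a b : K} (h : ∀ j : ℕ, 1 - a * b ^ j ≠ 0) (n : ℕ) :
    qPochhammer a b n ≠ 0 :=
  Finset.prod_ne_zero_iff.2 fun j _ => h j

lemma gaussBinom_zero_right (q : K) (n : ℕ) : gaussBinom q n 0 = 1 := by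
  cases n <;> rfl

lemma gaussBinom_succ_succ (q : K) (n r : ℕ) :
    gaussBinom q (n + 1) (r + 1) = q ^ (r + 1) * gaussBinom q n (r + 1) + gaussBinom q n r :=
  rfl

lemma gaussBinom_eq_zero_of_lt (q : K) {n r : ℕ} (h : n < r) : gaussBinom q n r = 0 := by
  induction n generalizing r with
  | zero => obtain ⟨r, rfl⟩ := Nat.exists_eq_add_of_lt h; simp [gaussBinom]
  | succ n ih =>
    obtain ⟨r, rfl⟩ : ∃ s, r = s + 1 := ⟨r - 1, by omega⟩
    rw [gaussBinom_succ_succ, ih (by omega), ih (by omega), mul_zero, add_zero]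

lemma gaussBinom_self (q : K) (n : ℕ) : gaussBinom q n n = 1 := by
  induction n with
  | zero => rfl
  | succ n ih =>
    rw [gaussBinom_succ_succ, gaussBinom_eq_zero_of_lt q (Nat.lt_succ_self n), ih]
    ring

lemma gaussBinom_mul_qPochhammer (q : K) (r k : ℕ) :
    gaussBinom q (r + k) r * (qPochhammer q q r * qPochhammer q q k)
      = qPochhammer q q (r + k) := by
  induction r generalizing k with
  | zero => simp [gaussBinom_zero_right, qPochhammer_zero]
  | succ r ihr =>
    induction k with
    | zero => simp [gaussBinom_self, qPochhammer_zero]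
    | succ k ihk =>
      have h1 := ihr (k + 1)
      rw [show r + 1 + (k + 1) = (r + 1 + k) + 1 by ring, gaussBinom_succ_succ,
        qPochhammer_succ q q (r + 1 + k), qPochhammer_succ q q k]
      rw [show r + (k + 1) = r + 1 + k by ring, qPochhammer_succ q q k] at h1
      rw [qPochhammer_succ q q r] at ihk ⊢
      linear_combination q ^ (r + 1) * (1 - q ^ (k + 1)) * ihk + (1 - q ^ (r + 1)) * h1

/-- A limiting case of the q-Chu–Vandermonde summation. -/
lemma sum_gaussBinom_div_qPochhammer (q x : K) (hx : ∀ j : ℕ, 1 - x * q ^ j ≠ 0) (n : ℕ) :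
    ∑ r ∈ Finset.range (n + 1), gaussBinom q n r * (x ^ r * q ^ (r * (r - 1))) / qPochhammer x q r
      = 1 / qPochhammer x q n := by
  induction n generalizing x with
  | zero => simp [gaussBinom_zero_right, qPochhammer_zero]
  | succ n ih =>
    have hxq : ∀ j : ℕ, 1 - x * q * q ^ j ≠ 0 := fun j => by
      simpa [pow_succ', mul_assoc] using hx (j + 1)
    have hterm : ∀ r : ℕ,
        q ^ r * gaussBinom q n r * (x ^ r * q ^ (r * (r - 1))) / qPochhammer x q r
          + gaussBinom q n r * (x ^ (r + 1) * q ^ ((r + 1) * r)) / qPochhammer x q (r + 1)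
        = gaussBinom q n r * ((x * q) ^ r * q ^ (r * (r - 1))) / qPochhammer (x * q) q r
            / (1 - x) := fun r => by
      have h2 := hx r
      have hE : q ^ ((r + 1) * r) = q ^ (r * (r - 1)) * (q ^ r * q ^ r) := by
        rw [← pow_add, ← pow_add]
        congr 1
        cases r
        · rfl
        · simp only [Nat.add_sub_cancel]; ring
      rw [div_div, mul_comm (qPochhammer (x * q) q r), ← qPochhammer_succ', qPochhammer_succ, hE,
        mul_pow, pow_succ]
      have h2' : 1 - q ^ r * x ≠ 0 := by rwa [mul_comm]
      field_simp
      ring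
    rw [qPochhammer_succ', mul_comm (1 - x), ← div_div, ← ih (x * q) hxq,
      Finset.sum_div, ← Finset.sum_congr rfl fun r _ => hterm r, Finset.sum_add_distrib,
      Finset.sum_range_succ']
    have hshift := Finset.sum_range_succ'
      (fun r => q ^ r * gaussBinom q n r * (x ^ r * q ^ (r * (r - 1))) / qPochhammer x q r) (n + 1)
    rw [Finset.sum_range_succ, gaussBinom_eq_zero_of_lt q (Nat.lt_succ_self n)] at hshift
    simp only [mul_zero, zero_mul, zero_div, add_zero] at hshift
    rw [hshift, add_right_comm, ← Finset.sum_add_distrib]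
    simp [gaussBinom_succ_succ, gaussBinom_zero_right, add_mul, add_div]

lemma sum_div_qPochhammer (q x : K) (hq : ∀ j : ℕ, 1 - q * q ^ j ≠ 0)
    (hx : ∀ j : ℕ, 1 - x * q ^ j ≠ 0) (n : ℕ) :
    ∑ r ∈ Finset.range (n + 1), x ^ r * q ^ (r * (r - 1)) /
        (qPochhammer q q (n - r) * qPochhammer q q r * qPochhammer x q r)
      = 1 / (qPochhammer q q n * qPochhammer x q n) := by
  rw [mul_comm (qPochhammer q q n), ← div_div, ← sum_gaussBinom_div_qPochhammer q x hx n,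
    Finset.sum_div]
  refine Finset.sum_congr rfl fun r hr => ?_
  obtain ⟨k, rfl⟩ := Nat.exists_eq_add_of_le (Nat.lt_succ_iff.1 (Finset.mem_range.1 hr))
  have h := gaussBinom_mul_qPochhammer q r k
  have h1 := qPochhammer_ne_zero hq r
  have h2 := qPochhammer_ne_zero hq k
  have h3 := qPochhammer_ne_zero hq (r + k)
  rw [Nat.add_sub_cancel_left]
  field_simp
  rw [← h]
  ring

lemma bailey_tree_step (u z q : K) (hq0 : q ≠ 0) (hq : ∀ j : ℕ, 1 - q * q ^ j ≠ 0)
    (hz : ∀ j : ℕ, 1 - z * q ^ j ≠ 0) (n : ℕ) :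
    ∑ r ∈ Finset.range (n + 1),
      (z / q) ^ r * q ^ (r ^ 2) / qPochhammer q q (n - r) *
        ((1 - u * z - (1 - u) * z * q ^ r) / (qPochhammer q q r * qPochhammer z q (r + 1)))
      = (1 - u * z ^ 2 - (1 - u * z) * z * q ^ n) /
        (qPochhammer q q n * qPochhammer z q (n + 1)) := by
  have hsplit : ∀ r : ℕ,
      (z / q) ^ r * q ^ (r ^ 2) / qPochhammer q q (n - r) *
        ((1 - u * z - (1 - u) * z * q ^ r) / (qPochhammer q q r * qPochhammer z q (r + 1)))
      = z ^ r * q ^ (r * (r - 1)) /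
          (qPochhammer q q (n - r) * qPochhammer q q r * qPochhammer z q r)
        - u * z * (z ^ r * q ^ (r * (r - 1)) * (1 - q ^ r) /
          (qPochhammer q q (n - r) * qPochhammer q q r * qPochhammer z q (r + 1))) := fun r => by
    have h4 := hz r
    have hE : (z / q) ^ r * q ^ (r ^ 2) = z ^ r * q ^ (r * (r - 1)) := by
      have : q ^ (r ^ 2) = q ^ (r * (r - 1)) * q ^ r := by
        rw [← pow_add]
        congr 1
        cases r
        · rfl
        · simp only [Nat.add_sub_cancel]; ring
      rw [this, div_pow]
      field_simp
    rw [hE, qPochhammer_succ]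
    field_simp
    ring
  rw [Finset.sum_congr rfl fun r _ => hsplit r, Finset.sum_sub_distrib, ← Finset.mul_sum,
    sum_div_qPochhammer q z hq hz, Finset.sum_range_succ']
  have h4 := hz n
  cases n with
  | zero =>
    simp only [qPochhammer_succ, qPochhammer_zero, pow_zero, mul_one, one_mul] at h4 ⊢
    simp only [Finset.range_zero, Finset.sum_empty, sub_self, mul_zero, zero_div, add_zero,
      sub_zero]
    field_simp
    ring
  | succ m =>
    have hzqq : ∀ j : ℕ, 1 - z * q * q * q ^ j ≠ 0 := fun j => by
      simpa [pow_succ', mul_assoc] using hz (j + 2)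
    have hterm : ∀ r : ℕ,
        z ^ (r + 1) * q ^ ((r + 1) * (r + 1 - 1)) * (1 - q ^ (r + 1)) /
          (qPochhammer q q (m + 1 - (r + 1)) * qPochhammer q q (r + 1) *
            qPochhammer z q (r + 1 + 1))
        = z / ((1 - z) * (1 - z * q)) * ((z * q * q) ^ r * q ^ (r * (r - 1)) /
          (qPochhammer q q (m - r) * qPochhammer q q r * qPochhammer (z * q * q) q r)) :=
        fun r => by
      have g4 := hq r
      have hE : q ^ ((r + 1) * r) = q ^ (r * (r - 1)) * (q ^ r * q ^ r) := by
        rw [← pow_add, ← pow_add]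
        congr 1
        cases r
        · rfl
        · simp only [Nat.add_sub_cancel]; ring
      rw [Nat.add_sub_add_right m 1 r, Nat.add_sub_cancel r 1, hE, qPochhammer_succ q q r,
        qPochhammer_succ' z, qPochhammer_succ' (z * q)]
      rw [pow_succ' q r, pow_succ z r, mul_pow, mul_pow]
      generalize qPochhammer (z * q * q) q r = A at *
      generalize 1 - z * q = c at *
      generalize 1 - q * q ^ r = d at *
      field_simp
    have g4 := hq m
    have hlast : qPochhammer z q (m + 1) * (1 - z * q ^ (m + 1))
        = (1 - z) * ((1 - z * q) * qPochhammer (z * q * q) q m) := by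
      rw [← qPochhammer_succ, qPochhammer_succ', qPochhammer_succ']
    have hfirst : 1 / (qPochhammer q q (m + 1) * qPochhammer z q (m + 1))
        = (1 - z * q ^ (m + 1)) / (qPochhammer q q (m + 1) *
          ((1 - z) * ((1 - z * q) * qPochhammer (z * q * q) q m))) := by
      rw [← hlast]
      field_simp
    rw [Finset.sum_congr rfl fun r _ => hterm r, ← Finset.mul_sum,
      sum_div_qPochhammer q _ hq hzqq, hfirst, qPochhammer_succ z q (m + 1), hlast, qPochhammer_succ q q m]
    simp only [pow_zero, sub_self, mul_zero, zero_div, add_zero]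
    rw [pow_succ' q m]
    field_simp
    ring

end General

lemma one_sub_algebraMap_ne_zero {p : MvPolynomial (Fin 3) ℚ}
    (hp : MvPolynomial.constantCoeff p = 0) :
    1 - algebraMap (MvPolynomial (Fin 3) ℚ) F p ≠ 0 := by
  rw [← map_one (algebraMap (MvPolynomial (Fin 3) ℚ) F), ← map_sub]
  intro h
  have h0 := (map_eq_zero_iff _ (IsFractionRing.injective (MvPolynomial (Fin 3) ℚ) F)).1 h
  simpa [hp] using congrArg MvPolynomial.constantCoeff h0

lemma q_ne_zero : q ≠ 0 := fun h =>
  MvPolynomial.X_ne_zero (2 : Fin 3)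
    ((map_eq_zero_iff _ (IsFractionRing.injective (MvPolynomial (Fin 3) ℚ) F)).1 h)

lemma one_sub_q_mul_pow_ne_zero (j : ℕ) : 1 - q * q ^ j ≠ 0 := by
  rw [q, ← map_pow, ← map_mul]
  exact one_sub_algebraMap_ne_zero (by simp)

lemma one_sub_z_mul_pow_ne_zero (j : ℕ) : 1 - z * q ^ j ≠ 0 := by
  rw [q, z, ← map_pow, ← map_mul]
  exact one_sub_algebraMap_ne_zero (by simp)

/-- The second branch of the `A₁` Bailey tree (Lemma 3.3(b) of the paper):
`Σ_{r=0}^n 𝒦_{n;r}(z/q;q) Φ_r(u;z;q) = Φ_n(uz;z;q)` as rational functions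
in `u, z, q`. -/
theorem A1_bailey_tree_step (n : ℕ) :
    ∑ r ∈ Finset.range (n + 1),
      (z / q) ^ r * q ^ (r ^ 2) / qPoch q q (n - r) *
        ((1 - u * z - (1 - u) * z * q ^ r) / (qPoch q q r * qPoch z q (r + 1)))
      = (1 - u * z ^ 2 - (1 - u * z) * z * q ^ n) / (qPoch q q n * qPoch z q (n + 1)) :=
  bailey_tree_step u z q q_ne_zero one_sub_q_mul_pow_ne_zero one_sub_z_mul_pow_ne_zero n

end Stmt8
end
end

section
/- Proposition (A₂ matrix inversion). For integers n, m, N, M with n ≥ N and m ≥ M, Σ_{r=N}^n Σ_{s=M}^m q^{n+m−r−s} · Φ_{n−r, m−s}(z q^{2r−s}, w q^{2s−r}; q) · Φ_{r−N, s−M}(z q^{2r−s}, w q^{2s−r}; q^{−1}) = δ_{n,N} δ_{m,M}, as an identity of rational functions in z, w, q over ℚ, where δ is the Kronecker delta. -/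
noncomputable section

namespace Stmt10

/-- The field `ℚ(z, w, q)` of rational functions in three variables over `ℚ`. -/
abbrev F : Type := FractionRing (MvPolynomial (Fin 3) ℚ)

/-- The variable `z`. -/
def z : F := algebraMap (MvPolynomial (Fin 3) ℚ) F (MvPolynomial.X 0)

/-- The variable `w`. -/
def w : F := algebraMap (MvPolynomial (Fin 3) ℚ) F (MvPolynomial.X 1)

/-- The variable `q`. -/
def q : F := algebraMap (MvPolynomial (Fin 3) ℚ) F (MvPolynomial.X 2)

/-- `(a; b)_n`, the finite q-Pochhammer symbol. -/
def qPoch (a b : F) (n : ℕ) : F := ∏ j ∈ Finset.range n, (1 - a * b ^ j)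

/-- `Φ_{n,m}(z,w;q) = (zwq;q)_{n+m}/((q,zq,zwq;q)_n (q,wq,zwq;q)_m)`. -/
def Phi (n m : ℕ) (zz ww qq : F) : F :=
  qPoch (zz * ww * qq) qq (n + m) /
    ((qPoch qq qq n * qPoch (zz * qq) qq n * qPoch (zz * ww * qq) qq n) *
      (qPoch qq qq m * qPoch (ww * qq) qq m * qPoch (zz * ww * qq) qq m))

/-- Conditions on `p, Z, W` guaranteeing that no denominator of `Phi` in base `p` vanishes. -/
structure Generic (Z W p : F) : Prop where
  base_ne_zero : p ≠ 0
  base_zpow : ∀ k : ℤ, k ≠ 0 → 1 - p ^ k ≠ 0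
  left : ∀ k : ℤ, 1 - Z * p ^ k ≠ 0
  right : ∀ k : ℤ, 1 - W * p ^ k ≠ 0
  both : ∀ k : ℤ, 1 - Z * W * p ^ k ≠ 0

/-- `Phi` extended by zero to integer indices. -/
def PhiInt (a b : ℤ) (Z W p : F) : F :=
  if 0 ≤ a ∧ 0 ≤ b then Phi a.toNat b.toNat Z W p else 0

lemma PhiInt_of_nonneg {a b : ℤ} (ha : 0 ≤ a) (hb : 0 ≤ b) (Z W p : F) :
    PhiInt a b Z W p = Phi a.toNat b.toNat Z W p := if_pos ⟨ha, hb⟩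

lemma PhiInt_of_left_neg {a : ℤ} (ha : a < 0) (b : ℤ) (Z W p : F) : PhiInt a b Z W p = 0 :=
  if_neg fun h => absurd h.1 (not_le.2 ha)

lemma PhiInt_of_right_neg (a : ℤ) {b : ℤ} (hb : b < 0) (Z W p : F) : PhiInt a b Z W p = 0 :=
  if_neg fun h => absurd h.2 (not_le.2 hb)

lemma PhiInt_zero_zero (Z W p : F) : PhiInt 0 0 Z W p = 1 := by
  simp [PhiInt, Phi, qPoch]

lemma qPoch_succ (a b : F) (n : ℕ) : qPoch a b (n + 1) = qPoch a b n * (1 - a * b ^ n) :=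
  Finset.prod_range_succ _ _

lemma qPoch_ne_zero {a b : F} (h : ∀ k : ℕ, 1 - a * b ^ k ≠ 0) (n : ℕ) : qPoch a b n ≠ 0 :=
  Finset.prod_ne_zero_iff.2 fun j _ => h j

lemma Phi_comm (a b : ℕ) (Z W p : F) : Phi a b Z W p = Phi b a W Z p := by
  simp only [Phi, mul_comm W Z, add_comm b a]
  congr 1
  ring

lemma PhiInt_comm (a b : ℤ) (Z W p : F) : PhiInt a b Z W p = PhiInt b a W Z p := by
  simp only [PhiInt, Phi_comm a.toNat, and_comm]

lemma Generic.symm {Z W p : F} (h : Generic Z W p) : Generic W Z p :=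
  ⟨h.1, h.2, h.4, h.3, by simpa only [mul_comm W Z] using h.5⟩

lemma Phi_succ_left {Z W p : F} (h : Generic Z W p) (a b : ℕ) :
    (1 - Z * W * p ^ (a + 1 + b)) * Phi a b Z W p =
      (1 - p ^ (a + 1)) * (1 - Z * p ^ (a + 1)) * (1 - Z * W * p ^ (a + 1)) *
        Phi (a + 1) b Z W p := by
  have base (k : ℕ) : 1 - p * p ^ k ≠ 0 := by
    have := h.base_zpow (k + 1) (by omega)
    rwa [zpow_add_one₀ h.base_ne_zero, zpow_natCast, mul_comm] at this
  have shift {c : F} (hc : ∀ k : ℤ, 1 - c * p ^ k ≠ 0) (k : ℕ) : 1 - c * p * p ^ k ≠ 0 := by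
    have := hc (k + 1)
    rwa [zpow_add_one₀ h.base_ne_zero, zpow_natCast, mul_comm (p ^ k), ← mul_assoc] at this
  have h1 := qPoch_ne_zero base
  have h2 := qPoch_ne_zero (shift h.left)
  have h3 := qPoch_ne_zero (shift h.right)
  have h4 := qPoch_ne_zero (shift h.both)
  have e1 := base a
  have e2 := shift h.left a
  have e3 := shift h.both a
  have hp (c : F) (k : ℕ) : c * p * p ^ k = c * p ^ (k + 1) := by ring
  have hp' (k : ℕ) : p * p ^ k = p ^ (k + 1) := by ring
  simp only [Phi, add_right_comm a 1 b, qPoch_succ]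
  simp only [hp, hp'] at e1 e2 e3 ⊢
  have := h1 a; have := h1 b; have := h2 a; have := h3 b; have := h4 a; have := h4 b
  field_simp

lemma PhiInt_sub_one_left {Z W p : F} (h : Generic Z W p) (a b : ℤ) :
    (1 - Z * W * p ^ (a + b)) * PhiInt (a - 1) b Z W p =
      (1 - p ^ a) * (1 - Z * p ^ a) * (1 - Z * W * p ^ a) * PhiInt a b Z W p := by
  rcases lt_or_ge b 0 with hb | hb
  · simp [PhiInt_of_right_neg _ hb]
  rcases lt_trichotomy a 0 with ha | rfl | ha
  · rw [PhiInt_of_left_neg ha, PhiInt_of_left_neg (by omega), mul_zero, mul_zero]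
  · rw [PhiInt_of_left_neg (by omega)]
    simp
  · obtain ⟨b, rfl⟩ := Int.eq_ofNat_of_zero_le hb
    obtain ⟨a, rfl⟩ : ∃ k : ℕ, a = k + 1 := ⟨(a - 1).toNat, by omega⟩
    rw [PhiInt_of_nonneg (by omega) hb, PhiInt_of_nonneg ha.le hb]
    have := Phi_succ_left h a b
    rw [show ((a : ℤ) + 1 - 1).toNat = a by omega, show ((a : ℤ) + 1).toNat = a + 1 by omega,
      Int.toNat_natCast]
    exact_mod_cast this

lemma PhiInt_sub_one_right {Z W p : F} (h : Generic Z W p) (a b : ℤ) :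
    (1 - Z * W * p ^ (a + b)) * PhiInt a (b - 1) Z W p =
      (1 - p ^ b) * (1 - W * p ^ b) * (1 - Z * W * p ^ b) * PhiInt a b Z W p := by
  have := PhiInt_sub_one_left h.symm b a
  rwa [PhiInt_comm, PhiInt_comm b, mul_comm W Z, add_comm b] at this

/-- `Phi` is an eigenfunction of a first-order difference operator in its two indices. -/
lemma PhiInt_eigen {Z W p : F} (h : Generic Z W p) (a b : ℤ) :
    (1 + Z + Z * W) * PhiInt a b Z W p =
      (p ^ (-a) + Z * p ^ (a - b) + Z * W * p ^ b) * PhiInt a b Z W p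
        - p ^ (-a) * PhiInt (a - 1) b Z W p - Z * p ^ (a - b) * PhiInt a (b - 1) Z W p := by
  have hA := PhiInt_sub_one_left h a b
  have hB := PhiInt_sub_one_right h a b
  have hp := h.base_ne_zero
  apply mul_left_cancel₀ (h.both (a + b))
  rw [zpow_neg, zpow_sub₀ hp]
  rw [zpow_add₀ hp] at hA hB ⊢
  have ha : p ^ a ≠ 0 := zpow_ne_zero _ hp
  have hb : p ^ b ≠ 0 := zpow_ne_zero _ hp
  generalize p ^ a = x at *
  generalize p ^ b = y at *
  have key : (1 - Z * W * (x * y)) * ((x⁻¹ + Z * (x / y) + Z * W * y) - (1 + Z + Z * W)) =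
      x⁻¹ * ((1 - x) * (1 - Z * x) * (1 - Z * W * x)) +
        Z * (x / y) * ((1 - y) * (1 - W * y) * (1 - Z * W * y)) := by
    field_simp
    ring
  linear_combination x⁻¹ * hA + Z * (x / y) * hB - PhiInt a b Z W p * key

lemma eval_eq_of_algebraMap_eq {P Q : MvPolynomial (Fin 3) ℚ}
    (h : algebraMap _ F P = algebraMap _ F Q) (v : Fin 3 → ℚ) :
    MvPolynomial.eval v P = MvPolynomial.eval v Q := by
  rw [IsFractionRing.injective (MvPolynomial (Fin 3) ℚ) F h]

lemma q_ne_zero : q ≠ 0 := fun h => by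
  have := eval_eq_of_algebraMap_eq (P := MvPolynomial.X 2) (Q := 0) (by rw [map_zero]; exact h) 1
  simp at this

lemma exists_eval_mul_two_pow_eq {P : MvPolynomial (Fin 3) ℚ} {k : ℤ}
    (h : algebraMap _ F P * q ^ k = 1) : ∃ a b : ℕ, k = a - b ∧
      MvPolynomial.eval ![0, 0, 2] P * 2 ^ a = 2 ^ b := by
  refine ⟨k.toNat, (-k).toNat, by omega, ?_⟩
  have hk : q ^ k = q ^ k.toNat / q ^ (-k).toNat := by
    rw [← zpow_natCast, ← zpow_natCast, ← zpow_sub₀ q_ne_zero]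
    congr 1
    omega
  rw [hk, ← mul_div_assoc, div_eq_one_iff_eq (pow_ne_zero _ q_ne_zero)] at h
  have := eval_eq_of_algebraMap_eq (P := P * MvPolynomial.X 2 ^ k.toNat)
    (Q := MvPolynomial.X 2 ^ (-k).toNat) (by simpa [q] using h) ![0, 0, 2]
  simpa using this

lemma one_sub_mul_q_zpow_ne_zero {P : MvPolynomial (Fin 3) ℚ}
    (hP : MvPolynomial.eval ![0, 0, 2] P = 0) (k : ℤ) : 1 - algebraMap _ F P * q ^ k ≠ 0 := by
  intro h
  obtain ⟨a, b, -, h⟩ := exists_eval_mul_two_pow_eq (sub_eq_zero.1 h).symm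
  rw [hP, zero_mul] at h
  exact pow_ne_zero b two_ne_zero h.symm

lemma generic_shift (r s : ℤ) :
    Generic (z * q ^ (2 * r - s)) (w * q ^ (2 * s - r)) q where
  base_ne_zero := q_ne_zero
  base_zpow k hk hone := by
    obtain ⟨a, b, rfl, h⟩ := exists_eval_mul_two_pow_eq (P := 1) (k := k)
      (by simpa using (sub_eq_zero.1 hone).symm)
    rw [map_one, one_mul] at h
    have := pow_right_injective₀ (two_pos (α := ℚ)) (by norm_num) h
    omega
  left k := by
    rw [mul_assoc, ← zpow_add₀ q_ne_zero]
    exact one_sub_mul_q_zpow_ne_zero (P := MvPolynomial.X 0) (by simp) _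
  right k := by
    rw [mul_assoc, ← zpow_add₀ q_ne_zero]
    exact one_sub_mul_q_zpow_ne_zero (P := MvPolynomial.X 1) (by simp) _
  both k := by
    rw [mul_mul_mul_comm, mul_assoc, ← zpow_add₀ q_ne_zero, ← zpow_add₀ q_ne_zero]
    have := one_sub_mul_q_zpow_ne_zero (P := MvPolynomial.X 0 * MvPolynomial.X 1) (by simp)
      (2 * r - s + (2 * s - r) + k)
    rwa [map_mul] at this

lemma Generic.inv {Z W p : F} (h : Generic Z W p) : Generic Z W p⁻¹ where
  base_ne_zero := inv_ne_zero h.base_ne_zero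
  base_zpow k hk := by simpa using h.base_zpow (-k) (neg_ne_zero.2 hk)
  left k := by simpa using h.left (-k)
  right k := by simpa using h.right (-k)
  both k := by simpa using h.both (-k)

/-- The eigenvalues of the difference operator. -/
def eigenval (r s : ℤ) : F := q ^ (-r) + z * q ^ (r - s) + z * w * q ^ s

lemma eigenval_injective {r s r' s' : ℤ} (h : eigenval r s = eigenval r' s') :
    r = r' ∧ s = s' := by
  obtain ⟨K, h₁, h₂, h₃, h₁', h₂', h₃'⟩ : ∃ K : ℤ, 0 ≤ K + -r ∧ 0 ≤ K + (r - s) ∧ 0 ≤ K + s ∧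
      0 ≤ K + -r' ∧ 0 ≤ K + (r' - s') ∧ 0 ≤ K + s' :=
    ⟨r.natAbs + s.natAbs + r'.natAbs + s'.natAbs, by omega⟩
  have lift (k : ℤ) (hk : 0 ≤ K + k) : q ^ K * q ^ k = q ^ (K + k).toNat := by
    rw [← zpow_add₀ q_ne_zero, ← zpow_natCast, Int.toNat_of_nonneg hk]
  have hscaled (r s : ℤ) (h₁ : 0 ≤ K + -r) (h₂ : 0 ≤ K + (r - s)) (h₃ : 0 ≤ K + s) :
      q ^ K * eigenval r s = algebraMap (MvPolynomial (Fin 3) ℚ) F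
        (MvPolynomial.X 2 ^ (K + -r).toNat +
          MvPolynomial.X 0 * MvPolynomial.X 2 ^ (K + (r - s)).toNat +
          MvPolynomial.X 0 * MvPolynomial.X 1 * MvPolynomial.X 2 ^ (K + s).toNat) := by
    simp only [map_add, map_mul, map_pow]
    change _ = q ^ _ + z * q ^ _ + z * w * q ^ _
    rw [← lift _ h₁, ← lift _ h₂, ← lift _ h₃, eigenval]
    ring
  have heval := eval_eq_of_algebraMap_eq
    ((hscaled r s h₁ h₂ h₃).symm.trans ((congrArg _ h).trans (hscaled r' s' h₁' h₂' h₃')))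
  have e₁ := heval ![0, 0, 2]
  have e₂ := heval ![1, 0, 2]
  simp only [map_add, map_mul, map_pow, MvPolynomial.eval_X, Matrix.cons_val, zero_mul, mul_zero,
    add_zero, one_mul] at e₁ e₂
  rw [e₁, add_right_inj] at e₂
  have inj := pow_right_injective₀ (two_pos (α := ℚ)) (by norm_num)
  have := inj e₁
  have := inj e₂
  omega

/-- The entries of the matrix to be inverted. -/
def matF (n m r s : ℤ) : F :=
  q ^ (n + m - r - s) * PhiInt (n - r) (m - s) (z * q ^ (2 * r - s)) (w * q ^ (2 * s - r)) q

/-- The entries of the inverse matrix. -/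
def matG (r s N M : ℤ) : F :=
  PhiInt (r - N) (s - M) (z * q ^ (2 * r - s)) (w * q ^ (2 * s - r)) q⁻¹

lemma matF_eigen (n m r s : ℤ) :
    eigenval r s * matF n m r s = eigenval n m * matF n m r s
      - q ^ (1 - n) * matF (n - 1) m r s - z * q ^ (n - m + 1) * matF n (m - 1) r s := by
  have h := PhiInt_eigen (generic_shift r s) (n - r) (m - s)
  have hq := q_ne_zero
  unfold matF eigenval
  rw [show n - 1 - r = n - r - 1 by ring, show m - 1 - s = m - s - 1 by ring]
  generalize PhiInt (n - r) (m - s) _ _ _ = A at *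
  generalize PhiInt (n - r - 1) (m - s) _ _ _ = B at *
  generalize PhiInt (n - r) (m - s - 1) _ _ _ = C at *
  simp only [two_mul, zpow_sub₀ hq, zpow_add₀ hq, zpow_neg, zpow_one] at h ⊢
  have hn : q ^ n ≠ 0 := zpow_ne_zero _ hq
  have hm : q ^ m ≠ 0 := zpow_ne_zero _ hq
  have hr : q ^ r ≠ 0 := zpow_ne_zero _ hq
  have hs : q ^ s ≠ 0 := zpow_ne_zero _ hq
  generalize q ^ n = x at *
  generalize q ^ m = y at *
  generalize q ^ r = u at *
  generalize q ^ s = v at *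
  field_simp at h ⊢
  linear_combination h

lemma matG_eigen (r s N M : ℤ) :
    eigenval r s * matG r s N M = eigenval N M * matG r s N M
      - q ^ (-N) * matG r s (N + 1) M - z * q ^ (N - M) * matG r s N (M + 1) := by
  have h := PhiInt_eigen (generic_shift r s).inv (r - N) (s - M)
  have hq := q_ne_zero
  unfold matG eigenval
  rw [show r - (N + 1) = r - N - 1 by ring, show s - (M + 1) = s - M - 1 by ring]
  generalize PhiInt (r - N) (s - M) _ _ _ = A at *
  generalize PhiInt (r - N - 1) (s - M) _ _ _ = B at *
  generalize PhiInt (r - N) (s - M - 1) _ _ _ = C at *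
  simp only [two_mul, inv_zpow, zpow_sub₀ hq, zpow_add₀ hq, zpow_neg] at h ⊢
  have hn : q ^ N ≠ 0 := zpow_ne_zero _ hq
  have hm : q ^ M ≠ 0 := zpow_ne_zero _ hq
  have hr : q ^ r ≠ 0 := zpow_ne_zero _ hq
  have hs : q ^ s ≠ 0 := zpow_ne_zero _ hq
  generalize q ^ N = x at *
  generalize q ^ M = y at *
  generalize q ^ r = u at *
  generalize q ^ s = v at *
  field_simp at h ⊢
  linear_combination h

lemma sum_Icc_sub_shift (H : ℤ → F) {a b : ℤ} (hab : a ≤ b) :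
    ∑ i ∈ Finset.Icc a b, (H i - H (i + 1)) = H a - H (b + 1) := by
  induction b, hab using Int.leInduction with
  | base => simp
  | succ b hab ih =>
    rw [← Finset.insert_Icc_right_eq_Icc_add_one (by omega), Finset.sum_insert (by simp), ih]
    ring

lemma sum_matG_mul_matF {n m N M : ℤ} (hn : N ≤ n) (hm : M ≤ m) {r s r' s' : ℤ}
    (hr : r ≤ n) (hs : s ≤ m) (hr' : N ≤ r') (hs' : M ≤ s') :
    ∑ i ∈ Finset.Icc N n, ∑ j ∈ Finset.Icc M m, matG r s i j * matF i j r' s' *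
      (eigenval r s - eigenval r' s') = 0 := by
  let H (i j : ℤ) : F := q ^ (1 - i) * matG r s i j * matF (i - 1) j r' s'
  let K (i j : ℤ) : F := z * q ^ (i - j + 1) * matG r s i j * matF i (j - 1) r' s'
  have hterm (i j : ℤ) : matG r s i j * matF i j r' s' * (eigenval r s - eigenval r' s') =
      (H i j - H (i + 1) j) + (K i j - K i (j + 1)) := by
    have hF := matF_eigen i j r' s'
    have hG := matG_eigen r s i j
    simp only [H, K, add_sub_cancel_right, show 1 - (i + 1) = -i by ring,
      show i - (j + 1) + 1 = i - j by ring]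
    linear_combination matF i j r' s' * hG - matG r s i j * hF
  simp only [hterm, Finset.sum_add_distrib]
  rw [Finset.sum_comm]
  simp only [sum_Icc_sub_shift _ hm, sum_Icc_sub_shift (fun i => H i _) hn]
  have hH₁ (j : ℤ) : H N j = 0 := by
    simp [H, matF, PhiInt_of_left_neg (show N - 1 - r' < 0 by omega)]
  have hH₂ (j : ℤ) : H (n + 1) j = 0 := by
    simp [H, matG, PhiInt_of_left_neg (show r - (n + 1) < 0 by omega)]
  have hK₁ (i : ℤ) : K i M = 0 := by
    simp [K, matF, PhiInt_of_right_neg _ (show M - 1 - s' < 0 by omega)]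
  have hK₂ (i : ℤ) : K i (m + 1) = 0 := by
    simp [K, matG, PhiInt_of_right_neg _ (show s - (m + 1) < 0 by omega)]
  simp [hH₁, hH₂, hK₁, hK₂]

lemma matG_mul_matF_self {r s i j : ℤ} (h : ¬ (i = r ∧ j = s)) :
    matG r s i j * matF i j r s = 0 := by
  rcases lt_trichotomy i r with hi | rfl | hi
  · simp [matF, PhiInt_of_left_neg (sub_neg.2 hi)]
  · rcases lt_trichotomy j s with hj | rfl | hj
    · simp [matF, PhiInt_of_right_neg _ (sub_neg.2 hj)]
    · simp at h
    · simp [matG, PhiInt_of_right_neg _ (sub_neg.2 hj)]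
  · simp [matG, PhiInt_of_left_neg (sub_neg.2 hi)]

/-- The `A₂` matrix inversion (Proposition 4.1 of the paper), as an identity of
rational functions in `z, w, q`. -/
theorem A2_matrix_inversion (n m N M : ℤ) (hn : N ≤ n) (hm : M ≤ m) :
    (∑ r ∈ Finset.Icc N n, ∑ s ∈ Finset.Icc M m,
      q ^ (n + m - r - s) *
        Phi (n - r).toNat (m - s).toNat (z * q ^ (2 * r - s)) (w * q ^ (2 * s - r)) q *
        Phi (r - N).toNat (s - M).toNat (z * q ^ (2 * r - s)) (w * q ^ (2 * s - r)) q⁻¹)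
      = if n = N ∧ m = M then 1 else 0 := by
  classical
  let B := Finset.Icc N n ×ˢ Finset.Icc M m
  let A : Matrix B B F := Matrix.of fun x y => matF x.1.1 x.1.2 y.1.1 y.1.2
  let A' : Matrix B B F := Matrix.of fun x y => matG x.1.1 x.1.2 y.1.1 y.1.2
  have hmul : A' * A = 1 := by
    ext ⟨⟨r, s⟩, hx⟩ ⟨⟨r', s'⟩, hy⟩
    have hx' := hx
    have hy' := hy
    simp only [B, Finset.mem_product, Finset.mem_Icc] at hx' hy'
    rw [Matrix.mul_apply, Matrix.one_apply]
    change ∑ x : B, (fun p : ℤ × ℤ => matG r s p.1 p.2 * matF p.1 p.2 r' s') x.1 = _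
    rw [Finset.sum_coe_sort B (fun p : ℤ × ℤ => matG r s p.1 p.2 * matF p.1 p.2 r' s')]
    by_cases h : r = r' ∧ s = s'
    · obtain ⟨rfl, rfl⟩ := h
      rw [if_pos rfl, Finset.sum_eq_single_of_mem (r, s) hx fun p _ hp =>
        matG_mul_matF_self fun h => hp (Prod.ext h.1 h.2)]
      simp [matG, matF, PhiInt_zero_zero]
    · rw [if_neg (by simpa using h), Finset.sum_product]
      have := sum_matG_mul_matF hn hm hx'.1.2 hx'.2.2 hy'.1.1 hy'.2.1
      simp only [← Finset.sum_mul] at this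
      exact (mul_eq_zero.1 this).resolve_right
        (sub_ne_zero.2 fun e => h (eigenval_injective e))
  have hmul' : A * A' = 1 := mul_eq_one_comm.1 hmul
  have hentry := congrFun (congrFun hmul'
    ⟨(n, m), by simp [B, hn, hm]⟩) ⟨(N, M), by simp [B, hn, hm]⟩
  rw [Matrix.mul_apply, Matrix.one_apply] at hentry
  change ∑ x : B, (fun p : ℤ × ℤ => matF n m p.1 p.2 * matG p.1 p.2 N M) x.1 = _ at hentry
  rw [Finset.sum_coe_sort B (fun p : ℤ × ℤ => matF n m p.1 p.2 * matG p.1 p.2 N M),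
    Finset.sum_product] at hentry
  simp only [Subtype.mk.injEq, Prod.mk.injEq] at hentry
  rw [← hentry]
  refine Finset.sum_congr rfl fun r hr => Finset.sum_congr rfl fun s hs => ?_
  rw [Finset.mem_Icc] at hr hs
  rw [matF, matG, PhiInt_of_nonneg (sub_nonneg.2 hr.2) (sub_nonneg.2 hs.2),
    PhiInt_of_nonneg (sub_nonneg.2 hr.1) (sub_nonneg.2 hs.1)]

end Stmt10
end
end
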